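/- For every good word g, the lexicographically largest word occurring with nonzero coefficient in r_g = Ξ([g]) is g itself: max(r_g) = g. -/

import Mathlib

open scoped BigOperators

noncomputable section

/-- The field `ℚ(q)` of rational functions over `ℚ`. -/
abbrev K : Type := RatFunc ℚ

/-- The indeterminate `q`. -/
abbrev qq : K := RatFunc.X

/-- Words on the alphabet `{w_1, …, w_r}` (the free monoid `M`). -/
abbrev Word (r : ℕ) := List (Fin r)

/-- The space `F` with basis the words, as finitely supported families of coefficients. -/
abbrev FA (r : ℕ) := Word r →₀ K

variable {r : ℕ}

/-- `(|w|, |x|)` : the symmetric bilinear form evaluated on the degrees of two words,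
where `p i j = (α_i, α_j)` is the form on simple roots. -/
def pairW (p : Fin r → Fin r → ℤ) (w x : Word r) : ℤ :=
  (w.map fun i => (x.map fun j => p i j).sum).sum

/-- Auxiliary q-shuffle on *reversed* words:
`shAux p w x` is the q-shuffle of `w.reverse` and `x.reverse`; it implements the recursion
`(w·a) * (x·b) = (w * (x·b))·a + q^{-(|w·a|,|b|)} ((w·a) * x)·b`, `w[] * x = x * w[] = x`. -/
def shAux (p : Fin r → Fin r → ℤ) : Word r → Word r → FA r
  | [], x => Finsupp.single x.reverse 1
  | w, [] => Finsupp.single w.reverse 1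
  | a :: w, b :: x =>
      Finsupp.mapDomain (fun u => u ++ [a]) (shAux p w (b :: x))
      + (qq ^ (-(pairW p (a :: w) [b]))) •
          Finsupp.mapDomain (fun u => u ++ [b]) (shAux p (a :: w) x)
  termination_by w x => w.length + x.length
  decreasing_by all_goals (first | (simp only [List.length_cons]; omega) | omega)

/-- The q-shuffle product `*` on `F`, extended bilinearly from words. -/
def shuffle (p : Fin r → Fin r → ℤ) (f g : FA r) : FA r :=
  f.sum fun w c => g.sum fun x d => (c * d) • shAux p w.reverse x.reverse

/-- Membership in `𝒰`, the `ℚ(q)`-subalgebra of `(F, *)` generated by the letters `w_i`. -/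
inductive InU (p : Fin r → Fin r → ℤ) : FA r → Prop
  | letter (i : Fin r) : InU p (Finsupp.single [i] 1)
  | one : InU p (Finsupp.single ([] : Word r) 1)
  | add : ∀ {f g : FA r}, InU p f → InU p g → InU p (f + g)
  | smul : ∀ (c : K) {f : FA r}, InU p f → InU p (c • f)
  | mul : ∀ {f g : FA r}, InU p f → InU p g → InU p (shuffle p f g)

/-- The degree of a word in `Q⁺`, recorded as the multiplicity of each simple root. -/
def deg (w : Word r) : Fin r → ℕ := fun i => w.count i

/-- `f` is homogeneous of degree `ν`. -/
def Homog (f : FA r) (ν : Fin r → ℕ) : Prop := ∀ w ∈ f.support, deg w = ν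

/-- Lexicographic order on words (a proper left factor is smaller than the word). -/
def wlt (w x : Word r) : Prop := List.Lex (· < ·) w x

def wle (w x : Word r) : Prop := wlt w x ∨ w = x

/-- `g` is the lexicographically largest word occurring (with nonzero coefficient) in `f`. -/
def IsMaxWord (f : FA r) (g : Word r) : Prop :=
  f g ≠ 0 ∧ ∀ w ∈ f.support, wle w g

/-- Good words: words of the form `max(u)` for a nonzero homogeneous `u ∈ 𝒰`. -/
def IsGood (p : Fin r → Fin r → ℤ) (g : Word r) : Prop :=
  ∃ u : FA r, InU p u ∧ (∃ ν, Homog u ν) ∧ IsMaxWord u g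

/-- Lyndon words: nonempty words smaller than all their proper nonempty right factors. -/
def IsLyndon (l : Word r) : Prop :=
  l ≠ [] ∧ ∀ u v : Word r, l = u ++ v → u ≠ [] → v ≠ [] → wlt l v

/-- The concatenation product on `F`. -/
def cmul (f g : FA r) : FA r :=
  f.sum fun w c => g.sum fun x d => Finsupp.single (w ++ x) (c * d)

open scoped Classical in
/-- Length of the longest proper nonempty left factor of `l` which is a Lyndon word. -/
def costdLen (l : Word r) : ℕ :=
  Nat.findGreatest (fun k => 0 < k ∧ k < l.length ∧ IsLyndon (l.take k)) (l.length - 1)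

/-- The iterated q-bracketing `[l]` of a word: `[l] = l` for a letter, and
`[l] = [[l₁],[l₂]]_q = [l₁][l₂] − q^{(|l₁|,|l₂|)}[l₂][l₁]` for the co-standard
factorization `l = l₁ l₂`. -/
def bracket (p : Fin r → Fin r → ℤ) (l : Word r) : FA r :=
  if l.length ≤ 1 then Finsupp.single l 1
  else if hk : 0 < costdLen l ∧ costdLen l < l.length then
    cmul (bracket p (l.take (costdLen l))) (bracket p (l.drop (costdLen l)))
      - qq ^ (pairW p (l.take (costdLen l)) (l.drop (costdLen l))) •
          cmul (bracket p (l.drop (costdLen l))) (bracket p (l.take (costdLen l)))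
  else Finsupp.single l 1
  termination_by l.length
  decreasing_by
    all_goals (first | (simp only [List.length_take, List.length_drop]; omega) | omega)

/-- `[w] = [l₁][l₂]⋯[l_k]` : the concatenation product of the brackets of a list of words. -/
def cprod (p : Fin r → Fin r → ℤ) (ls : List (Word r)) : FA r :=
  (ls.map (bracket p)).foldr cmul (Finsupp.single ([] : Word r) 1)

/-- `Ξ` on a word: the q-shuffle product of its letters. -/
def xiWord (p : Fin r → Fin r → ℤ) : Word r → FA r
  | [] => Finsupp.single ([] : Word r) 1
  | i :: w => shuffle p (Finsupp.single [i] 1) (xiWord p w)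

/-- The linear map `Ξ : (F, concatenation) → (F, *)`, `Ξ(w_{i₁}⋯w_{i_k}) = w_{i₁} * ⋯ * w_{i_k}`. -/
def xi (p : Fin r → Fin r → ℤ) (f : FA r) : FA r :=
  f.sum fun w c => c • xiWord p w

/-- The data of the Cartan matrix `[a_{ij}]` of a finite-dimensional complex simple
Lie algebra of rank `r`: an integral matrix with `2` on the diagonal and nonpositive
off-diagonal entries, symmetrizable by `d_i ∈ {1,2,3}`, whose symmetrization
`(α_i, α_j) = d_i a_{ij}` is positive definite, and which is indecomposable. -/
structure CartanData (r : ℕ) where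
  a : Fin r → Fin r → ℤ
  d : Fin r → ℤ
  diag : ∀ i, a i i = 2
  offdiag : ∀ i j, i ≠ j → a i j ≤ 0
  dval : ∀ i, d i = 1 ∨ d i = 2 ∨ d i = 3
  dsymm : ∀ i j, d i * a i j = d j * a j i
  posdef : ∀ v : Fin r → ℚ, v ≠ 0 → 0 < ∑ i, ∑ j, v i * v j * ((d i * a i j : ℤ) : ℚ)
  indec : ∀ s : Finset (Fin r), s.Nonempty → s ≠ Finset.univ →
    ∃ i ∈ s, ∃ j, j ∉ s ∧ a i j ≠ 0

/-- The symmetric bilinear form `(α_i, α_j) = d_i a_{ij}` on simple roots. -/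
def CartanData.p (C : CartanData r) : Fin r → Fin r → ℤ := fun i j => C.d i * C.a i j

section
set_option linter.all false
/-! ### Part 1 : generic q-shuffle on functions -/

section Generic
variable {k : Type*} [CommRing k]

/-- functions on words -/
abbrev Fn (r : ℕ) (k : Type*) := Word r → k

def Dl (d : Fin r) : Fn r k →ₗ[k] Fn r k where
  toFun u := fun w => u (d :: w)
  map_add' _ _ := rfl
  map_smul' _ _ := rfl

def Dr (c : Fin r) : Fn r k →ₗ[k] Fn r k where
  toFun u := fun w => u (w ++ [c])
  map_add' _ _ := rfl
  map_smul' _ _ := rfl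

def chi (s : Fin r → k) (w : Word r) : k := (w.map s).prod

def mulc (s : Fin r → k) : Fn r k →ₗ[k] Fn r k where
  toFun u := fun w => chi s w * u w
  map_add' u v := by funext w; simp [mul_add]
  map_smul' c u := by funext w; simp; ring

@[simp] lemma Dl_apply (d : Fin r) (u : Fn r k) (w : Word r) : Dl d u w = u (d :: w) := rfl
@[simp] lemma Dr_apply (d : Fin r) (u : Fn r k) (w : Word r) : Dr d u w = u (w ++ [d]) := rfl
@[simp] lemma mulc_apply (s : Fin r → k) (u : Fn r k) (w : Word r) :
    mulc s u w = chi s w * u w := rfl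
@[simp] lemma chi_nil (s : Fin r → k) : chi s [] = 1 := by simp [chi]
@[simp] lemma chi_cons (s : Fin r → k) (a : Fin r) (w : Word r) :
    chi s (a :: w) = s a * chi s w := by simp [chi]
@[simp] lemma chi_append (s : Fin r → k) (v w : Word r) :
    chi s (v ++ w) = chi s v * chi s w := by simp [chi]

lemma Dl_mulc (d : Fin r) (s : Fin r → k) (u : Fn r k) :
    Dl d (mulc s u) = s d • mulc s (Dl d u) := by
  funext w; simp [mul_assoc]

lemma Dr_mulc (d : Fin r) (s : Fin r → k) (u : Fn r k) :
    Dr d (mulc s u) = s d • mulc s (Dr d u) := by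
  funext w; simp; ring

lemma Dl_Dr (d c : Fin r) (u : Fn r k) : Dl d (Dr c u) = Dr c (Dl d u) := rfl

lemma mulc_comm (s s' : Fin r → k) (u : Fn r k) : mulc s (mulc s' u) = mulc s' (mulc s u) := by
  funext w; simp; ring

def shW (t : Fin r → Fin r → k) : Word r → Fn r k → Fn r k → k
  | [], u, v => u [] * v []
  | d :: w, u, v => shW t w (Dl d u) (mulc (t d) v) + shW t w u (Dl d v)

lemma shW_add_left (t : Fin r → Fin r → k) (w : Word r) (u u' v : Fn r k) :
    shW t w (u + u') v = shW t w u v + shW t w u' v := by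
  induction w generalizing u u' v with
  | nil => simp [shW, add_mul]
  | cons d w ih => simp only [shW, map_add, ih]; ring

lemma shW_add_right (t : Fin r → Fin r → k) (w : Word r) (u v v' : Fn r k) :
    shW t w u (v + v') = shW t w u v + shW t w u v' := by
  induction w generalizing u v v' with
  | nil => simp [shW, mul_add]
  | cons d w ih => simp only [shW, map_add, ih]; ring

lemma shW_smul_left (t : Fin r → Fin r → k) (w : Word r) (c : k) (u v : Fn r k) :
    shW t w (c • u) v = c * shW t w u v := by
  induction w generalizing u v with
  | nil => simp [shW, mul_assoc]
  | cons d w ih => simp only [shW, map_smul, ih]; ring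

lemma shW_smul_right (t : Fin r → Fin r → k) (w : Word r) (c : k) (u v : Fn r k) :
    shW t w u (c • v) = c * shW t w u v := by
  induction w generalizing u v with
  | nil => simp [shW]; ring
  | cons d w ih => simp only [shW, map_smul, ih]; ring

/-- the q-shuffle as bilinear map -/
def sh (t : Fin r → Fin r → k) : Fn r k →ₗ[k] Fn r k →ₗ[k] Fn r k :=
  LinearMap.mk₂ k (fun u v w => shW t w u v)
    (fun u u' v => by funext w; exact shW_add_left t w u u' v)
    (fun c u v => by funext w; exact shW_smul_left t w c u v)
    (fun u v v' => by funext w; exact shW_add_right t w u v v')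
    (fun c u v => by funext w; exact shW_smul_right t w c u v)

variable (t : Fin r → Fin r → k)

lemma sh_nil (u v : Fn r k) : sh t u v [] = u [] * v [] := rfl
lemma sh_cons (u v : Fn r k) (d : Fin r) (w : Word r) :
    sh t u v (d :: w) = sh t (Dl d u) (mulc (t d) v) w + sh t u (Dl d v) w := rfl

lemma Dl_sh (d : Fin r) (u v : Fn r k) :
    Dl d (sh t u v) = sh t (Dl d u) (mulc (t d) v) + sh t u (Dl d v) := rfl

lemma fn_ext {u v : Fn r k} (h0 : u [] = v []) (h1 : ∀ d w, u (d :: w) = v (d :: w)) : u = v := by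
  funext w; cases w with
  | nil => exact h0
  | cons d w => exact h1 d w

lemma mulc_sh (s : Fin r → k) (u v : Fn r k) :
    mulc s (sh t u v) = sh t (mulc s u) (mulc s v) := by
  funext w
  induction w generalizing u v with
  | nil => simp [sh_nil]
  | cons d w ih =>
    have h1 := ih (Dl d u) (mulc (t d) v)
    have h2 := ih u (Dl d v)
    simp only [mulc_apply] at h1 h2
    simp only [mulc_apply, sh_cons, chi_cons, Dl_mulc, map_smul, LinearMap.smul_apply,
      Pi.smul_apply, smul_eq_mul, mulc_comm (t d) s, ← h1, ← h2]
    ring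

lemma sh_assoc (u v x : Fn r k) : sh t (sh t u v) x = sh t u (sh t v x) := by
  funext w
  induction w generalizing u v x with
  | nil => simp [sh_nil, mul_assoc]
  | cons d w ih =>
    simp only [sh_cons, Dl_sh, map_add, LinearMap.add_apply, Pi.add_apply, mulc_sh, ih]
    ring

lemma Dr_sh (c : Fin r) (u v : Fn r k) :
    Dr c (sh t u v) = sh t (Dr c u) v + sh t (mulc (fun i => t i c) u) (Dr c v) := by
  funext w
  induction w generalizing u v with
  | nil => simp [sh_nil, sh_cons]
  | cons d w ih =>
    have h1 := ih (Dl d u) (mulc (t d) v)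
    have h2 := ih u (Dl d v)
    simp only [Dr_apply] at h1 h2
    simp only [Dr_apply, List.cons_append, sh_cons, Pi.add_apply, h1, h2, Dr_mulc, Dl_mulc, Dl_Dr,
      map_smul, LinearMap.smul_apply, Pi.smul_apply, smul_eq_mul]
    ring

/-- delta function -/
def de (w : Word r) : Fn r k := fun x => if x = w then 1 else 0

lemma de_apply (w x : Word r) : (de w x : k) = if x = w then 1 else 0 := rfl

lemma Dl_de_nil (d : Fin r) : Dl d (de [] : Fn r k) = 0 := by funext w; simp [de]
lemma Dl_de_cons (d c : Fin r) (w : Word r) :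
    Dl d (de (c :: w) : Fn r k) = if d = c then de w else 0 := by
  funext x; by_cases h : d = c <;> simp [de, h]
lemma Dr_de_nil (d : Fin r) : Dr d (de [] : Fn r k) = 0 := by funext w; simp [de]
lemma Dr_de_append (d c : Fin r) (w : Word r) :
    Dr d (de (w ++ [c]) : Fn r k) = if d = c then de w else 0 := by
  funext x; by_cases h : d = c <;> simp [de, h]
lemma mulc_de (s : Fin r → k) (w : Word r) : mulc s (de w) = chi s w • (de w : Fn r k) := by
  funext x; by_cases h : x = w <;> simp [de, h]

lemma sh_one_left (v : Fn r k) : sh t (de []) v = v := by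
  funext w
  induction w generalizing v with
  | nil => simp [sh_nil, de]
  | cons d w ih => simp [sh_cons, Dl_de_nil, ih]

lemma sh_one_right (v : Fn r k) : sh t v (de []) = v := by
  funext w
  induction w generalizing v with
  | nil => simp [sh_nil, de]
  | cons d w ih => simp [sh_cons, Dl_de_nil, ih, mulc_de]

/-- homogeneous function -/
def HomF (u : Fn r k) (ν : Fin r → ℕ) : Prop := ∀ w, u w ≠ 0 → deg w = ν

lemma deg_nil : deg ([] : Word r) = 0 := by funext i; simp [deg]
lemma deg_append (v w : Word r) : deg (v ++ w) = deg v + deg w := by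
  funext i; simp [deg]
lemma deg_cons (d : Fin r) (w : Word r) : deg (d :: w) = Pi.single d 1 + deg w := by
  funext i; by_cases h : i = d
  · subst h; simp [deg]; omega
  · simp [deg, h, Ne.symm h]
lemma deg_single (d : Fin r) : deg [d] = Pi.single d 1 := by
  rw [deg_cons, deg_nil, add_zero]

lemma HomF.add {u v : Fn r k} {ν} (hu : HomF u ν) (hv : HomF v ν) : HomF (u + v) ν := by
  intro w hw
  by_cases h : u w = 0
  · apply hv; intro h'; apply hw; simp [h, h']
  · exact hu w h
lemma HomF.smul {u : Fn r k} {ν} (c : k) (hu : HomF u ν) : HomF (c • u) ν := by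
  intro w hw; apply hu; intro h; apply hw; simp [h]
lemma HomF.sub {u v : Fn r k} {ν} (hu : HomF u ν) (hv : HomF v ν) : HomF (u - v) ν := by
  rw [sub_eq_add_neg, ← neg_one_smul k v]; exact hu.add (hv.smul _)
lemma HomF.zero (ν) : HomF (0 : Fn r k) ν := by intro w hw; simp at hw
lemma HomF.de (w : Word r) : HomF (_root_.de w : Fn r k) (deg w) := by
  intro x hx; simp [de_apply] at hx; rw [hx.1]
lemma HomF.mulc {u : Fn r k} {ν} (s : Fin r → k) (hu : HomF u ν) : HomF (mulc s u) ν := by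
  intro w hw; apply hu; intro h; apply hw; simp [h]

lemma HomF.sh {u v : Fn r k} {ν μ} (hu : HomF u ν) (hv : HomF v μ) :
    HomF (sh t u v) (ν + μ) := by
  intro w
  induction w generalizing u v ν μ with
  | nil =>
    intro h
    rw [sh_nil] at h
    rw [← hu [] (left_ne_zero_of_mul h), ← hv [] (right_ne_zero_of_mul h), deg_nil, add_zero]
  | cons d w ih =>
    intro h
    rw [sh_cons] at h
    have key : ∀ {u : Fn r k} {ν}, HomF u ν → HomF (Dl d u) (ν - Pi.single d 1) := by
      intro u ν hu x hx
      have := hu _ hx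
      rw [deg_cons] at this
      rw [← this, add_tsub_cancel_left]
    have key2 : ∀ {u : Fn r k} {ν}, HomF u ν → Dl d u ≠ 0 → Pi.single d 1 ≤ ν := by
      intro u ν hu hx
      obtain ⟨x, hx⟩ := Function.ne_iff.1 hx
      have := hu _ hx
      rw [← this, deg_cons]; exact le_self_add
    by_cases h1 : _root_.sh t (Dl d u) (_root_.mulc (t d) v) w = 0
    · rw [h1, zero_add] at h
      have := ih hu (key hv) h
      have h2 : Dl d v ≠ 0 := by rintro h2; apply h; simp [h2]
      rw [deg_cons, this, add_left_comm, add_tsub_cancel_of_le (key2 hv h2)]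
    · have := ih (key hu) (hv.mulc _) h1
      have h2 : Dl d u ≠ 0 := by rintro h2; apply h1; simp [h2]
      rw [deg_cons, this, ← add_assoc, add_tsub_cancel_of_le (key2 hu h2)]

/-! Xi -/
def Xi : Word r → Fn r k
  | [] => de []
  | i :: w => sh t (de [i]) (Xi w)

lemma Xi_nil : Xi t [] = (de [] : Fn r k) := rfl
lemma Xi_cons (i : Fin r) (w : Word r) : Xi t (i :: w) = sh t (de [i]) (Xi t w) := rfl
lemma Xi_append (v w : Word r) : Xi t (v ++ w) = sh t (Xi t v) (Xi t w) := by
  induction v with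
  | nil => simp [Xi_nil, sh_one_left]
  | cons i v ih => simp only [List.cons_append, Xi_cons, ih, sh_assoc]
lemma Xi_single (i : Fin r) : Xi t [i] = (de [i] : Fn r k) := by
  simp [Xi_cons, Xi_nil, sh_one_right]
lemma HomF.Xi (w : Word r) : HomF (Xi t w) (deg w) := by
  induction w with
  | nil => exact HomF.de []
  | cons i w ih =>
    rw [show i :: w = [i] ++ w from rfl, deg_append]
    exact (HomF.de [i]).sh t ih

/-- the free algebra -/
abbrev Fr (r : ℕ) (k : Type*) [CommRing k] := Word r →₀ k

def XiF : Fr r k →ₗ[k] Fn r k := Finsupp.linearCombination k (Xi t)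

/-- pairing -/
def pr (f : Fr r k) : Fn r k →ₗ[k] k where
  toFun u := Finsupp.linearCombination k u f
  map_add' u v := by simp [Finsupp.linearCombination_apply, Finsupp.sum, mul_add, Finset.sum_add_distrib]
  map_smul' c u := by
    simp [Finsupp.linearCombination_apply, Finsupp.sum, Finset.mul_sum, mul_left_comm]

lemma pr_def (f : Fr r k) (u : Fn r k) : pr f u = f.sum fun w c => c * u w := by
  simp [pr, Finsupp.linearCombination_apply]
lemma pr_def' (f : Fr r k) (u : Fn r k) : pr f u = Finsupp.linearCombination k u f := rfl
@[simp] lemma pr_add (f g : Fr r k) (u : Fn r k) : pr (f + g) u = pr f u + pr g u := by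
  simp [pr_def']
@[simp] lemma pr_sub (f g : Fr r k) (u : Fn r k) : pr (f - g) u = pr f u - pr g u := by
  simp [pr_def']
@[simp] lemma pr_smul (c : k) (f : Fr r k) (u : Fn r k) : pr (c • f) u = c * pr f u := by
  simp [pr_def']
@[simp] lemma pr_zero (u : Fn r k) : pr 0 u = 0 := by simp [pr_def']
@[simp] lemma pr_single (w : Word r) (c : k) (u : Fn r k) :
    pr (Finsupp.single w c) u = c * u w := by
  simp [pr_def']
lemma XiF_single (w : Word r) (c : k) : XiF t (Finsupp.single w c) = c • Xi t w := by
  simp [XiF]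

/-- concatenation -/
def cm : Fr r k →ₗ[k] Fr r k →ₗ[k] Fr r k :=
  LinearMap.mk₂ k (fun f g => f.sum fun w c => g.sum fun x d => Finsupp.single (w ++ x) (c * d))
    (by
      intro f f' g
      rw [Finsupp.sum_add_index'] <;> intros
      · simp
      · simp [add_mul, Finsupp.sum_add])
    (by
      intro c f g
      rw [Finsupp.sum_smul_index' (by intros; simp), Finsupp.smul_sum]
      congr; funext w d; rw [Finsupp.smul_sum]; congr; funext x e
      simp [mul_assoc, -Finsupp.single_mul])
    (by
      intro f g g'
      rw [← Finsupp.sum_add]; congr; funext w c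
      rw [Finsupp.sum_add_index'] <;> intros
      · simp
      · simp [mul_add])
    (by
      intro c f g
      rw [Finsupp.smul_sum]; congr; funext w d
      rw [Finsupp.sum_smul_index' (by intros; simp), Finsupp.smul_sum]
      congr; funext x e
      simp [mul_left_comm, -Finsupp.single_mul])

lemma cm_apply (f g : Fr r k) :
    cm f g = f.sum fun w c => g.sum fun x d => Finsupp.single (w ++ x) (c * d) := rfl

@[simp] lemma cm_single (w x : Word r) (c d : k) :
    cm (Finsupp.single w c) (Finsupp.single x d) = Finsupp.single (w ++ x) (c * d) := by
  rw [cm_apply, Finsupp.sum_single_index, Finsupp.sum_single_index] <;> simp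

lemma fr_ext {M : Type*} [AddCommGroup M] [Module k M] {φ ψ : Fr r k →ₗ[k] M}
    (h : ∀ w, φ (Finsupp.single w 1) = ψ (Finsupp.single w 1)) : φ = ψ := by
  apply Finsupp.lhom_ext'
  intro w
  apply LinearMap.ext_ring
  exact h w

lemma XiF_cm (f g : Fr r k) : XiF t (cm f g) = sh t (XiF t f) (XiF t g) := by
  have : (cm.compr₂ (XiF t) : Fr r k →ₗ[k] Fr r k →ₗ[k] Fn r k)
      = (sh t).compl₁₂ (XiF t) (XiF t) := by
    apply fr_ext; intro w; apply fr_ext; intro x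
    simp [XiF_single, Xi_append]
  exact LinearMap.congr_fun₂ this f g

lemma cm_assoc (f g h : Fr r k) : cm (cm f g) h = cm f (cm g h) := by
  induction f using Finsupp.induction_linear with
  | zero => simp
  | add f f' h1 h2 => simp [h1, h2]
  | single w c =>
    induction g using Finsupp.induction_linear with
    | zero => simp
    | add f f' h1 h2 => simp [h1, h2]
    | single w c =>
      induction h using Finsupp.induction_linear with
      | zero => simp
      | add f f' h1 h2 => simp only [map_add, h1, h2]
      | single w c => simp only [cm_single, mul_assoc, List.append_assoc]

/-- left truncation operator by an element of the free algebra -/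
def Lop (f : Fr r k) : Fn r k →ₗ[k] Fn r k where
  toFun u := fun y => pr f (fun x => u (x ++ y))
  map_add' u v := by funext y; exact (pr f).map_add (fun x => u (x ++ y)) (fun x => v (x ++ y))
  map_smul' c u := by funext y; exact (pr f).map_smul c (fun x => u (x ++ y))

lemma Lop_apply (f : Fr r k) (u : Fn r k) (y : Word r) :
    Lop f u y = pr f (fun x => u (x ++ y)) := rfl
lemma Lop_add (f g : Fr r k) : Lop (f + g) = Lop f + Lop g := by
  ext u y; simp [Lop_apply]
lemma Lop_sub (f g : Fr r k) : Lop (f - g) = Lop f - Lop g := by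
  ext u y; simp [Lop_apply]
lemma Lop_smul (c : k) (f : Fr r k) : Lop (c • f) = c • Lop f := by
  ext u y; simp [Lop_apply]
lemma Lop_single (w : Word r) (c : k) (u : Fn r k) (y : Word r) :
    Lop (Finsupp.single w c) u y = c * u (w ++ y) := by
  simp [Lop_apply]
def LopL : Fr r k →ₗ[k] Module.End k (Fn r k) where
  toFun := Lop
  map_add' := Lop_add
  map_smul' := Lop_smul
lemma pr_eq_Lop (f : Fr r k) (u : Fn r k) : pr f u = Lop f u [] := by
  simp [Lop_apply]
lemma Lop_cm (f g : Fr r k) : Lop (cm f g) = Lop g ∘ₗ Lop f := by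
  induction f using Finsupp.induction_linear with
  | zero =>
    have : Lop (0 : Fr r k) = 0 := by ext u y; simp [Lop_apply]
    rw [map_zero, LinearMap.zero_apply, this, LinearMap.comp_zero]
  | add f f' h1 h2 => simp [h1, h2, Lop_add, LinearMap.comp_add]
  | single w c =>
    induction g using Finsupp.induction_linear with
    | zero => ext u y; simp [Lop_apply]
    | add f f' h1 h2 => simp [h1, h2, Lop_add, LinearMap.add_comp]
    | single x d =>
      ext u y
      rw [cm_single, LinearMap.comp_apply, Lop_single, Lop_single, Lop_single, List.append_assoc]; ring
lemma Lop_Dr (f : Fr r k) (c : Fin r) (u : Fn r k) : Lop f (Dr c u) = Dr c (Lop f u) := by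
  funext y; simp [Lop_apply]

/-- Adjoint of left multiplication by a letter. -/
def Lam (c : Fin r) : Word r → Fr r k
  | [] => 0
  | d :: x => (if c = d then Finsupp.single x (chi (t c) x) else 0)
      + cm (Finsupp.single [d] 1) (Lam c x)

lemma pr_cm_letter (d : Fin r) (f : Fr r k) (u : Fn r k) :
    pr (cm (Finsupp.single [d] 1) f) u = pr f (Dl d u) := by
  rw [pr_eq_Lop, pr_eq_Lop, Lop_cm, LinearMap.comp_apply]
  have : Lop (Finsupp.single [d] 1) u = Dl d u := by funext y; simp [Lop_single]
  rw [this]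

lemma pr_Lam (c : Fin r) (x : Word r) (u : Fn r k) : pr (Lam t c x) u = sh t (de [c]) u x := by
  induction x generalizing u with
  | nil => simp [Lam, sh_nil, de]
  | cons d x ih =>
    simp only [Lam, pr_add, pr_cm_letter, ih, sh_cons, Dl_de_cons]
    by_cases h : c = d
    · subst h; simp [sh_one_left]
    · simp [h, Ne.symm h]

lemma XiF_Lam (c : Fin r) (x : Word r) :
    XiF t (Lam t c x) = Dl c (Xi t x) := by
  induction x with
  | nil => simp [Lam, Xi_nil, Dl_de_nil]
  | cons d x ih =>
    have hm : mulc (t c) (Xi t x) = chi (t c) x • Xi t x := by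
      clear ih
      funext w
      simp only [mulc_apply, Pi.smul_apply, smul_eq_mul]
      by_cases h : Xi t x w = 0
      · simp [h]
      · have := HomF.Xi t x w h
        congr 1
        apply List.Perm.prod_eq
        apply List.Perm.map
        rw [List.perm_iff_count]; intro i; exact congrFun this i
    simp only [Lam, map_add, XiF_cm, ih, XiF_single, Xi_cons, Dl_sh, one_smul, Xi_single,
      Dl_de_cons, Xi_nil, sh_one_right]
    by_cases h : c = d
    · subst h; simp [sh_one_left, hm, XiF_single]
    · simp [h]

lemma Xi_symm (w x : Word r) : Xi t w x = Xi t x w := by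
  induction w generalizing x with
  | nil =>
    by_cases h : x = []
    · subst h; rfl
    · rw [Xi_nil, de_apply, if_neg h]
      by_contra h'
      have := HomF.Xi t x [] (Ne.symm h')
      rw [deg_nil] at this
      cases x with
      | nil => exact h rfl
      | cons i x => have := congrFun this i; simp [deg] at this
  | cons c w ih =>
    have h1 : ∀ f : Fr r k, pr f (Xi t w) = XiF t f w := by
      intro f
      rw [pr_def, XiF, Finsupp.linearCombination_apply, Finsupp.sum, Finsupp.sum]
      simp [ih]
    rw [Xi_cons, ← pr_Lam, h1, XiF_Lam t]; rfl

lemma pr_XiF (f g : Fr r k) : pr f (XiF t g) = pr g (XiF t f) := by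
  induction f using Finsupp.induction_linear with
  | zero => simp
  | add f f' h1 h2 => simp [h1, h2]
  | single w c =>
    induction g using Finsupp.induction_linear with
    | zero => simp
    | add f f' h1 h2 => simp only [map_add, pr_add, h1, h2]
    | single x d =>
      simp [XiF_single, Xi_symm t w x]; ring

end Generic
end

section
set_option linter.all false
/-! ### Part 2 : the subalgebra, link to the frozen definitions -/

section Generic
variable {k : Type*} [CommRing k] (t : Fin r → Fin r → k)

def UU : Submodule k (Fn r k) := LinearMap.range (XiF t)

lemma XiF_mem (f : Fr r k) : XiF t f ∈ UU t := ⟨f, rfl⟩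
lemma Xi_mem (w : Word r) : Xi t w ∈ UU t := ⟨Finsupp.single w 1, by simp [XiF_single]⟩

lemma UU_ind {P : Fn r k → Prop} (h0 : P 0) (hadd : ∀ u v, u ∈ UU t → v ∈ UU t → P u → P v → P (u + v))
    (hsm : ∀ (c : k) u, u ∈ UU t → P u → P (c • u)) (hX : ∀ w, P (Xi t w)) : ∀ u ∈ UU t, P u := by
  rintro _ ⟨f, rfl⟩
  induction f using Finsupp.induction_linear with
  | zero => simpa using h0
  | add f f' h1 h2 => rw [map_add]; exact hadd _ _ (XiF_mem t f) (XiF_mem t f') h1 h2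
  | single w c => rw [XiF_single]; exact hsm _ _ (Xi_mem t w) (hX w)

lemma UU_closed (φ : Fn r k →ₗ[k] Fn r k) (h : ∀ w, φ (Xi t w) ∈ UU t) :
    ∀ u ∈ UU t, φ u ∈ UU t := by
  apply UU_ind
  · simp
  · intro u v _ _ h1 h2; rw [map_add]; exact add_mem h1 h2
  · intro c u _ h1; rw [map_smul]; exact Submodule.smul_mem _ _ h1
  · exact h

lemma UU_sh {u v : Fn r k} (hu : u ∈ UU t) (hv : v ∈ UU t) : sh t u v ∈ UU t := by
  obtain ⟨f, rfl⟩ := hu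
  obtain ⟨g, rfl⟩ := hv
  rw [← XiF_cm]; exact XiF_mem t _

lemma UU_Dl (c : Fin r) {u : Fn r k} (hu : u ∈ UU t) : Dl c u ∈ UU t := by
  refine UU_closed t (Dl c) (fun w => ?_) u hu
  rw [← XiF_Lam]; exact XiF_mem t _

lemma Dr_Xi_mem (c : Fin r) (w : Word r) : Dr c (Xi t w) ∈ UU t := by
  induction w with
  | nil => rw [Xi_nil, Dr_de_nil]; exact zero_mem _
  | cons i w ih =>
    rw [Xi_cons, Dr_sh, mulc_de, map_smul, LinearMap.smul_apply, show ([i] : Word r) = [] ++ [i] from rfl,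
      Dr_de_append]
    refine add_mem ?_ (Submodule.smul_mem _ _ (UU_sh t ?_ ih))
    · by_cases h : c = i
      · rw [if_pos h, sh_one_left]; exact Xi_mem t w
      · rw [if_neg h]; simp
    · rw [List.nil_append, ← Xi_single]; exact Xi_mem t _

lemma UU_Dr (c : Fin r) {u : Fn r k} (hu : u ∈ UU t) : Dr c u ∈ UU t :=
  UU_closed t (Dr c) (Dr_Xi_mem t c) u hu

/-- degree component -/
def comp (ν : Fin r → ℕ) : Fn r k →ₗ[k] Fn r k where
  toFun u := fun w => if deg w = ν then u w else 0
  map_add' u v := by funext w; by_cases h : deg w = ν <;> simp [h]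
  map_smul' c u := by funext w; by_cases h : deg w = ν <;> simp [h]

lemma comp_apply (ν : Fin r → ℕ) (u : Fn r k) (w : Word r) :
    comp ν u w = if deg w = ν then u w else 0 := rfl
lemma HomF.comp (ν : Fin r → ℕ) (u : Fn r k) : HomF (comp ν u) ν := by
  intro w hw; rw [comp_apply] at hw; by_contra h; simp [h] at hw
lemma comp_of_hom {u : Fn r k} {ν} (h : HomF u ν) : comp ν u = u := by
  funext w; rw [comp_apply]; split_ifs with h1
  · rfl
  · by_contra h2; exact h1 (h w (Ne.symm h2))
lemma comp_of_hom_ne {u : Fn r k} {ν μ} (h : HomF u ν) (hne : ν ≠ μ) : comp μ u = 0 := by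
  funext w; rw [comp_apply]; split_ifs with h1
  · by_contra h2; exact hne ((h w h2).symm.trans h1)
  · rfl
lemma UU_comp (ν : Fin r → ℕ) {u : Fn r k} (hu : u ∈ UU t) : comp ν u ∈ UU t := by
  refine UU_closed t (comp ν) (fun w => ?_) u hu
  by_cases h : deg w = ν
  · rw [comp_of_hom (h ▸ HomF.Xi t w)]; exact Xi_mem t w
  · rw [comp_of_hom_ne (HomF.Xi t w) h]; exact zero_mem _

lemma chi_deg (s : Fin r → k) {w x : Word r} (h : deg w = deg x) : chi s w = chi s x := by
  apply List.Perm.prod_eq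
  apply List.Perm.map
  rw [List.perm_iff_count]; intro i; exact congrFun h i

lemma mulc_hom (s : Fin r → k) {u : Fn r k} {x : Word r} (h : HomF u (deg x)) :
    mulc s u = chi s x • u := by
  funext w
  by_cases h1 : u w = 0
  · simp [h1]
  · simp [chi_deg s (h w h1)]

lemma UU_mulc (s : Fin r → k) {u : Fn r k} (hu : u ∈ UU t) : mulc s u ∈ UU t := by
  refine UU_closed t (mulc s) (fun w => ?_) u hu
  rw [mulc_hom s (HomF.Xi t w)]
  exact Submodule.smul_mem _ _ (Xi_mem t w)

/-- word truncations -/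
def Dlw (x : Word r) : Fn r k →ₗ[k] Fn r k where
  toFun u := fun y => u (x ++ y)
  map_add' _ _ := rfl
  map_smul' _ _ := rfl
def Drw (x : Word r) : Fn r k →ₗ[k] Fn r k where
  toFun u := fun y => u (y ++ x)
  map_add' _ _ := rfl
  map_smul' _ _ := rfl
@[simp] lemma Dlw_apply (x : Word r) (u : Fn r k) (w : Word r) : Dlw x u w = u (x ++ w) := rfl
@[simp] lemma Drw_apply (x : Word r) (u : Fn r k) (w : Word r) : Drw x u w = u (w ++ x) := rfl
lemma Dlw_nil (u : Fn r k) : Dlw [] u = u := rfl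
lemma Dlw_cons (d : Fin r) (x : Word r) (u : Fn r k) : Dlw (d :: x) u = Dlw x (Dl d u) := rfl
lemma Drw_nil (u : Fn r k) : Drw [] u = u := by funext w; simp
lemma Drw_append (x : Word r) (d : Fin r) (u : Fn r k) : Drw (x ++ [d]) u = Drw x (Dr d u) := by
  funext w; simp
lemma Drw_cons (x : Word r) (d : Fin r) (u : Fn r k) : Drw (d :: x) u = Dr d (Drw x u) := by
  funext w; simp
lemma UU_Dlw (x : Word r) {u : Fn r k} (hu : u ∈ UU t) : Dlw x u ∈ UU t := by
  induction x generalizing u with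
  | nil => exact hu
  | cons d x ih => rw [Dlw_cons]; exact ih (UU_Dl t d hu)
lemma UU_Drw (x : Word r) {u : Fn r k} (hu : u ∈ UU t) : Drw x u ∈ UU t := by
  induction x with
  | nil => rwa [Drw_nil]
  | cons d x ih => rw [Drw_cons]; exact UU_Dr t d ih
lemma Lop_eq_sum (f : Fr r k) (u : Fn r k) : Lop f u = ∑ x ∈ f.support, f x • Dlw x u := by
  funext y; simp [Lop_apply, pr_def, Finsupp.sum]
lemma UU_Lop (f : Fr r k) {u : Fn r k} (hu : u ∈ UU t) : Lop f u ∈ UU t := by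
  rw [Lop_eq_sum]
  exact sum_mem fun x _ => Submodule.smul_mem _ _ (UU_Dlw t x hu)
lemma UU_one : (de [] : Fn r k) ∈ UU t := Xi_mem t []
lemma UU_letter (i : Fin r) : (de [i] : Fn r k) ∈ UU t := by rw [← Xi_single t]; exact Xi_mem t _

lemma pr_Xi (f : Fr r k) (w : Word r) : pr f (Xi t w) = XiF t f w := by
  have := pr_XiF t f (Finsupp.single w 1)
  simpa [XiF_single] using this

lemma XiF_eq_zero_iff (f : Fr r k) : XiF t f = 0 ↔ ∀ u ∈ UU t, pr f u = 0 := by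
  constructor
  · rintro h _ ⟨g, rfl⟩
    rw [pr_XiF, h, map_zero]
  · intro h; funext w; rw [← pr_Xi]; exact h _ (Xi_mem t w)

/-- homogeneous elements of the free algebra -/
lemma HomF_XiF {f : Fr r k} {ν} (h : HomF (⇑f) ν) : HomF (XiF t f) ν := by
  intro w hw
  rw [XiF, Finsupp.linearCombination_apply, Finsupp.sum, Finset.sum_apply] at hw
  obtain ⟨x, hx, h1⟩ := Finset.exists_ne_zero_of_sum_ne_zero hw
  rw [Finsupp.mem_support_iff] at hx
  have h2 : Xi t x w ≠ 0 := by intro h2; apply h1; simp [h2]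
  rw [HomF.Xi t x w h2, h x hx]

lemma HomF_cm {f g : Fr r k} {ν μ} (h : HomF (⇑f) ν) (h' : HomF (⇑g) μ) :
    HomF (⇑(cm f g)) (ν + μ) := by
  intro w hw
  rw [cm_apply, Finsupp.sum, Finsupp.finset_sum_apply] at hw
  obtain ⟨x, hx, h1⟩ := Finset.exists_ne_zero_of_sum_ne_zero hw
  rw [Finsupp.sum, Finsupp.finset_sum_apply] at h1
  obtain ⟨y, hy, h2⟩ := Finset.exists_ne_zero_of_sum_ne_zero h1
  rw [Finsupp.mem_support_iff] at hx hy
  rw [Finsupp.single_apply] at h2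
  have : x ++ y = w := by by_contra h3; simp [h3] at h2
  rw [← this, deg_append, h x hx, h' y hy]

lemma pr_hom_ne {f : Fr r k} {u : Fn r k} {ν μ} (h : HomF (⇑f) ν) (h' : HomF u μ) (hne : ν ≠ μ) :
    pr f u = 0 := by
  rw [pr_def, Finsupp.sum]
  apply Finset.sum_eq_zero
  intro w hw
  rw [Finsupp.mem_support_iff] at hw
  by_cases h1 : u w = 0
  · simp [h1]
  · exact absurd ((h w hw).symm.trans (h' w h1)) hne

lemma pr_congr {f : Fr r k} {u v : Fn r k} (h : ∀ w, f w ≠ 0 → u w = v w) : pr f u = pr f v := by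
  rw [pr_def, pr_def]; apply Finsupp.sum_congr; intro w hw
  rw [h w (Finsupp.mem_support_iff.1 hw)]

/-- good words -/
def Good (g : Word r) : Prop :=
  ∃ u ∈ UU t, HomF u (deg g) ∧ u g ≠ 0 ∧ ∀ w, u w ≠ 0 → w ≤ g

lemma length_of_deg {w x : Word r} (h : deg w = deg x) : w.length = x.length := by
  have : w.Perm x := by rw [List.perm_iff_count]; intro i; exact congrFun h i
  exact this.length_eq

lemma cons_lt_cons_iff' (d e : Fin r) (a b : Word r) :
    d :: a < e :: b ↔ d < e ∨ d = e ∧ a < b := List.cons_lt_cons_iff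

lemma nil_le' (a : Word r) : [] ≤ a := not_lt.1 (by simp)

lemma append_lt_append_left_iff (a b c : Word r) : a ++ b < a ++ c ↔ b < c := by
  induction a with
  | nil => rfl
  | cons d a ih => simp only [List.cons_append, cons_lt_cons_iff', ih]; simp

lemma append_le_append_left_iff (a b c : Word r) : a ++ b ≤ a ++ c ↔ b ≤ c := by
  rw [← not_lt, ← not_lt, append_lt_append_left_iff]

lemma le_of_append_le {a b x y : Word r} (hl : a.length = b.length) (h : a ++ x ≤ b ++ y) : a ≤ b := by
  rw [← not_lt] at h ⊢
  intro h1; apply h; clear h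
  induction a generalizing b with
  | nil => simp at h1
  | cons d a ih =>
    cases b with
    | nil => simp at hl
    | cons e b =>
      simp only [List.cons_append, cons_lt_cons_iff'] at h1 ⊢
      simp at hl
      rcases h1 with h | ⟨h, h'⟩
      · exact Or.inl h
      · exact Or.inr ⟨h, ih hl h'⟩

lemma append_lt_of_lt {a b : Word r} (x y : Word r) (hl : a.length = b.length) (h : a < b) :
    a ++ x < b ++ y := by
  by_contra h1
  exact absurd (le_of_append_le hl.symm (not_lt.1 h1)) (not_le.2 h)

lemma HomF_Dlw {u : Fn r k} {x : Word r} {ν} (h : HomF u (deg x + ν)) : HomF (Dlw x u) ν := by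
  intro w hw
  have := h _ hw
  rw [deg_append] at this
  exact add_left_cancel this
lemma HomF_Drw {u : Fn r k} {x : Word r} {ν} (h : HomF u (ν + deg x)) : HomF (Drw x u) ν := by
  intro w hw
  have := h _ hw
  rw [deg_append] at this
  exact add_right_cancel this

lemma Good.right {a b : Word r} (h : Good t (a ++ b)) : Good t b := by
  obtain ⟨u, hu, h1, h2, h3⟩ := h
  rw [deg_append] at h1
  refine ⟨Dlw a u, UU_Dlw t a hu, HomF_Dlw h1, h2, fun w hw => ?_⟩
  exact (append_le_append_left_iff a _ _).1 (h3 _ hw)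
lemma Good.left {a b : Word r} (h : Good t (a ++ b)) : Good t a := by
  obtain ⟨u, hu, h1, h2, h3⟩ := h
  rw [deg_append] at h1
  refine ⟨Drw b u, UU_Drw t b hu, HomF_Drw h1, h2, fun w hw => ?_⟩
  exact le_of_append_le (length_of_deg (HomF_Drw h1 w hw)) (h3 _ hw)

end Generic

/-! link -/
def tq (p : Fin r → Fin r → ℤ) : Fin r → Fin r → K := fun i j => qq ^ (-(p i j))

lemma qq_ne : (qq : K) ≠ 0 := RatFunc.X_ne_zero

lemma chi_tq (p : Fin r → Fin r → ℤ) (b : Fin r) (w : Word r) :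
    chi (fun i => tq p i b) w = qq ^ (-(pairW p w [b])) := by
  induction w with
  | nil => simp [pairW]
  | cons a w ih =>
    have : pairW p (a :: w) [b] = p a b + pairW p w [b] := by simp [pairW]
    rw [chi_cons, ih, this, tq, neg_add, zpow_add₀ qq_ne]

lemma pairW_perm (p : Fin r → Fin r → ℤ) {w w' x x' : Word r} (h : w.Perm w') (h' : x.Perm x') :
    pairW p w x = pairW p w' x' := by
  unfold pairW
  rw [(h.map _).sum_eq]
  congr 1
  apply List.map_congr_left
  intro a _
  exact (h'.map _).sum_eq

lemma fn_ext_last {k : Type*} {u v : Fn r k} (h0 : u [] = v [])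
    (h1 : ∀ w d, u (w ++ [d]) = v (w ++ [d])) : u = v := by
  funext w
  rcases List.eq_nil_or_concat w with rfl | ⟨w, d, rfl⟩
  · exact h0
  · rw [List.concat_eq_append]; exact h1 w d

lemma mapDomain_snoc (f : FA r) (a : Fin r) (w : Word r) (d : Fin r) :
    Finsupp.mapDomain (fun u : Word r => u ++ [a]) f (w ++ [d]) = if d = a then f w else 0 := by
  have hinj : Function.Injective (fun u : Word r => u ++ [a]) := fun x y h => by simpa using h
  split_ifs with h
  · subst h; exact Finsupp.mapDomain_apply hinj f w
  · apply Finsupp.mapDomain_notin_range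
    rintro ⟨y, hy⟩
    apply h
    have := List.append_inj_right' hy rfl
    simpa using this.symm

lemma mapDomain_snoc_nil (f : FA r) (a : Fin r) :
    Finsupp.mapDomain (fun u : Word r => u ++ [a]) f [] = 0 := by
  apply Finsupp.mapDomain_notin_range
  rintro ⟨y, hy⟩
  simp at hy

lemma coe_single (w : Word r) : ⇑(Finsupp.single w 1 : FA r) = de w := by
  funext x; simp [Finsupp.single_apply, de_apply, eq_comm]

lemma shAux_coe (p : Fin r → Fin r → ℤ) (w x : Word r) :
    ⇑(shAux p w x) = sh (tq p) (de w.reverse) (de x.reverse) := by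
  induction w, x using shAux.induct with
  | case1 x => rw [shAux, coe_single, List.reverse_nil, sh_one_left]
  | case2 w hw =>
    rw [shAux, coe_single, List.reverse_nil, sh_one_right]
    exact hw
  | case3 a w b x ih1 ih2 =>
    rw [shAux]
    apply fn_ext_last
    · simp [mapDomain_snoc_nil, sh_nil, de_apply]
    · intro y d
      have h := congrFun (Dr_sh (tq p) d (de (a :: w).reverse) (de (b :: x).reverse)) y
      rw [Dr_apply] at h
      rw [h, Finsupp.add_apply, Finsupp.smul_apply, mapDomain_snoc, mapDomain_snoc, ih1, ih2]
      simp only [List.reverse_cons, Dr_de_append, Pi.add_apply, mulc_de]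
      have e : chi (fun i => tq p i d) (w.reverse ++ [a]) = qq ^ (-(pairW p (a :: w) [d])) := by
        rw [chi_tq, pairW_perm p (w := w.reverse ++ [a]) (w' := a :: w) _ (List.Perm.refl _)]
        rw [← List.reverse_cons]; exact List.reverse_perm _
      rw [e]
      by_cases h1 : d = a
      · by_cases h2 : d = b
        · subst h1; subst h2; simp
        · simp [h1, h2]; subst h1; simp [h2]
      · by_cases h2 : d = b
        · subst h2; simp [h1]
        · simp [h1, h2]

lemma coe_linearCombination {k : Type*} [CommRing k] (f : Fr r k) :
    f.sum (fun w c => c • (de w : Fn r k)) = ⇑f := by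
  funext x
  rw [Finsupp.sum, Finset.sum_apply]
  simp [de_apply]
  
lemma shuffle_coe (p : Fin r → Fin r → ℤ) (f g : FA r) :
    ⇑(shuffle p f g) = sh (tq p) ⇑f ⇑g := by
  conv_rhs => rw [← coe_linearCombination f, ← coe_linearCombination g]
  rw [shuffle, Finsupp.sum, Finsupp.coe_finset_sum, Finsupp.sum, map_sum, LinearMap.sum_apply]
  apply Finset.sum_congr rfl
  intro w _
  rw [Finsupp.sum, Finsupp.coe_finset_sum, Finsupp.sum, map_smul, LinearMap.smul_apply, map_sum,
    Finset.smul_sum]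
  apply Finset.sum_congr rfl
  intro x _
  rw [Finsupp.coe_smul, shAux_coe, List.reverse_reverse, List.reverse_reverse, map_smul, smul_smul]

lemma xiWord_coe (p : Fin r → Fin r → ℤ) (w : Word r) : ⇑(xiWord p w) = Xi (tq p) w := by
  induction w with
  | nil => rw [xiWord, coe_single]; rfl
  | cons i w ih => rw [xiWord, shuffle_coe, ih, coe_single]; rfl

lemma xi_coe (p : Fin r → Fin r → ℤ) (f : FA r) : ⇑(xi p f) = XiF (tq p) f := by
  rw [xi, Finsupp.sum, Finsupp.coe_finset_sum, XiF, Finsupp.linearCombination_apply, Finsupp.sum]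
  apply Finset.sum_congr rfl
  intro x _
  rw [Finsupp.coe_smul, xiWord_coe]

lemma InU_mem (p : Fin r → Fin r → ℤ) {f : FA r} (h : InU p f) : ⇑f ∈ UU (tq p) := by
  induction h with
  | letter i => rw [coe_single]; exact UU_letter _ i
  | one => rw [coe_single]; exact UU_one _
  | add _ _ h1 h2 => rw [Finsupp.coe_add]; exact add_mem h1 h2
  | smul c _ h1 => rw [Finsupp.coe_smul]; exact Submodule.smul_mem _ _ h1
  | mul _ _ h1 h2 => rw [shuffle_coe]; exact UU_sh _ h1 h2

lemma wlt_iff (w x : Word r) : wlt w x ↔ w < x := Iff.rfl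
lemma wle_iff (w x : Word r) : wle w x ↔ w ≤ x := by
  rw [wle, wlt_iff, le_iff_lt_or_eq]

lemma IsGood.good (p : Fin r → Fin r → ℤ) {g : Word r} (h : IsGood p g) : Good (tq p) g := by
  obtain ⟨u, hu, ⟨ν, hν⟩, h1, h2⟩ := h
  refine ⟨u, InU_mem p hu, ?_, h1, fun w hw => (wle_iff _ _).1 (h2 w (Finsupp.mem_support_iff.2 hw))⟩
  intro w hw
  rw [hν w (Finsupp.mem_support_iff.2 hw), hν g (Finsupp.mem_support_iff.2 h1)]
end

section
set_option linter.all false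
/-! ### Part 3 : combinatorics of Lyndon words -/

lemma lt_append_right (a : Word r) {s : Word r} (hs : s ≠ []) : a < a ++ s := by
  have := (append_lt_append_left_iff a [] s).2 (by
    cases s with
    | nil => exact absurd rfl hs
    | cons d s => simp)
  simpa using this

lemma le_append_right (a s : Word r) : a ≤ a ++ s := by
  by_cases hs : s = []
  · subst hs; simp
  · exact (lt_append_right a hs).le

lemma lt_of_not_prefix {a b : Word r} (h : a < b) (hp : ¬ a <+: b) (x y : Word r) :
    a ++ x < b ++ y := by
  induction a generalizing b with
  | nil => exact absurd (List.nil_prefix) hp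
  | cons d a ih =>
    cases b with
    | nil => simp at h
    | cons e b =>
      simp only [List.cons_append, cons_lt_cons_iff'] at h ⊢
      rcases h with h | ⟨h, h'⟩
      · exact Or.inl h
      · refine Or.inr ⟨h, ih h' fun h2 => hp ?_⟩
        rw [h, List.prefix_cons_inj]; exact h2

lemma IsLyndon.lt_suffix {l u v : Word r} (h : IsLyndon l) (he : l = u ++ v) (hu : u ≠ [])
    (hv : v ≠ []) : l < v := h.2 u v he hu hv

lemma IsLyndon.le_suffix {l u v : Word r} (h : IsLyndon l) (he : l = u ++ v) 
    (hv : v ≠ []) : l ≤ v := by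
  by_cases hu : u = []
  · subst hu; simp at he; rw [he]
  · exact (h.lt_suffix he hu hv).le

lemma isLyndon_letter (i : Fin r) : IsLyndon [i] := by
  refine ⟨by simp, fun u v h hu hv => ?_⟩
  exfalso
  have := congrArg List.length h
  have h1 := List.length_pos_of_ne_nil hu
  have h2 := List.length_pos_of_ne_nil hv
  simp at this; omega

lemma flatten_lt_suffix {m : Word r} (hm : IsLyndon m) (zs : List (Word r)) (hz : ∀ z ∈ zs, z < m)
    (p s : Word r) (he : m = p ++ s) (hs : s ≠ []) : zs.flatten < s := by
  induction zs generalizing p s with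
  | nil =>
    cases s with
    | nil => exact absurd rfl hs
    | cons d s => simp
  | cons z zs ih =>
    have h1 : z < s := lt_of_lt_of_le (hz z (by simp)) (hm.le_suffix he hs)
    rw [List.flatten_cons]
    by_cases hp : z <+: s
    · obtain ⟨s', rfl⟩ := hp
      rw [append_lt_append_left_iff]
      apply ih (fun z' hz' => hz z' (by simp [hz'])) (p ++ z) s' (by simp [he])
      rintro rfl; simp at h1
    · simpa using lt_of_not_prefix h1 hp zs.flatten []

lemma flatten_lt {m : Word r} (hm : IsLyndon m) {zs : List (Word r)} (hz : ∀ z ∈ zs, z < m) :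
    zs.flatten < m := flatten_lt_suffix hm zs hz [] m rfl hm.1

/-- sorted Lyndon lists -/
def SL (ls : List (Word r)) : Prop :=
  (∀ l ∈ ls, IsLyndon l) ∧ ls.Pairwise (fun a b => b ≤ a)

lemma SL.nil : SL ([] : List (Word r)) := ⟨by simp, by simp⟩
lemma SL.tail {l : Word r} {ls : List (Word r)} (h : SL (l :: ls)) : SL ls :=
  ⟨fun x hx => h.1 x (by simp [hx]), (List.pairwise_cons.1 h.2).2⟩
lemma SL.head {l : Word r} {ls : List (Word r)} (h : SL (l :: ls)) : IsLyndon l := h.1 l (by simp)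
lemma SL.le_head {l : Word r} {ls : List (Word r)} (h : SL (l :: ls)) {x} (hx : x ∈ l :: ls) : x ≤ l := by
  rcases List.mem_cons.1 hx with rfl | hx
  · exact le_rfl
  · exact (List.pairwise_cons.1 h.2).1 x hx
lemma SL.cons {l : Word r} {ls : List (Word r)} (hl : IsLyndon l) (h : SL ls) (h' : ∀ x ∈ ls, x ≤ l) :
    SL (l :: ls) := by
  refine ⟨?_, List.pairwise_cons.2 ⟨h', h.2⟩⟩
  intro x hx
  rcases List.mem_cons.1 hx with rfl | hx
  · exact hl
  · exact h.1 x hx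
lemma SL.single {l : Word r} (hl : IsLyndon l) : SL [l] := SL.cons hl SL.nil (by simp)
lemma SL.append {ls ms : List (Word r)} (h : SL ls) (h' : SL ms) (hle : ∀ a ∈ ls, ∀ b ∈ ms, b ≤ a) :
    SL (ls ++ ms) := by
  refine ⟨?_, List.pairwise_append.2 ⟨h.2, h'.2, hle⟩⟩
  intro x hx
  rcases List.mem_append.1 hx with hx | hx
  · exact h.1 x hx
  · exact h'.1 x hx
lemma SL.left {ls ms : List (Word r)} (h : SL (ls ++ ms)) : SL ls :=
  ⟨fun x hx => h.1 x (by simp [hx]), (List.pairwise_append.1 h.2).1⟩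
lemma SL.right {ls ms : List (Word r)} (h : SL (ls ++ ms)) : SL ms :=
  ⟨fun x hx => h.1 x (by simp [hx]), (List.pairwise_append.1 h.2).2.1⟩

/-- if the concatenation is at least `m`, so is the first factor -/
lemma SL.first_ge {m : Word r} (hm : IsLyndon m) {ls : List (Word r)} (h : SL ls)
    (hge : m ≤ ls.flatten) : ∃ z zs, ls = z :: zs ∧ m ≤ z := by
  cases ls with
  | nil =>
    exfalso
    have : m ≤ [] := hge
    exact absurd (lt_of_le_of_lt this (lt_append_right [] hm.1)) (by simp)
  | cons z zs =>
    refine ⟨z, zs, rfl, ?_⟩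
    by_contra hlt
    have := flatten_lt hm (zs := z :: zs) (fun x hx => lt_of_le_of_lt (h.le_head hx) (not_le.1 hlt))
    exact absurd this (not_lt.2 hge)

lemma SL.all_lt {m : Word r} {ls : List (Word r)} (h : SL ls)
    (hlt : ls.flatten < m) : ∀ z ∈ ls, z < m := by
  cases ls with
  | nil => simp
  | cons z zs =>
    intro x hx
    refine lt_of_le_of_lt (h.le_head hx) (lt_of_le_of_lt ?_ hlt)
    rw [List.flatten_cons]; exact le_append_right _ _

lemma SL.all_le {m : Word r} {ls : List (Word r)} (h : SL ls)
    (hlt : ls.flatten ≤ m) : ∀ z ∈ ls, z ≤ m := by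
  cases ls with
  | nil => simp
  | cons z zs =>
    intro x hx
    refine (h.le_head hx).trans (le_trans ?_ hlt)
    rw [List.flatten_cons]; exact le_append_right _ _

lemma SL.unique {ls ms : List (Word r)} (h : SL ls) (h' : SL ms) (he : ls.flatten = ms.flatten) :
    ls = ms := by
  induction ls generalizing ms with
  | nil =>
    cases ms with
    | nil => rfl
    | cons m ms =>
      simp only [List.flatten_nil, List.flatten_cons] at he
      exact absurd (List.append_eq_nil_iff.1 he.symm).1 h'.head.1
  | cons l ls ih =>
    cases ms with
    | nil =>
      simp only [List.flatten_nil, List.flatten_cons] at he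
      exact absurd (List.append_eq_nil_iff.1 he).1 h.head.1
    | cons m ms =>
      have key : ∀ {l m : Word r} {ls ms : List (Word r)}, SL (l :: ls) → SL (m :: ms) →
          (l :: ls).flatten = (m :: ms).flatten → m ≤ l := by
        intro l m ls ms h h' he
        obtain ⟨z, zs, h1, h2⟩ := SL.first_ge h'.head h (by
          rw [he, List.flatten_cons]; exact le_append_right _ _)
        rw [List.cons.injEq] at h1
        rwa [h1.1]
      have e : l = m := le_antisymm (key h' h he.symm) (key h h' he)
      subst e
      rw [ih h.tail h'.tail (by simpa using he)]

lemma IsLyndon.append {u v : Word r} (hu : IsLyndon u) (hv : IsLyndon v) (h : u < v) :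
    IsLyndon (u ++ v) := by
  have huv : u ++ v < v := by
    by_cases hp : u <+: v
    · obtain ⟨v', rfl⟩ := hp
      rw [append_lt_append_left_iff]
      apply hv.lt_suffix rfl hu.1
      rintro rfl; simp at h
    · simpa using lt_of_not_prefix h hp v []
  refine ⟨by simp [hu.1], fun a b he ha hb => ?_⟩
  rw [wlt_iff]
  rcases List.append_eq_append_iff.1 he with ⟨c, h1, h2⟩ | ⟨c, h1, h2⟩
  · -- a = u ++ c, v = c ++ b
    exact lt_of_lt_of_le huv (hv.le_suffix h2 hb)
  · -- u = a ++ c, b = c ++ v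
    by_cases hc : c = []
    · subst hc; simp at h2; rw [h2]; exact huv
    · rw [h2]
      apply lt_of_not_prefix (hu.lt_suffix h1 ha hc)
      intro hp
      have h3 := hp.length_le
      have h4 := List.length_pos_of_ne_nil ha
      rw [h1, List.length_append] at h3; omega

lemma SL.insert {l : Word r} (hl : IsLyndon l) {ls : List (Word r)} (h : SL ls) :
    ∃ ms, SL ms ∧ ms.flatten = l ++ ls.flatten := by
  induction ls generalizing l with
  | nil => exact ⟨[l], SL.single hl, by simp⟩
  | cons m ls ih =>
    by_cases hlm : m ≤ l
    · exact ⟨l :: m :: ls, SL.cons hl h (fun x hx => (h.le_head hx).trans hlm), by simp⟩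
    · obtain ⟨ms, h1, h2⟩ := ih (hl.append h.head (not_le.1 hlm)) h.tail
      exact ⟨ms, h1, by simp [h2]⟩

lemma exists_SL (w : Word r) : ∃ ls, SL ls ∧ ls.flatten = w := by
  induction w with
  | nil => exact ⟨[], SL.nil, rfl⟩
  | cons i w ih =>
    obtain ⟨ls, h1, h2⟩ := ih
    obtain ⟨ms, h3, h4⟩ := SL.insert (isLyndon_letter i) h1
    exact ⟨ms, h3, by rw [h4, h2]; rfl⟩

/-- the Lyndon factorization -/
def fac (w : Word r) : List (Word r) := (exists_SL w).choose
lemma fac_SL (w : Word r) : SL (fac w) := (exists_SL w).choose_spec.1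
@[simp] lemma fac_flatten (w : Word r) : (fac w).flatten = w := (exists_SL w).choose_spec.2
lemma fac_eq {ls : List (Word r)} (h : SL ls) : fac ls.flatten = ls :=
  SL.unique (fac_SL _) h (fac_flatten _)
lemma fac_lyndon {l : Word r} (h : IsLyndon l) : fac l = [l] := by
  have := fac_eq (SL.single h); simpa using this
lemma fac_nil : fac ([] : Word r) = [] := by
  have := fac_eq (SL.nil (r := r)); simpa using this

lemma costd_spec {l : Word r} (hl : IsLyndon l) (h2 : 2 ≤ l.length) :
    (0 < costdLen l ∧ costdLen l < l.length) ∧ IsLyndon (l.take (costdLen l)) ∧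
      IsLyndon (l.drop (costdLen l)) := by
  classical
  have h1 : IsLyndon (l.take 1) := by
    cases l with
    | nil => simp at h2
    | cons i l => simpa using isLyndon_letter i
  have hs : 0 < costdLen l ∧ costdLen l < l.length ∧ IsLyndon (l.take (costdLen l)) := by
    unfold costdLen
    exact Nat.findGreatest_spec (P := fun k => 0 < k ∧ k < l.length ∧ IsLyndon (l.take k))
      (m := 1) (by omega) ⟨by omega, by omega, h1⟩
  have hmax : ∀ n, costdLen l < n → n < l.length → ¬ IsLyndon (l.take n) := by
    intro n hn hn' hL
    unfold costdLen at hn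
    exact Nat.findGreatest_is_greatest hn (by omega) ⟨by omega, hn', hL⟩
  refine ⟨⟨hs.1, hs.2.1⟩, hs.2.2, ?_⟩
  set l1 := l.take (costdLen l) with hl1
  set l2 := l.drop (costdLen l) with hl2
  have he : l = l1 ++ l2 := (List.take_append_drop _ _).symm
  obtain ⟨ms, hms, hfl⟩ := exists_SL l2
  have hl2ne : l2 ≠ [] := by
    intro h; have := congrArg List.length h; simp [hl2] at this; omega
  have hl1len : l1.length = costdLen l := by simp [hl1]; omega
  cases ms with
  | nil => exact absurd hfl.symm hl2ne
  | cons m ms =>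
    rcases lt_or_ge l1 m with hlt | hge
    · have hL := hs.2.2.append hms.head hlt
      have e2 : l = (l1 ++ m) ++ ms.flatten := by rw [he, ← hfl]; simp
      by_cases hn : ms.flatten = []
      · rw [List.flatten_cons, hn, List.append_nil] at hfl
        rw [← hfl]; exact hms.head
      · exfalso
        have h3 := List.length_pos_of_ne_nil hn
        have h4 := List.length_pos_of_ne_nil hms.head.1
        have h5 := congrArg List.length e2
        rw [List.length_append, List.length_append] at h5
        apply hmax (l1 ++ m).length (by rw [List.length_append]; omega)
          (by rw [List.length_append]; omega)
        have : l.take (l1 ++ m).length = l1 ++ m := by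
          rw [congrArg (List.take (l1 ++ m).length) e2, List.take_left']; rfl
        rw [this]; exact hL
    · exfalso
      obtain ⟨k, hk⟩ : ∃ k, (m :: ms).getLast (by simp) = k := ⟨_, rfl⟩
      have hkm : k ∈ m :: ms := hk ▸ List.getLast_mem _
      have hsp : (m :: ms) = (m :: ms).dropLast ++ [k] := by
        rw [← hk]; exact (List.dropLast_append_getLast _).symm
      have hl2' : l2 = (m :: ms).dropLast.flatten ++ k := by
        rw [← hfl]; conv_lhs => rw [hsp]
        simp
      have hl1ne : l1 ≠ [] := hs.2.2.1
      have h5 : l < k := hl.lt_suffix (u := l1 ++ (m :: ms).dropLast.flatten)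
        (by rw [List.append_assoc, ← hl2', ← he]) (by simp [hl1ne]) (hms.1 k hkm).1
      have h6 : k ≤ l1 := (hms.le_head hkm).trans hge
      have h7 : l1 ≤ l := by conv_rhs => rw [he]
                             exact le_append_right _ _
      exact absurd (lt_of_lt_of_le h5 (h6.trans h7)) (lt_irrefl _)

lemma lyndon_cases {l : Word r} (hl : IsLyndon l) : (∃ i, l = [i]) ∨ 
    ∃ l1 l2, l = l1 ++ l2 ∧ IsLyndon l1 ∧ IsLyndon l2 ∧ l1 = l.take (costdLen l) ∧
      l2 = l.drop (costdLen l) ∧ 0 < costdLen l ∧ costdLen l < l.length := by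
  by_cases h : 2 ≤ l.length
  · right
    obtain ⟨h1, h2, h3⟩ := costd_spec hl h
    exact ⟨_, _, (List.take_append_drop _ _).symm, h2, h3, rfl, rfl, h1.1, h1.2⟩
  · left
    rw [← List.length_eq_one_iff]
    have := List.length_pos_of_ne_nil hl.1
    omega

section brk
variable {k : Type*} [CommRing k] (c : Word r → Word r → k)

/-- generic bracketing -/
def brk (l : Word r) : Fr r k :=
  if hk : 0 < costdLen l ∧ costdLen l < l.length then
    cm (brk (l.take (costdLen l))) (brk (l.drop (costdLen l)))
      - c (l.take (costdLen l)) (l.drop (costdLen l)) •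
          cm (brk (l.drop (costdLen l))) (brk (l.take (costdLen l)))
  else Finsupp.single l 1
  termination_by l.length
  decreasing_by
    all_goals (first | (simp only [List.length_take, List.length_drop]; omega) | omega)

lemma brk_letter (i : Fin r) : brk c [i] = Finsupp.single [i] 1 := by
  rw [brk, dif_neg]
  intro h; simp at h; omega

/-- induction over Lyndon words -/
lemma lyndon_rec {P : Word r → Prop} (h1 : ∀ i, P [i])
    (h2 : ∀ l1 l2, IsLyndon l1 → IsLyndon l2 → IsLyndon (l1 ++ l2) → l1 < l2 →
      (∀ (k : Type) [CommRing k] (c : Word r → Word r → k), brk c (l1 ++ l2) = cm (brk c l1) (brk c l2)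
        - c l1 l2 • cm (brk c l2) (brk c l1)) → P l1 → P l2 → P (l1 ++ l2)) :
    ∀ l, IsLyndon l → P l := by
  intro l
  induction hn : l.length using Nat.strong_induction_on generalizing l with
  | _ n ih =>
    intro hl
    rcases lyndon_cases hl with ⟨i, rfl⟩ | ⟨l1, l2, he, hl1, hl2, h3, h4, h5, h6⟩
    · exact h1 i
    · have hlen : l.length = l1.length + l2.length := by rw [he]; simp
      have hp1 := List.length_pos_of_ne_nil hl1.1
      have hp2 := List.length_pos_of_ne_nil hl2.1
      have hlt : l1 < l2 := lt_trans (by rw [he]; exact lt_append_right _ hl2.1)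
        (hl.lt_suffix he hl1.1 hl2.1)
      have := h2 l1 l2 hl1 hl2 (he ▸ hl) hlt (by
        intro k _ c
        rw [← he, brk, dif_pos ⟨h5, h6⟩, ← h3, ← h4]) (ih l1.length (by omega) l1 rfl hl1)
          (ih l2.length (by omega) l2 rfl hl2)
      rwa [he]

/-- triangularity -/
def Tri (f : Fr r k) (w : Word r) : Prop := f w = 1 ∧ ∀ x, f x ≠ 0 → w ≤ x ∧ deg x = deg w

lemma cm_eval {f g : Fr r k} {n : ℕ} (hf : ∀ x, f x ≠ 0 → x.length = n) {a b : Word r}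
    (ha : a.length = n) : cm f g (a ++ b) = f a * g b := by
  rw [cm_apply, Finsupp.sum, Finsupp.finset_sum_apply]
  rw [Finset.sum_eq_single a]
  · rw [Finsupp.sum, Finsupp.finset_sum_apply, Finset.sum_eq_single b]
    · rw [Finsupp.single_eq_same]
    · intro x _ hx
      rw [Finsupp.single_apply, if_neg]; simpa using hx
    · intro h
      rw [Finsupp.single_eq_same, Finsupp.notMem_support_iff.1 h, mul_zero]
  · intro w hw hwa
    rw [Finsupp.sum, Finsupp.finset_sum_apply]
    apply Finset.sum_eq_zero
    intro x _
    rw [Finsupp.single_apply, if_neg]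
    intro h
    exact hwa (List.append_inj h (by rw [hf w (Finsupp.mem_support_iff.1 hw), ha])).1
  · intro h
    rw [Finsupp.notMem_support_iff.1 h]
    simp [Finsupp.sum]

lemma cm_supp {f g : Fr r k} {y : Word r} (h : cm f g y ≠ 0) :
    ∃ w x, y = w ++ x ∧ f w ≠ 0 ∧ g x ≠ 0 := by
  rw [cm_apply, Finsupp.sum, Finsupp.finset_sum_apply] at h
  obtain ⟨x, hx, h1⟩ := Finset.exists_ne_zero_of_sum_ne_zero h
  rw [Finsupp.sum, Finsupp.finset_sum_apply] at h1
  obtain ⟨y, hy, h2⟩ := Finset.exists_ne_zero_of_sum_ne_zero h1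
  rw [Finsupp.mem_support_iff] at hx hy
  rw [Finsupp.single_apply] at h2
  refine ⟨x, y, ?_, hx, hy⟩
  by_contra h3; simp [Ne.symm h3] at h2

lemma append_le_append {a b x y : Word r} (hl : a.length = b.length) (h : a ≤ b) (h' : x ≤ y) :
    a ++ x ≤ b ++ y := by
  rcases h.lt_or_eq with h | rfl
  · exact (append_lt_of_lt x y hl h).le
  · exact (append_le_append_left_iff _ _ _).2 h'

lemma Tri.cm {f g : Fr r k} {w x : Word r} (hf : Tri f w) (hg : Tri g x) : Tri (cm f g) (w ++ x) := by
  constructor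
  · rw [cm_eval (n := w.length) (fun y hy => length_of_deg (hf.2 y hy).2) rfl, hf.1, hg.1, mul_one]
  · intro y hy
    obtain ⟨a, b, rfl, ha, hb⟩ := cm_supp hy
    rw [deg_append, deg_append, (hf.2 a ha).2, (hg.2 b hb).2]
    exact ⟨append_le_append (length_of_deg (hf.2 a ha).2).symm (hf.2 a ha).1 (hg.2 b hb).1, rfl⟩

lemma Tri.sub_smul {f g : Fr r k} {w x : Word r} (hf : Tri f w) (hg : Tri g x) (h : w < x)
    (hd : deg x = deg w) (a : k) : Tri (f - a • g) w := by
  constructor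
  · have : g w = 0 := by
      by_contra h1; exact absurd (hg.2 w h1).1 (not_le.2 h)
    simp [hf.1, this]
  · intro y hy
    by_cases h1 : f y = 0
    · have h2 : g y ≠ 0 := by rintro h2; apply hy; simp [h1, h2]
      exact ⟨h.le.trans (hg.2 y h2).1, (hg.2 y h2).2.trans hd⟩
    · exact hf.2 y h1

lemma Tri.single (w : Word r) : Tri (Finsupp.single w (1 : k)) w := by
  constructor
  · simp
  · intro x hx
    have : w = x := by by_contra h; simp [Finsupp.single_apply, h] at hx
    subst this; exact ⟨le_rfl, rfl⟩

lemma lyndon_swap_lt {l1 l2 : Word r} (h : IsLyndon (l1 ++ l2)) (h1 : l1 ≠ []) (h2 : l2 ≠ []) :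
    l1 ++ l2 < l2 ++ l1 := 
  lt_of_lt_of_le (h.lt_suffix rfl h1 h2) (le_append_right _ _)

end brk

lemma brk_tri {k : Type} [CommRing k] (c : Word r → Word r → k) {l : Word r} (hl : IsLyndon l) :
    Tri (brk c l) l := by
  revert l
  apply lyndon_rec
  · intro i; rw [brk_letter]; exact Tri.single _
  · intro l1 l2 h1 h2 h h12 he t1 t2
    rw [he]
    exact (t1.cm t2).sub_smul (t2.cm t1) (lyndon_swap_lt h h1.1 h2.1)
      (by rw [deg_append, deg_append, add_comm]) _

/-- product of brackets -/
def cpr {k : Type*} [CommRing k] (c : Word r → Word r → k) (ls : List (Word r)) : Fr r k :=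
  (ls.map (brk c)).foldr (fun f g => cm f g) (Finsupp.single [] 1)

lemma cpr_nil {k : Type*} [CommRing k] (c : Word r → Word r → k) :
  cpr c [] = Finsupp.single [] 1 := rfl
lemma cpr_cons {k : Type*} [CommRing k] (c : Word r → Word r → k) (l : Word r) (ls : List (Word r)) :
  cpr c (l :: ls) = cm (brk c l) (cpr c ls) := rfl
lemma one_cm {k : Type*} [CommRing k] (f : Fr r k) : cm (Finsupp.single [] 1) f = f := by
  induction f using Finsupp.induction_linear with
  | zero => simp
  | add f g h1 h2 => simp [h1, h2]
  | single w c => rw [cm_single]; simp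
lemma cm_one {k : Type*} [CommRing k] (f : Fr r k) : cm f (Finsupp.single [] 1) = f := by
  induction f using Finsupp.induction_linear with
  | zero => simp
  | add f g h1 h2 => rw [map_add, LinearMap.add_apply, h1, h2]
  | single w c => rw [cm_single]; simp
lemma cpr_append {k : Type*} [CommRing k] (c : Word r → Word r → k) (ls ms : List (Word r)) :
    cpr c (ls ++ ms) = cm (cpr c ls) (cpr c ms) := by
  induction ls with
  | nil => rw [cpr_nil, one_cm]; rfl
  | cons l ls ih => rw [List.cons_append, cpr_cons, cpr_cons, ih, cm_assoc]
lemma cpr_single {k : Type*} [CommRing k] (c : Word r → Word r → k) (l : Word r) :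
    cpr c [l] = brk c l := by rw [cpr_cons, cpr_nil, cm_one]

lemma cpr_tri {k : Type} [CommRing k] (c : Word r → Word r → k) {ls : List (Word r)}
    (h : ∀ l ∈ ls, IsLyndon l) : Tri (cpr c ls) ls.flatten := by
  induction ls with
  | nil => exact Tri.single _
  | cons l ls ih =>
    rw [cpr_cons, List.flatten_cons]
    exact (brk_tri c (h l (by simp))).cm (ih fun x hx => h x (by simp [hx]))

/-- link with the frozen bracket -/
def cq (p : Fin r → Fin r → ℤ) : Word r → Word r → K := fun w x => qq ^ (pairW p w x)

lemma cmul_eq (f g : FA r) : cmul f g = cm f g := rfl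

lemma bracket_eq (p : Fin r → Fin r → ℤ) (l : Word r) : bracket p l = brk (cq p) l := by
  induction hn : l.length using Nat.strong_induction_on generalizing l with
  | _ n ih =>
    rw [bracket, brk]
    by_cases h1 : l.length ≤ 1
    · rw [if_pos h1, dif_neg]; omega
    · rw [if_neg h1]
      by_cases h : 0 < costdLen l ∧ costdLen l < l.length
      · rw [dif_pos h, dif_pos h, ih (l.take (costdLen l)).length _ _ rfl,
          ih (l.drop (costdLen l)).length _ _ rfl]
        · rfl
        · simp; omega
        · simp; omega
      · rw [dif_neg h, dif_neg h]

lemma cprod_eq (p : Fin r → Fin r → ℤ) (ls : List (Word r)) : cprod p ls = cpr (cq p) ls := by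
  induction ls with
  | nil => rfl
  | cons l ls ih =>
    rw [cpr_cons, ← ih, ← bracket_eq]; rfl
end

section
set_option linter.all false
/-! ### Part 4 : shuffles and the lexicographic order -/

inductive Shuf : Word r → Word r → Word r → Prop
  | nil : Shuf [] [] []
  | left (d : Fin r) {w x z : Word r} : Shuf w x z → Shuf (d :: w) x (d :: z)
  | right (d : Fin r) {w x z : Word r} : Shuf w x z → Shuf w (d :: x) (d :: z)

lemma shuf_append (w x : Word r) : Shuf w x (w ++ x) := by
  induction w with
  | nil =>
    induction x with
    | nil => exact Shuf.nil
    | cons d x ih => exact Shuf.right d ih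
  | cons d w ih => exact Shuf.left d ih

lemma sh_supp {k : Type*} [CommRing k] (t : Fin r → Fin r → k) {u v : Fn r k} {z : Word r}
    (h : sh t u v z ≠ 0) : ∃ w x, Shuf w x z ∧ u w ≠ 0 ∧ v x ≠ 0 := by
  induction z generalizing u v with
  | nil =>
    rw [sh_nil] at h
    exact ⟨[], [], Shuf.nil, left_ne_zero_of_mul h, right_ne_zero_of_mul h⟩
  | cons d z ih =>
    rw [sh_cons] at h
    by_cases h1 : sh t (Dl d u) (mulc (t d) v) z = 0
    · rw [h1, zero_add] at h
      obtain ⟨w, x, h2, h3, h4⟩ := ih h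
      exact ⟨w, d :: x, Shuf.right d h2, h3, h4⟩
    · obtain ⟨w, x, h2, h3, h4⟩ := ih h1
      exact ⟨d :: w, x, Shuf.left d h2, h3, right_ne_zero_of_mul h4⟩

/-- classical parameters -/
abbrev t1 : Fin r → Fin r → ℚ := fun _ _ => 1
abbrev c1 : Word r → Word r → ℚ := fun _ _ => 1

lemma mulc_one (d : Fin r) (u : Fn r ℚ) : mulc (t1 d) u = u := by
  funext w; simp [chi]

lemma sh1_nonneg {u v : Fn r ℚ} (hu : ∀ w, 0 ≤ u w) (hv : ∀ w, 0 ≤ v w) (z : Word r) :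
    0 ≤ sh t1 u v z := by
  induction z generalizing u v with
  | nil => rw [sh_nil]; exact mul_nonneg (hu _) (hv _)
  | cons d z ih =>
    rw [sh_cons, mulc_one]
    exact add_nonneg (ih (fun w => hu _) hv) (ih hu (fun w => hv _))

lemma de_nonneg (w x : Word r) : 0 ≤ (de w x : ℚ) := by
  rw [de_apply]; split_ifs <;> norm_num

lemma sh1_pos {w x z : Word r} (h : Shuf w x z) : 0 < sh t1 (de w) (de x) z := by
  induction h with
  | nil => simp [sh_nil, de_apply]
  | left d h ih =>
    rw [sh_cons, mulc_one]
    apply add_pos_of_pos_of_nonneg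
    · rw [Dl_de_cons, if_pos rfl]; exact ih
    · exact sh1_nonneg (de_nonneg _) (fun w => de_nonneg _ _) _
  | right d h ih =>
    rw [sh_cons, mulc_one]
    apply add_pos_of_nonneg_of_pos
    · exact sh1_nonneg (fun w => de_nonneg _ _) (de_nonneg _) _
    · rw [Dl_de_cons, if_pos rfl]; exact ih

/-- derivations of the classical shuffle -/
def Der (φ : Fn r ℚ →ₗ[ℚ] Fn r ℚ) : Prop :=
  ∀ u v, φ (sh t1 u v) = sh t1 (φ u) v + sh t1 u (φ v)

lemma Der_Dl (d : Fin r) : Der (Dl d) := by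
  intro u v; rw [Dl_sh, mulc_one]

lemma Der.bracket {φ ψ : Fn r ℚ →ₗ[ℚ] Fn r ℚ} (h : Der φ) (h' : Der ψ) :
    Der (φ ∘ₗ ψ - ψ ∘ₗ φ) := by
  intro u v
  simp only [LinearMap.sub_apply, LinearMap.comp_apply, h' u v, h u v, map_add, h _ _, h' _ _,
    map_sub]
  abel

lemma Der_brk {l : Word r} (hl : IsLyndon l) : Der (Lop (brk c1 l)) := by
  revert l
  apply lyndon_rec
  · intro i
    have : Lop (brk c1 [i]) = Dl i := by
      ext u y; rw [brk_letter, Lop_single]; simp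
    rw [this]; exact Der_Dl i
  · intro l1 l2 _ _ _ _ he h1 h2
    rw [he, one_smul, Lop_sub, Lop_cm, Lop_cm]
    exact h2.bracket h1

lemma finite_deg (ν : Fin r → ℕ) : Set.Finite {w : Word r | deg w = ν} := by
  by_cases h : ∃ w : Word r, deg w = ν
  · obtain ⟨w, hw⟩ := h
    refine (List.finite_length_eq (Fin r) w.length).subset ?_
    intro x hx
    exact length_of_deg (by rw [hw]; exact hx)
  · have : {w : Word r | deg w = ν} = ∅ := by
      ext w; simp; exact fun hw => h ⟨w, hw⟩
    rw [this]; exact Set.finite_empty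

lemma exists_max_of {P : Word r → Prop} {ν : Fin r → ℕ} (hP : ∀ w, P w → deg w = ν) (w0 : Word r)
    (h0 : P w0) : ∃ g, P g ∧ w0 ≤ g ∧ ∀ w, P w → w ≤ g := by
  have hf : Set.Finite {w | P w} := (finite_deg ν).subset hP
  obtain ⟨g, hg, hmax⟩ := Set.exists_max_image {w | P w} id hf ⟨w0, h0⟩
  exact ⟨g, hg, hmax w0 h0, hmax⟩

lemma exists_max {k : Type*} [CommRing k] {u : Fn r k} {ν : Fin r → ℕ} (hu : HomF u ν)
    {w0 : Word r} (h0 : u w0 ≠ 0) : ∃ g, u g ≠ 0 ∧ w0 ≤ g ∧ ∀ w, u w ≠ 0 → w ≤ g :=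
  exists_max_of (P := fun w => u w ≠ 0) hu w0 h0

/-- pairing of a triangular element with a function bounded by `w` -/
lemma Tri.pr {k : Type*} [CommRing k] {f : Fr r k} {w : Word r} (hf : Tri f w) {u : Fn r k}
    (hu : ∀ x, u x ≠ 0 → x ≤ w) : pr f u = u w := by
  rw [pr_def, Finsupp.sum, Finset.sum_eq_single w]
  · rw [hf.1, one_mul]
  · intro x hx hxw
    by_contra h
    have h1 := (hf.2 x (Finsupp.mem_support_iff.1 hx)).1
    exact hxw (le_antisymm (hu x (right_ne_zero_of_mul h)) h1)
  · intro h; rw [Finsupp.notMem_support_iff.1 h, zero_mul]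

lemma Tri.pr_zero {k : Type*} [CommRing k] {f : Fr r k} {w : Word r} (hf : Tri f w) {u : Fn r k}
    (hu : ∀ x, u x ≠ 0 → x < w) : _root_.pr f u = 0 := by
  rw [hf.pr fun x hx => (hu x hx).le]
  by_contra h; exact lt_irrefl _ (hu w h)

lemma Tri.Lop_zero {k : Type*} [CommRing k] {f : Fr r k} {w : Word r} (hf : Tri f w) {u : Fn r k}
    (hu : ∀ x, u x ≠ 0 → x < w) : Lop f u = 0 := by
  funext y
  rw [Lop_apply]
  apply hf.pr_zero
  intro x hx
  exact lt_of_le_of_lt (le_append_right _ _) (hu _ hx)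

lemma de_ne {k : Type*} [CommRing k] {w x : Word r} (h : (de w x : k) ≠ 0) : x = w := by
  by_contra h1; simp [de_apply, h1] at h

lemma shuf_lt {m : Word r} (hm : IsLyndon m) {w x z : Word r} (hw : w < m) (hx : x < m)
    (h : Shuf w x z) : z < m := by
  by_contra hz
  rw [not_lt] at hz
  have hH : HomF (sh t1 (de w) (de x) : Fn r ℚ) (deg w + deg x) := (HomF.de w).sh t1 (HomF.de x)
  obtain ⟨g, h1, h2, h3⟩ := exists_max hH (sh1_pos h).ne'
  have hT := cpr_tri c1 (fac_SL g).1
  have e := hT.pr (u := sh t1 (de w) (de x)) (by rw [fac_flatten]; exact h3)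
  rw [fac_flatten] at e
  obtain ⟨z1, zs, hz1, hz2⟩ := SL.first_ge hm (fac_SL g) (by rw [fac_flatten]; exact hz.trans h2)
  have hL : IsLyndon z1 := (fac_SL g).1 z1 (by rw [hz1]; simp)
  have hb := brk_tri c1 hL
  rw [hz1, cpr_cons, pr_eq_Lop, Lop_cm, LinearMap.comp_apply, Der_brk hL,
    hb.Lop_zero (u := de w) (fun y hy => by rw [de_ne hy]; exact lt_of_lt_of_le hw hz2),
    hb.Lop_zero (u := de x) (fun y hy => by rw [de_ne hy]; exact lt_of_lt_of_le hx hz2)] at e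
  simp at e
  exact h1 e.symm

/-- shuffle closure -/
lemma sh_lt {k : Type*} [CommRing k] (t : Fin r → Fin r → k) {m : Word r} (hm : IsLyndon m)
    {u v : Fn r k} (hu : ∀ w, u w ≠ 0 → w < m) (hv : ∀ w, v w ≠ 0 → w < m) :
    ∀ w, sh t u v w ≠ 0 → w < m := by
  intro z hz
  obtain ⟨w, x, h1, h2, h3⟩ := sh_supp t hz
  exact shuf_lt hm (hu w h2) (hv x h3) h1

lemma Lop_brk_self {l : Word r} (hl : IsLyndon l) (g : Word r) :
    Lop (brk c1 l) (de (l ++ g)) = de g := by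
  funext y
  have hb := brk_tri c1 hl
  rw [Lop_apply]
  have : pr (brk c1 l) (fun x => de (l ++ g) (x ++ y)) = pr (brk c1 l) (fun x => if x = l then de g y else 0) := by
    apply pr_congr
    intro x hx
    have hlen := length_of_deg (hb.2 x hx).2
    by_cases h : x = l
    · subst h; simp [de_apply]
    · rw [if_neg h, de_apply, if_neg]
      intro h2; exact h (List.append_inj h2 hlen).1
  rw [this, hb.pr]
  · simp
  · intro x hx; by_cases h : x = l
    · exact h.le
    · simp [h] at hx

lemma pr_cpr_le {l : Word r} (hl : IsLyndon l) (zs ls : List (Word r)) (hz : SL zs)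
    (hls : SL (l :: ls)) (h : pr (cpr c1 zs) (sh t1 (de l) (de ls.flatten)) ≠ 0) :
    zs.flatten ≤ l ++ ls.flatten := by
  induction zs generalizing ls with
  | nil => exact nil_le' _
  | cons z zs ih =>
    have hL := hz.head
    have hb := brk_tri c1 hL
    rcases lt_trichotomy z l with hzl | hzl | hzl
    · exact (lt_of_lt_of_le (flatten_lt hl (fun x hx => lt_of_le_of_lt (hz.le_head hx) hzl))
        (le_append_right _ _)).le
    · subst hzl
      rw [cpr_cons, pr_eq_Lop, Lop_cm, LinearMap.comp_apply, Der_brk hL] at h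
      have e1 : Lop (brk c1 z) (de z) = de [] := by
        have := Lop_brk_self hL []; simpa using this
      rw [e1, sh_one_left, map_add, Pi.add_apply, ← pr_eq_Lop, ← pr_eq_Lop] at h
      rw [List.flatten_cons, append_le_append_left_iff]
      by_cases h0 : pr (cpr c1 zs) (de ls.flatten) = 0
      · rw [h0, zero_add] at h
        have hne : Lop (brk c1 z) (de ls.flatten) ≠ 0 := by intro h'; apply h; simp [h']
        have : ∃ ls', ls = z :: ls' := by
          by_contra hno
          apply hne
          apply hb.Lop_zero
          intro x hx
          rw [de_ne hx]
          apply flatten_lt hL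
          intro y hy
          have h3 : ∀ y ∈ ls, y ≤ z := fun y hy => hls.le_head (by simp [hy])
          cases ls with
          | nil => simp at hy
          | cons a ls =>
            refine lt_of_le_of_lt (hls.tail.le_head hy) (lt_of_le_of_ne (h3 a (by simp)) ?_)
            rintro rfl; exact hno ⟨_, rfl⟩
        obtain ⟨ls', rfl⟩ := this
        rw [List.flatten_cons, Lop_brk_self hL] at h
        rw [List.flatten_cons]
        exact ih ls' hz.tail hls.tail h
      · by_contra hlt
        apply h0
        have := cpr_tri c1 hz.tail.1
        apply this.pr_zero
        intro x hx
        rw [de_ne hx]; exact not_le.1 hlt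
    · exfalso; apply h
      rw [cpr_cons, pr_eq_Lop, Lop_cm, LinearMap.comp_apply, Der_brk hL, hb.Lop_zero, hb.Lop_zero]
      · simp
      · intro x hx; rw [de_ne hx]
        exact flatten_lt hL (fun y hy => lt_of_le_of_lt (hls.le_head (by simp [hy])) hzl)
      · intro x hx; rw [de_ne hx]; exact hzl

lemma shuf_le {l : Word r} {ls : List (Word r)} (hls : SL (l :: ls)) {z : Word r}
    (h : Shuf l ls.flatten z) : z ≤ l ++ ls.flatten := by
  have hH : HomF (sh t1 (de l) (de ls.flatten) : Fn r ℚ) (deg l + deg ls.flatten) :=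
    (HomF.de _).sh t1 (HomF.de _)
  obtain ⟨g, h1, h2, h3⟩ := exists_max hH (sh1_pos h).ne'
  refine h2.trans ?_
  have hT := cpr_tri c1 (fac_SL g).1
  have e := hT.pr (u := sh t1 (de l) (de ls.flatten)) (by rw [fac_flatten]; exact h3)
  have := pr_cpr_le hls.head (fac g) ls (fac_SL g) hls (by rw [e, fac_flatten]; exact h1)
  rwa [fac_flatten] at this

lemma shuf_replace {w x z : Word r} (h : Shuf w x z) : ∀ (l g : Word r), w ≤ l → x ≤ g →
    w.length = l.length → x.length = g.length →
    ∃ z', Shuf l g z' ∧ z ≤ z' ∧ (z = z' → w = l ∧ x = g) := by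
  have key : ∀ {d e : Fin r} {a b : Word r}, d :: a ≤ e :: b → d < e ∨ d = e ∧ a ≤ b := by
    intro d e a b h
    rcases h.lt_or_eq with h | h
    · rw [cons_lt_cons_iff'] at h
      rcases h with h | h
      · exact Or.inl h
      · exact Or.inr ⟨h.1, h.2.le⟩
    · rw [List.cons.injEq] at h; exact Or.inr ⟨h.1, h.2.le⟩
  induction h with
  | nil =>
    intro l g _ _ h1 h2
    have : l = [] := List.length_eq_zero_iff.1 h1.symm
    have : g = [] := List.length_eq_zero_iff.1 h2.symm
    subst_vars
    exact ⟨[], Shuf.nil, le_rfl, fun _ => ⟨rfl, rfl⟩⟩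
  | left d h ih =>
    intro l g h1 h2 h3 h4
    cases l with
    | nil => simp at h3
    | cons e l =>
      rcases key h1 with h5 | ⟨rfl, h5⟩
      · refine ⟨e :: (l ++ g), Shuf.left e (shuf_append l g), ?_, ?_⟩
        · exact ((cons_lt_cons_iff' _ _ _ _).2 (Or.inl h5)).le
        · intro h6; rw [List.cons.injEq] at h6; exact absurd h6.1 h5.ne
      · obtain ⟨z', h6, h7, h8⟩ := ih l g h5 h2 (by simpa using h3) h4
        refine ⟨d :: z', Shuf.left d h6, ?_, ?_⟩
        · exact (append_le_append_left_iff [d] _ _).2 h7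
        · intro h9; rw [List.cons.injEq] at h9
          obtain ⟨rfl, rfl⟩ := h8 h9.2; exact ⟨rfl, rfl⟩
  | right d h ih =>
    intro l g h1 h2 h3 h4
    cases g with
    | nil => simp at h4
    | cons e g =>
      rcases key h2 with h5 | ⟨rfl, h5⟩
      · refine ⟨e :: (l ++ g), Shuf.right e (shuf_append l g), ?_, ?_⟩
        · exact ((cons_lt_cons_iff' _ _ _ _).2 (Or.inl h5)).le
        · intro h6; rw [List.cons.injEq] at h6; exact absurd h6.1 h5.ne
      · obtain ⟨z', h6, h7, h8⟩ := ih l g h1 h5 h3 (by simpa using h4)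
        refine ⟨d :: z', Shuf.right d h6, ?_, ?_⟩
        · exact (append_le_append_left_iff [d] _ _).2 h7
        · intro h9; rw [List.cons.injEq] at h9
          obtain ⟨rfl, rfl⟩ := h8 h9.2; exact ⟨rfl, rfl⟩

/-- `g` is the maximal word of `u` -/
def IsMx {k : Type*} [CommRing k] (u : Fn r k) (g : Word r) : Prop :=
  HomF u (deg g) ∧ u g ≠ 0 ∧ ∀ w, u w ≠ 0 → w ≤ g

lemma IsMx.sh {k : Type*} [CommRing k] [IsDomain k] (t : Fin r → Fin r → k) {l : Word r}
    {ls : List (Word r)} (hls : SL (l :: ls)) {u v : Fn r k} (hu : IsMx u l) (hv : IsMx v ls.flatten)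
    (hne : sh t (de l) (de ls.flatten) (l ++ ls.flatten) ≠ 0) :
    IsMx (sh t u v) (l ++ ls.flatten) := by
  set g := ls.flatten with hg
  have key : ∀ {w x z : Word r}, Shuf w x z → w ≤ l → x ≤ g → deg w = deg l → deg x = deg g →
      z ≤ l ++ g ∧ (z = l ++ g → w = l ∧ x = g) := by
    intro w x z h h1 h2 h3 h4
    obtain ⟨z', h5, h6, h7⟩ := shuf_replace h l g h1 h2 (length_of_deg h3) (length_of_deg h4)
    have h8 := shuf_le hls h5
    refine ⟨h6.trans h8, fun h9 => h7 (le_antisymm h6 (by rw [h9]; exact h8))⟩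
  refine ⟨by rw [deg_append]; exact hu.1.sh t hv.1, ?_, ?_⟩
  · set u' := u - u l • de l with hu'
    set v' := v - v g • de g with hv'
    have e1 : u = u l • de l + u' := by rw [hu']; abel
    have e2 : v = v g • de g + v' := by rw [hv']; abel
    have hu0 : ∀ w, u' w ≠ 0 → u w ≠ 0 ∧ w ≠ l := by
      intro w hw
      by_cases h : w = l
      · exfalso; apply hw; simp [hu', h, de_apply]
      · refine ⟨?_, h⟩
        simpa [hu', de_apply, h] using hw
    have hv0 : ∀ w, v' w ≠ 0 → v w ≠ 0 ∧ w ≠ g := by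
      intro w hw
      by_cases h : w = g
      · exfalso; apply hw; simp [hv', h, de_apply]
      · refine ⟨?_, h⟩
        simpa [hv', de_apply, h] using hw
    have z1 : _root_.sh t u' v (l ++ g) = 0 := by
      by_contra h
      obtain ⟨w, x, h1, h2, h3⟩ := sh_supp t h
      obtain ⟨h4, h5⟩ := hu0 w h2
      exact h5 ((key h1 (hu.2.2 w h4) (hv.2.2 x h3) (hu.1 w h4) (hv.1 x h3)).2 rfl).1
    have z2 : _root_.sh t (de l) v' (l ++ g) = 0 := by
      by_contra h
      obtain ⟨w, x, h1, h2, h3⟩ := sh_supp t h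
      obtain ⟨h4, h5⟩ := hv0 x h3
      rw [de_ne h2] at h1
      exact h5 ((key h1 le_rfl (hv.2.2 x h4) rfl (hv.1 x h4)).2 rfl).2
    have : _root_.sh t u v (l ++ g) = u l * v g * _root_.sh t (de l) (de g) (l ++ g) := by
      conv_lhs => rw [e1]
      rw [map_add, LinearMap.add_apply, Pi.add_apply, z1, add_zero, map_smul, LinearMap.smul_apply,
        Pi.smul_apply]
      conv_lhs => rw [e2]
      rw [map_add, Pi.add_apply, z2, add_zero, map_smul, Pi.smul_apply, smul_eq_mul, smul_eq_mul,
        mul_assoc]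
    rw [this]
    exact mul_ne_zero (mul_ne_zero hu.2.1 hv.2.1) hne
  · intro z hz
    obtain ⟨w, x, h1, h2, h3⟩ := sh_supp t hz
    exact (key h1 (hu.2.2 w h2) (hv.2.2 x h3) (hu.1 w h2) (hv.1 x h3)).1
end

section
set_option linter.all false
/-! ### Part 5 : strings for sl2 -/

structure Strg0 {V : Type*} [AddCommGroup V] [Module ℚ V] (E F : V →ₗ[ℚ] V) (M : ℤ → Submodule ℚ V)
    (w : ℤ) : Prop where
  hE : ∀ n x, x ∈ M n → E x ∈ M (n + 1)
  hF : ∀ n x, x ∈ M n → F x ∈ M (n - 1)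
  comm : ∀ n x, x ∈ M n → E (F x) - F (E x) = ((w + 2 * n : ℤ) : ℚ) • x
  nE : ∀ n x, x ∈ M n → ∃ m, (E ^ m) x = 0
  nF : ∀ n x, x ∈ M n → ∃ m, (F ^ m) x = 0

structure Strg {V : Type*} [AddCommGroup V] [Module ℚ V] (E F : V →ₗ[ℚ] V) (M : ℤ → Submodule ℚ V)
    (w : ℤ) : Prop extends Strg0 E F M w where
  dim : ∀ n x y, x ∈ M n → y ∈ M n → x ≠ 0 → ∃ c : ℚ, y = c • x

namespace Strg0
variable {V : Type*} [AddCommGroup V] [Module ℚ V] {E F : V →ₗ[ℚ] V} {M : ℤ → Submodule ℚ V} {w : ℤ}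

lemma mem_E (S : Strg0 E F M w) {n x} (hx : x ∈ M n) (m : ℕ) : (E ^ m) x ∈ M (n + m) := by
  induction m with
  | zero => simpa using hx
  | succ m ih =>
    rw [pow_succ', Module.End.mul_apply]
    have := S.hE _ _ ih
    rwa [show n + (m : ℤ) + 1 = n + ((m + 1 : ℕ) : ℤ) by push_cast; ring] at this

lemma FE (S : Strg0 E F M w) {n x} (hx : x ∈ M n) (m : ℕ) :
    F ((E ^ (m + 1)) x) = (E ^ (m + 1)) (F x) - (((m + 1) * (w + 2 * n + m) : ℤ) : ℚ) • (E ^ m) x := by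
  induction m with
  | zero =>
    have := S.comm _ _ hx
    simp only [zero_add, pow_one, pow_zero, Module.End.one_apply]
    rw [eq_sub_iff_add_eq, ← eq_sub_iff_add_eq'] 
    rw [this]; simp
  | succ m ih =>
    have h1 := S.comm _ _ (S.mem_E hx (m + 1))
    have h2 : F ((E ^ (m + 1 + 1)) x) = E (F ((E ^ (m + 1)) x)) -
        ((w + 2 * (n + (m + 1 : ℕ)) : ℤ) : ℚ) • (E ^ (m + 1)) x := by
      rw [pow_succ' E (m + 1), Module.End.mul_apply, ← h1]; abel
    rw [h2, ih, map_sub, map_smul, ← Module.End.mul_apply, ← pow_succ', ← Module.End.mul_apply (f := E) (g := E ^ m),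
      ← pow_succ', sub_sub, ← add_smul]
    congr 2; push_cast; ring

lemma last_E (S : Strg0 E F M w) {n x} (hx : x ∈ M n) (h0 : x ≠ 0) :
    ∃ m, (E ^ m) x ≠ 0 ∧ (E ^ (m + 1)) x = 0 := by
  obtain ⟨m, hm⟩ := S.nE n x hx
  by_contra h
  push Not at h
  have : ∀ m, (E ^ m) x ≠ 0 := by
    intro m; induction m with
    | zero => simpa using h0
    | succ m ih => exact h m ih
  exact this m hm

lemma F_inj (S : Strg0 E F M w) {n x} (hx : x ∈ M n) (h0 : x ≠ 0) (hw : 0 < w + 2 * n) : F x ≠ 0 := by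
  intro hF
  obtain ⟨m, h1, h2⟩ := S.last_E hx h0
  have := S.FE hx m
  rw [h2, hF, map_zero, map_zero, zero_sub, eq_comm, neg_eq_zero, smul_eq_zero] at this
  rcases this with h | h
  · rw [Int.cast_eq_zero] at h
    have : 0 < ((m : ℤ) + 1) * (w + 2 * n + m) := by positivity
    omega
  · exact h1 h

end Strg0

namespace Strg
variable {V : Type*} [AddCommGroup V] [Module ℚ V] {E F : V →ₗ[ℚ] V} {M : ℤ → Submodule ℚ V} {w : ℤ}

lemma swap (S : Strg E F M w) : Strg F E (fun n => M (-n)) (-w) where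
  hE n x hx := by have := S.hF _ _ hx; rwa [show -n - 1 = -(n + 1) by ring] at this
  hF n x hx := by have := S.hE _ _ hx; rwa [show -n + 1 = -(n - 1) by ring] at this
  dim n := S.dim (-n)
  comm n x hx := by
    have := S.comm _ _ hx
    rw [← neg_inj, neg_sub, this, ← neg_smul]; congr 1; push_cast; ring
  nE n := S.nF (-n)
  nF n := S.nE (-n)

lemma E_inj' (S : Strg E F M w) {n x} (hx : x ∈ M n) (h0 : x ≠ 0) (hw : w + 2 * n < 0) : E x ≠ 0 :=
  S.swap.F_inj (n := -n) (by simpa using hx) h0 (by linarith)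

lemma E_inj (S : Strg E F M w) {n x y} (hx : x ∈ M n) (h0 : x ≠ 0) (hy : y ∈ M (n + 1)) (hy0 : y ≠ 0) :
    E x ≠ 0 := by
  by_cases hw : w + 2 * n < 0
  · exact S.E_inj' hx h0 hw
  · intro hE
    have hy' : 0 < w + 2 * (n + 1) := by linarith
    have h1 := S.F_inj hy hy0 hy'
    have h2 := S.hF _ _ hy
    rw [add_sub_cancel_right] at h2
    obtain ⟨c, hc⟩ := S.dim n x (F y) hx h2 h0
    have h3 : E (F y) = 0 := by rw [hc, map_smul, hE, smul_zero]
    obtain ⟨m, h4, h5⟩ := S.last_E hy hy0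
    have := S.FE hy m
    rw [h5, map_zero, pow_succ, Module.End.mul_apply, h3, map_zero, zero_sub, eq_comm, neg_eq_zero,
      smul_eq_zero] at this
    rcases this with h | h
    · rw [Int.cast_eq_zero] at h
      have : 0 < ((m : ℤ) + 1) * (w + 2 * (n + 1) + m) := by positivity
      omega
    · exact h4 h

lemma F_pow (S : Strg E F M w) {n x} (hx : x ∈ M n) (h0 : x ≠ 0) (j : ℕ) (hj : (j : ℤ) ≤ w + 2 * n) :
    (F ^ j) x ≠ 0 := by
  induction j with
  | zero => simpa using h0
  | succ j ih =>
    have ih := ih (by push_cast at hj; linarith)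
    have memF : ∀ j : ℕ, (F ^ j) x ∈ M (n - j) := by
      intro j
      have := S.swap.mem_E (n := -n) (by simpa using hx) j
      rwa [show -(-n + (j : ℤ)) = n - j by ring] at this
    intro hF
    rw [pow_succ', Module.End.mul_apply] at hF
    set z := (F ^ j) x with hz
    obtain ⟨K, h1, h2⟩ := S.last_E (memF j) ih
    have h3 := S.FE (memF j) K
    rw [h2, map_zero, hF, map_zero, zero_sub, eq_comm, neg_eq_zero, smul_eq_zero] at h3
    rcases h3 with h3 | h3
    · rw [Int.cast_eq_zero] at h3
      have h4 : w + 2 * (n - j) + K = 0 := by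
        rcases mul_eq_zero.1 h3 with h | h
        · omega
        · exact h
      have hKj : K + 1 ≤ j := by push_cast at hj; omega
      -- E^K z in M (n - j + K), nonzero; M (n-j+K+1) contains F^(j-K-1) x
      have h5 := memF (j - (K + 1))
      have h6 : (F ^ (j - (K + 1))) x ≠ 0 := by
        intro h
        apply ih
        rw [hz, show j = (K + 1) + (j - (K + 1)) by omega, pow_add, Module.End.mul_apply, h, map_zero]
      have e : n - ((j - (K + 1) : ℕ) : ℤ) = (n - j + K) + 1 := by
        push_cast [Nat.cast_sub hKj]; ring
      rw [e] at h5
      have := S.E_inj (S.mem_E (memF j) K) h1 h5 h6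
      rw [pow_succ', Module.End.mul_apply] at h2
      exact this h2
    · exact h1 h3

/-- reflection -/
lemma refl (S : Strg E F M w) {n x} (hx : x ∈ M n) (h0 : x ≠ 0) : ∃ y ∈ M (n - (w + 2 * n)), y ≠ 0 := by
  rcases le_total 0 (w + 2 * n) with h | h
  · obtain ⟨j, hj⟩ := Int.eq_ofNat_of_zero_le h
    refine ⟨(F ^ j) x, ?_, S.F_pow hx h0 j (by rw [hj])⟩
    have := S.swap.mem_E (n := -n) (by simpa using hx) j
    rwa [show -(-n + (j : ℤ)) = n - (w + 2 * n) by rw [hj]; ring] at this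
  · obtain ⟨j, hj⟩ := Int.eq_ofNat_of_zero_le (show 0 ≤ -(w + 2 * n) by linarith)
    refine ⟨(E ^ j) x, ?_, S.swap.F_pow (n := -n) (by simpa using hx) h0 j (by linarith)⟩
    have := S.mem_E hx j
    rwa [show n + (j : ℤ) = n - (w + 2 * n) by linarith] at this

end Strg

/-- exponentials of degree 3 -/
lemma exp_conj {A : Type*} [Ring A] [Algebra ℚ A] {E X Y Z : A} (hE : E ^ 4 = 0)
    (h1 : E * X = X * E + Y) (h2 : E * Y = Y * E + Z) (h3 : E * Z = Z * E) :
    (1 + E + (1 / 2 : ℚ) • E ^ 2 + (1 / 6 : ℚ) • E ^ 3) * X =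
      (X + Y + (1 / 2 : ℚ) • Z) * (1 + E + (1 / 2 : ℚ) • E ^ 2 + (1 / 6 : ℚ) • E ^ 3) := by
  have a2 : E ^ 2 * X = X * E ^ 2 + 2 • (Y * E) + Z := by
    rw [pow_two, mul_assoc, h1, mul_add, ← mul_assoc, h1, h2, add_mul, mul_assoc, ← pow_two]; abel
  have a3 : E ^ 3 * X = X * E ^ 3 + 3 • (Y * E ^ 2) + 3 • (Z * E) := by
    rw [pow_succ' E 2, mul_assoc, a2, mul_add, mul_add, mul_smul_comm, ← mul_assoc, h1, ← mul_assoc, h2, h3,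
      add_mul, add_mul]
    simp only [mul_assoc, ← pow_two, ← pow_succ', smul_add]
    abel
  have a4 : 4 • (Y * E ^ 3) + 6 • (Z * E ^ 2) = 0 := by
    have : E ^ 4 * X = X * E ^ 4 + 4 • (Y * E ^ 3) + 6 • (Z * E ^ 2) := by
      rw [pow_succ' E 3, mul_assoc, a3, mul_add, mul_add, mul_smul_comm, mul_smul_comm, ← mul_assoc, h1,
        ← mul_assoc, h2, ← mul_assoc, h3, add_mul, add_mul]
      simp only [mul_assoc, ← pow_two, ← pow_succ', smul_add]
      abel
    rw [hE, zero_mul, mul_zero, zero_add] at this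
    exact this.symm
  have a5 : Z * E ^ 3 = 0 := by
    have e : (4 • (Y * E ^ 3) + 6 • (Z * E ^ 2)) * E = 0 := by rw [a4, zero_mul]
    rw [add_mul, smul_mul_assoc, smul_mul_assoc, mul_assoc, mul_assoc, ← pow_succ, ← pow_succ, hE, mul_zero,
      smul_zero, zero_add] at e
    rw [← Nat.cast_smul_eq_nsmul ℚ] at e
    rcases smul_eq_zero.1 e with h | h
    · norm_num at h
    · exact h
  have a4' : (1 / 6 : ℚ) • (Y * E ^ 3) + (1 / 4 : ℚ) • (Z * E ^ 2) = 0 := by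
    have := congrArg (fun x => (1 / 24 : ℚ) • x) a4
    simp only [smul_add, smul_zero, ← Nat.cast_smul_eq_nsmul ℚ, smul_smul] at this
    norm_num at this
    convert this using 3 <;> norm_num
  simp only [add_mul, mul_add, smul_mul_assoc, mul_smul_comm, one_mul, mul_one, h1, a2, a3, smul_smul,
    smul_add, a5, smul_zero, add_zero, ← Nat.cast_smul_eq_nsmul ℚ]
  norm_num
  have b : (1 / 6 : ℚ) • (Y * E ^ 3) = - ((1 / 4 : ℚ) • (Z * E ^ 2)) := eq_neg_of_add_eq_zero_left a4'
  norm_num at b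
  rw [b]
  abel
end

section
set_option linter.all false
/-! ### Part 6 : the abstract Lie algebra -/

structure CL (C : CartanData r) (L : Type) [LieRing L] [LieAlgebra ℚ L] where
  e : Fin r → L
  f : Fin r → L
  h : Fin r → L
  ef : ∀ i j, ⁅e i, f j⁆ = if i = j then h i else 0
  he : ∀ i j, ⁅h i, e j⁆ = ((C.a i j : ℤ) : ℚ) • e j
  hf : ∀ i j, ⁅h i, f j⁆ = -((C.a i j : ℤ) : ℚ) • f j
  serre : ∀ i j, i ≠ j → ∃ m : ℕ, ((LieAlgebra.ad ℚ L (e i)) ^ m) (e j) = 0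
  e0 : ∀ i, e i ≠ 0

def al (i : Fin r) : Fin r → ℤ := Pi.single i 1

def dz (w : Word r) : Fin r → ℤ := fun i => (w.count i : ℤ)

lemma dz_nil : dz ([] : Word r) = 0 := by ext; simp [dz]

lemma dz_cons (i : Fin r) (w : Word r) : dz (i :: w) = dz w + al i := by
  ext j; simp only [dz, al, List.count_cons, Pi.add_apply, Pi.single_apply]
  by_cases h : i = j
  · subst h; simp
  · simp [h, Ne.symm h]

lemma dz_append (v w : Word r) : dz (v ++ w) = dz v + dz w := by
  ext j; simp [dz]

lemma dz_single (i : Fin r) : dz [i] = al i := by rw [dz_cons, dz_nil, zero_add]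

lemma dz_nonneg (w : Word r) (i) : 0 ≤ dz w i := by simp [dz]

lemma dz_eq_zero {w : Word r} : dz w = 0 ↔ w = [] := by
  constructor
  · intro h
    cases w with
    | nil => rfl
    | cons i w =>
      have := congrFun h i
      have h2 := dz_nonneg w i
      rw [dz_cons] at this; simp [al] at this; omega
  · rintro rfl; exact dz_nil

lemma dz_eq_deg (w x : Word r) : dz w = dz x ↔ deg w = deg x := by
  simp only [funext_iff, dz, deg, Nat.cast_inj]

def wt (C : CartanData r) (β : Fin r → ℤ) (i : Fin r) : ℤ := ∑ j, C.a i j * β j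

def ip (C : CartanData r) (β γ : Fin r → ℤ) : ℤ := ∑ i, ∑ j, β i * γ j * C.p i j

lemma p_symm (C : CartanData r) (i j) : C.p i j = C.p j i := C.dsymm i j

lemma wt_add (C : CartanData r) (β γ : Fin r → ℤ) (i) : wt C (β + γ) i = wt C β i + wt C γ i := by
  simp [wt, mul_add, Finset.sum_add_distrib]
lemma wt_smul (C : CartanData r) (n : ℤ) (γ : Fin r → ℤ) (i) : wt C (n • γ) i = n * wt C γ i := by
  simp only [wt, Finset.mul_sum, Pi.smul_apply, smul_eq_mul]; congr 1; ext; ring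
lemma wt_neg (C : CartanData r) (γ : Fin r → ℤ) (i) : wt C (-γ) i = - wt C γ i := by
  simp [wt]
lemma wt_sub (C : CartanData r) (β γ : Fin r → ℤ) (i) : wt C (β - γ) i = wt C β i - wt C γ i := by
  rw [sub_eq_add_neg, wt_add, wt_neg]; ring
lemma wt_al (C : CartanData r) (i j) : wt C (al j) i = C.a i j := by
  simp [wt, al, Pi.single_apply]
lemma wt_zero (C : CartanData r) (i) : wt C 0 i = 0 := by simp [wt]

lemma ip_add_left (C : CartanData r) (β β' γ) : ip C (β + β') γ = ip C β γ + ip C β' γ := by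
  simp [ip, add_mul, Finset.sum_add_distrib]
lemma ip_symm (C : CartanData r) (β γ) : ip C β γ = ip C γ β := by
  rw [ip, Finset.sum_comm]; unfold ip; congr 1; ext i; congr 1; ext j; rw [p_symm]; ring
lemma ip_add_right (C : CartanData r) (β γ γ') : ip C β (γ + γ') = ip C β γ + ip C β γ' := by
  rw [ip_symm, ip_add_left, ip_symm, ip_symm C γ']
lemma ip_neg_left (C : CartanData r) (β γ) : ip C (-β) γ = - ip C β γ := by
  simp [ip]
lemma ip_neg_right (C : CartanData r) (β γ) : ip C β (-γ) = - ip C β γ := by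
  simp [ip]
lemma ip_sub_left (C : CartanData r) (β β' γ) : ip C (β - β') γ = ip C β γ - ip C β' γ := by
  rw [sub_eq_add_neg, ip_add_left, ip_neg_left]; ring
lemma ip_sub_right (C : CartanData r) (β γ γ') : ip C β (γ - γ') = ip C β γ - ip C β γ' := by
  rw [sub_eq_add_neg, ip_add_right, ip_neg_right]; ring
lemma ip_smul_left (C : CartanData r) (n : ℤ) (β γ) : ip C (n • β) γ = n * ip C β γ := by
  simp only [ip, Finset.mul_sum, Pi.smul_apply, smul_eq_mul]; congr 1; ext; congr 1; ext; ring
lemma ip_smul_right (C : CartanData r) (n : ℤ) (β γ) : ip C β (n • γ) = n * ip C β γ := by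
  rw [ip_symm, ip_smul_left, ip_symm]
lemma ip_zero_left (C : CartanData r) (γ) : ip C 0 γ = 0 := by simp [ip]

lemma ip_wt (C : CartanData r) (β γ) : ip C β γ = ∑ i, β i * (C.d i * wt C γ i) := by
  simp only [ip, wt, Finset.mul_sum, CartanData.p]; congr 1; ext; congr 1; ext; ring

lemma ip_al_left (C : CartanData r) (i γ) : ip C (al i) γ = C.d i * wt C γ i := by
  rw [ip_wt]; simp [al, Pi.single_apply]
lemma ip_al (C : CartanData r) (i γ) : ip C γ (al i) = C.d i * wt C γ i := by
  rw [ip_symm, ip_al_left]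

lemma ip_pos (C : CartanData r) {β : Fin r → ℤ} (h : β ≠ 0) : 0 < ip C β β := by
  have := C.posdef (fun i => (β i : ℚ)) (by
    intro h'; apply h; ext i; have := congrFun h' i; simpa using this)
  have e : (∑ i, ∑ j, (β i : ℚ) * (β j : ℚ) * ((C.d i * C.a i j : ℤ) : ℚ)) = ((ip C β β : ℤ) : ℚ) := by
    simp [ip, CartanData.p]
  rw [e] at this
  exact_mod_cast this

lemma d_pos (C : CartanData r) (i) : 0 < C.d i := by rcases C.dval i with h | h | h <;> omega

lemma exists_wt_pos (C : CartanData r) {β : Fin r → ℤ} (h : β ≠ 0) (h0 : ∀ i, 0 ≤ β i) :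
    ∃ i, 0 < β i ∧ 0 < wt C β i := by
  by_contra hc
  push Not at hc
  have := ip_pos C h
  rw [ip_wt] at this
  refine absurd this (not_lt.2 (Finset.sum_nonpos fun i _ => ?_))
  rcases (h0 i).eq_or_lt with h1 | h1
  · rw [← h1, zero_mul]
  · have := hc i h1; have := d_pos C i
    exact mul_nonpos_of_nonneg_of_nonpos h1.le (mul_nonpos_of_nonneg_of_nonpos this.le (hc i h1))

def off (γ : Fin r → ℤ) (i : Fin r) : Prop := ∃ j, j ≠ i ∧ γ j ≠ 0

lemma off.add {γ : Fin r → ℤ} {i} (h : off γ i) (n : ℤ) : off (γ + n • al i) i := by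
  obtain ⟨j, h1, h2⟩ := h
  exact ⟨j, h1, by simpa [al, Pi.single_apply, h1] using h2⟩

lemma off.ne {γ : Fin r → ℤ} {i} (h : off γ i) : γ ≠ al i := by
  obtain ⟨j, h1, h2⟩ := h
  rintro rfl; apply h2; simp [al, Pi.single_apply, h1]

lemma off.ne0 {γ : Fin r → ℤ} {i} (h : off γ i) : γ ≠ 0 := by
  obtain ⟨j, h1, h2⟩ := h
  rintro rfl; apply h2; simp

lemma not_off {γ : Fin r → ℤ} {i} (h : ¬ off γ i) : γ = γ i • al i := by
  ext j; by_cases hj : j = i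
  · subst hj; simp [al]
  · have : γ j = 0 := by by_contra h2; exact h ⟨j, hj, h2⟩
    simp [al, Pi.single_apply, hj, this]

namespace CL
variable {C : CartanData r} {L : Type} [LieRing L] [LieAlgebra ℚ L] (Z : CL C L)

def rnb : Word r → L
  | [] => 0
  | [i] => Z.e i
  | i :: j :: w => ⁅Z.e i, rnb (j :: w)⁆

lemma rnb_cons (i : Fin r) {w : Word r} (h : w ≠ []) : Z.rnb (i :: w) = ⁅Z.e i, Z.rnb w⁆ := by
  cases w with
  | nil => exact absurd rfl h
  | cons j w => rfl

def N (β : Fin r → ℤ) : Submodule ℚ L := Submodule.span ℚ {x | ∃ w, dz w = β ∧ Z.rnb w = x}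

lemma rnb_mem (w : Word r) : Z.rnb w ∈ Z.N (dz w) := Submodule.subset_span ⟨w, rfl, rfl⟩

lemma e_mem (i) : Z.e i ∈ Z.N (al i) := by rw [← dz_single]; exact Z.rnb_mem [i]

lemma N_ind {β} {P : L → Prop} (h0 : P 0) (ha : ∀ x y, P x → P y → P (x + y)) (hs : ∀ (c : ℚ) x, P x → P (c • x))
    (hw : ∀ w, w ≠ [] → dz w = β → P (Z.rnb w)) {x} (hx : x ∈ Z.N β) : P x := by
  refine Submodule.span_induction ?_ h0 (fun x y _ _ => ha x y) (fun c x _ => hs c x) hx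
  rintro x ⟨w, hw', rfl⟩
  by_cases h : w = []
  · subst h; exact h0
  · exact hw w h hw'

lemma e_N (i) {β x} (hx : x ∈ Z.N β) : ⁅Z.e i, x⁆ ∈ Z.N (β + al i) := by
  refine Z.N_ind (P := fun x => ⁅Z.e i, x⁆ ∈ Z.N (β + al i)) (by simp) (fun x y hx hy => by rw [lie_add]; exact add_mem hx hy)
    (fun c x hx => by rw [lie_smul]; exact Submodule.smul_mem _ _ hx) ?_ hx
  intro w hw hβ
  rw [← Z.rnb_cons i hw, ← hβ, ← dz_cons]; exact Z.rnb_mem _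

lemma N_lie {β γ x y} (hx : x ∈ Z.N β) (hy : y ∈ Z.N γ) : ⁅x, y⁆ ∈ Z.N (β + γ) := by
  refine Z.N_ind (P := fun x => ⁅x, y⁆ ∈ Z.N (β + γ)) (by simp) (fun x y hx hy => by rw [add_lie]; exact add_mem hx hy)
    (fun c x hx => by rw [smul_lie]; exact Submodule.smul_mem _ _ hx) ?_ hx
  intro w hw hβ
  subst hβ
  clear hx
  induction w generalizing γ y with
  | nil => exact absurd rfl hw
  | cons i w ih =>
    by_cases h : w = []
    · subst h
      rw [dz_single, add_comm]; exact Z.e_N i hy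
    · rw [Z.rnb_cons i h, lie_lie]
      refine sub_mem ?_ ?_
      · rw [dz_cons, add_right_comm]; exact Z.e_N i (ih hy h)
      · rw [dz_cons, add_assoc, add_comm (al i)]; exact ih (Z.e_N i hy) h

lemma h_N (i) {β x} (hx : x ∈ Z.N β) : ⁅Z.h i, x⁆ = ((wt C β i : ℤ) : ℚ) • x := by
  refine Z.N_ind (P := fun x => ⁅Z.h i, x⁆ = ((wt C β i : ℤ) : ℚ) • x) (by simp)
    (fun x y hx hy => by rw [lie_add, hx, hy, smul_add])
    (fun c x hx => by rw [lie_smul, hx, smul_comm]) ?_ hx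
  intro w hw hβ
  subst hβ
  clear hx
  induction w with
  | nil => exact absurd rfl hw
  | cons j w ih =>
    by_cases h : w = []
    · subst h
      rw [dz_single, wt_al]; exact Z.he i j
    · rw [Z.rnb_cons j h, leibniz_lie, Z.he, ih h, smul_lie, lie_smul, ← add_smul, dz_cons, wt_add, wt_al]
      push_cast; rw [add_comm]

lemma fe (i j) : ⁅Z.f i, Z.e j⁆ = if i = j then - Z.h i else 0 := by
  rw [← lie_skew, Z.ef]; by_cases h : i = j
  · subst h; simp
  · simp [h, Ne.symm h]

lemma f_rnb (i) {w : Word r} (hw : w ≠ [i]) : ⁅Z.f i, Z.rnb w⁆ ∈ Z.N (dz w - al i) := by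
  induction w with
  | nil => simp [rnb]
  | cons j w ih =>
    by_cases h : w = []
    · subst h
      have : i ≠ j := by rintro rfl; exact hw rfl
      simp [rnb, Z.fe, this]
    · rw [Z.rnb_cons j h, leibniz_lie, Z.fe]
      refine add_mem ?_ ?_
      · split_ifs with hij
        · subst hij
          rw [neg_lie, Z.h_N i (Z.rnb_mem w), dz_cons, add_sub_cancel_right]
          exact neg_mem (Submodule.smul_mem _ _ (Z.rnb_mem w))
        · simp
      · by_cases h1 : w = [i]
        · subst h1
          rw [dz_cons, dz_single, add_sub_cancel_left]
          simp only [rnb, Z.fe, if_true]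
          rw [lie_neg, lie_skew, Z.he]
          exact Submodule.smul_mem _ _ (Z.e_mem j)
        · have := Z.e_N j (ih h1)
          rwa [sub_add_eq_add_sub, ← dz_cons] at this

lemma f_N (i) {β x} (hβ : β ≠ al i) (hx : x ∈ Z.N β) : ⁅Z.f i, x⁆ ∈ Z.N (β - al i) := by
  refine Z.N_ind (P := fun x => ⁅Z.f i, x⁆ ∈ Z.N (β - al i)) (by simp) (fun x y hx hy => by rw [lie_add]; exact add_mem hx hy)
    (fun c x hx => by rw [lie_smul]; exact Submodule.smul_mem _ _ hx) ?_ hx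
  intro w hw h
  subst h
  apply Z.f_rnb
  rintro rfl
  exact hβ (dz_single i)

/-- roots -/
def Rt (β : Fin r → ℤ) : Prop := ∃ x ∈ Z.N β, x ≠ 0

lemma Rt.word {β} (h : Z.Rt β) : ∃ w, w ≠ [] ∧ dz w = β := by
  obtain ⟨x, hx, h0⟩ := h
  by_contra hc
  push Not at hc
  apply h0
  exact Z.N_ind (P := fun x => x = 0) rfl (by rintro x y rfl rfl; simp) (by rintro c x rfl; simp)
    (fun w h1 h2 => absurd h2 (hc w h1)) hx

lemma Rt.nonneg {β} (h : Z.Rt β) (i) : 0 ≤ β i := by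
  obtain ⟨w, _, rfl⟩ := Rt.word Z h; exact dz_nonneg w i

lemma Rt.ne0 {β} (h : Z.Rt β) : β ≠ 0 := by
  obtain ⟨w, h1, rfl⟩ := Rt.word Z h; rwa [Ne, dz_eq_zero]

lemma Rt_al (i) : Z.Rt (al i) := ⟨_, Z.e_mem i, Z.e0 i⟩

lemma N_al (i) {x} (hx : x ∈ Z.N (al i)) : ∃ c : ℚ, x = c • Z.e i := by
  refine Z.N_ind (P := fun x => ∃ c : ℚ, x = c • Z.e i) ⟨0, by simp⟩ ?_ ?_ ?_ hx
  · rintro _ _ ⟨c, rfl⟩ ⟨d, rfl⟩; exact ⟨c + d, by rw [add_smul]⟩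
  · rintro c _ ⟨d, rfl⟩; exact ⟨c * d, by rw [mul_smul]⟩
  · intro w hw h
    cases w with
    | nil => exact absurd rfl hw
    | cons j w =>
      have h2 : dz w = al i - al j := by rw [← h, dz_cons]; simp
      by_cases hj : j = i
      · subst hj
        rw [sub_self, dz_eq_zero] at h2
        subst h2; exact ⟨1, by simp [rnb]⟩
      · have := dz_nonneg w j
        rw [h2] at this; simp [al, Pi.single_apply, hj] at this

lemma rnb_ii (i) (w : Word r) (hw : ∀ j ∈ w, j = i) (h1 : w.length ≠ 1) : Z.rnb w = 0 := by
  induction w with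
  | nil => rfl
  | cons j w ih =>
    have hw' : w ≠ [] := by rintro rfl; simp at h1
    rw [Z.rnb_cons j hw']
    by_cases h : w.length = 1
    · obtain ⟨k, rfl⟩ := List.length_eq_one_iff.1 h
      have h1 := hw j (by simp); have h2 := hw k (by simp)
      subst h1; rw [h2]; simp [rnb]
    · rw [ih (fun j hj => hw j (List.mem_cons_of_mem _ hj)) h, lie_zero]

lemma Rt.not_off {β i} (h : Z.Rt β) (ho : ¬ off β i) : β = al i := by
  obtain ⟨x, hx, h0⟩ := h
  by_contra hc
  apply h0
  refine Z.N_ind (P := fun x => x = 0) rfl (by rintro x y rfl rfl; simp) (by rintro c x rfl; simp) ?_ hx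
  intro w h1 h2
  have h3 : ∀ j ∈ w, j = i := by
    intro j hj
    by_contra hji
    apply ho
    refine ⟨j, hji, ?_⟩
    rw [← h2]; simp only [dz, ne_eq, Nat.cast_eq_zero, List.count_eq_zero, not_not]; exact hj
  refine Z.rnb_ii i w h3 ?_
  intro h
  obtain ⟨k, rfl⟩ := List.length_eq_one_iff.1 h
  have := h3 k (by simp)
  subst this
  exact hc (h2 ▸ dz_single k)

abbrev E (i : Fin r) : Module.End ℚ L := LieAlgebra.ad ℚ L (Z.e i)
abbrev F (i : Fin r) : Module.End ℚ L := LieAlgebra.ad ℚ L (Z.f i)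
abbrev H (i : Fin r) : Module.End ℚ L := LieAlgebra.ad ℚ L (Z.h i)

lemma nE (i) {β x} (hx : x ∈ Z.N β) : ∃ m, (Z.E i ^ m) x = 0 := by
  have key : ∀ x, (∃ m, (Z.E i ^ m) x = 0) ↔ x ∈ LieSubalgebra.engel ℚ (Z.e i) := by
    intro x; rw [LieSubalgebra.mem_engel_iff]
  rw [key]
  refine Z.N_ind (P := fun x => x ∈ LieSubalgebra.engel ℚ (Z.e i)) (zero_mem _) (fun x y => add_mem)
    (fun c x hx => (LieSubalgebra.engel ℚ (Z.e i)).smul_mem c hx) ?_ hx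
  intro w hw hh
  clear hh hx
  have he : ∀ j, Z.e j ∈ LieSubalgebra.engel ℚ (Z.e i) := by
    intro j
    rw [← key]
    by_cases h : i = j
    · subst h; exact ⟨1, by simp⟩
    · exact Z.serre i j h
  induction w with
  | nil => exact absurd rfl hw
  | cons j w ih =>
    by_cases h : w = []
    · subst h; exact he j
    · rw [Z.rnb_cons j h]; exact LieSubalgebra.lie_mem _ (he j) (ih h)

lemma N_zero_of_neg {β x} {i} (hi : β i < 0) (hx : x ∈ Z.N β) : x = 0 := by
  by_contra h
  have := Rt.nonneg Z ⟨x, hx, h⟩ i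
  omega

lemma F_pow_mem (i) {γ x} (ho : off γ i) (hx : x ∈ Z.N γ) (m : ℕ) : (Z.F i ^ m) x ∈ Z.N (γ - (m : ℤ) • al i) := by
  induction m with
  | zero => simpa using hx
  | succ m ih =>
    rw [pow_succ', Module.End.mul_apply]
    have := Z.f_N i (by have := (ho.add (-m)).ne; rwa [neg_smul, ← sub_eq_add_neg] at this) ih
    rw [LieAlgebra.ad_apply]
    convert this using 2
    push_cast; rw [add_smul, one_smul]; abel

lemma strg0 {γ i} (ho : off γ i) : Strg0 (Z.E i) (Z.F i) (fun n => Z.N (γ + n • al i)) (wt C γ i) where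
  hE n x hx := by
    have := Z.e_N i hx
    rwa [add_assoc, ← one_smul ℤ (al i), smul_smul, mul_one, ← add_smul] at this
  hF n x hx := by
    have := Z.f_N i (ho.add n).ne hx
    rw [LieAlgebra.ad_apply]
    convert this using 2
    rw [sub_smul, one_smul]; abel
  comm n x hx := by
    have h1 := Z.h_N i hx
    rw [wt_add, wt_smul, wt_al, C.diag] at h1
    rw [show wt C γ i + 2 * n = wt C γ i + n * 2 by ring, ← h1, LieAlgebra.ad_apply, LieAlgebra.ad_apply, LieAlgebra.ad_apply, LieAlgebra.ad_apply, ← lie_lie, Z.ef]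
    simp
  nE n x hx := Z.nE i hx
  nF n x hx := by
    have ho' := ho.add n
    refine ⟨((γ + n • al i) i).toNat + 1, ?_⟩
    refine Z.N_zero_of_neg (i := i) ?_ (Z.F_pow_mem i ho' hx _)
    simp [al]

end CL
end

section
set_option linter.all false
/-! ### Part 7 : root combinatorics -/

def ht (β : Fin r → ℤ) : ℤ := ∑ i, β i

lemma ht_add (β γ : Fin r → ℤ) : ht (β + γ) = ht β + ht γ := by simp [ht, Finset.sum_add_distrib]
lemma ht_sub (β γ : Fin r → ℤ) : ht (β - γ) = ht β - ht γ := by simp [ht]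
lemma ht_smul (n : ℤ) (β : Fin r → ℤ) : ht (n • β) = n * ht β := by simp [ht, Finset.mul_sum]
lemma ht_al (i : Fin r) : ht (al i) = 1 := by simp [ht, al]

def sr (C : CartanData r) (i : Fin r) (γ : Fin r → ℤ) : Fin r → ℤ := γ - wt C γ i • al i

lemma sr_add (C : CartanData r) (i : Fin r) (β γ) : sr C i (β + γ) = sr C i β + sr C i γ := by
  simp only [sr, wt_add, add_smul]; abel
lemma sr_smul (C : CartanData r) (i : Fin r) (n : ℤ) (γ) : sr C i (n • γ) = n • sr C i γ := by
  simp only [sr, wt_smul, mul_smul, smul_sub]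
lemma sr_neg (C : CartanData r) (i : Fin r) (γ) : sr C i (-γ) = - sr C i γ := by
  simp only [sr, wt_neg, neg_smul]; abel
lemma sr_sub (C : CartanData r) (i : Fin r) (β γ) : sr C i (β - γ) = sr C i β - sr C i γ := by
  rw [sub_eq_add_neg, sr_add, sr_neg, sub_eq_add_neg]
lemma sr_al (C : CartanData r) (i : Fin r) : sr C i (al i) = - al i := by
  simp only [sr, wt_al, C.diag, two_smul]; abel
lemma wt_sr (C : CartanData r) (i : Fin r) (γ) : wt C (sr C i γ) i = - wt C γ i := by
  simp only [sr, wt_sub, wt_smul, wt_al, C.diag]; ring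
lemma sr_sr (C : CartanData r) (i : Fin r) (γ) : sr C i (sr C i γ) = γ := by
  rw [sr, wt_sr, sr, neg_smul]; abel
lemma ip_sr (C : CartanData r) (i : Fin r) (β γ) : ip C (sr C i β) (sr C i γ) = ip C β γ := by
  simp only [sr, ip_sub_left, ip_sub_right, ip_smul_left, ip_smul_right, ip_al, ip_al_left, wt_sub, wt_smul, wt_al, C.diag]; ring
lemma ht_sr (C : CartanData r) (i : Fin r) (γ) : ht (sr C i γ) = ht γ - wt C γ i := by
  rw [sr, ht_sub, ht_smul, ht_al, mul_one]
lemma off.sr {C : CartanData r} {i : Fin r} {γ} (h : off γ i) : off (sr C i γ) i := by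
  have := h.add (- wt C γ i); rwa [neg_smul, ← sub_eq_add_neg] at this

namespace CL
variable {C : CartanData r} {L : Type} [LieRing L] [LieAlgebra ℚ L] (Z : CL C L)

lemma Rt.ht_pos {β} (h : Z.Rt β) : 0 < ht β := by
  obtain ⟨i, hi⟩ : ∃ i, β i ≠ 0 := by
    by_contra hc; push Not at hc; exact Rt.ne0 Z h (funext hc)
  have h0 := Rt.nonneg Z h
  exact Finset.sum_pos' (fun i _ => h0 i) ⟨i, Finset.mem_univ _, lt_of_le_of_ne (h0 i) (Ne.symm hi)⟩

lemma dim_le {β x y} (hx : x ∈ Z.N β) (hy : y ∈ Z.N β) (h0 : x ≠ 0) : ∃ c : ℚ, y = c • x := by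
  obtain ⟨n, hn⟩ : ∃ n : ℕ, (ht β).toNat = n := ⟨_, rfl⟩
  induction n using Nat.strong_induction_on generalizing β x y with
  | _ n ih =>
    have hR : Z.Rt β := ⟨x, hx, h0⟩
    obtain ⟨i, h1, h2⟩ := exists_wt_pos C (Rt.ne0 Z hR) (Rt.nonneg Z hR)
    by_cases ho : off β i
    · have S := Z.strg0 ho
      have e0 : β + (0 : ℤ) • al i = β := by simp
      have hinj : ∀ z ∈ Z.N β, z ≠ 0 → Z.F i z ≠ 0 := fun z hz h => S.F_inj (n := 0) (by rwa [e0]) h (by simpa using h2)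
      have hF : ∀ z ∈ Z.N β, Z.F i z ∈ Z.N (β - al i) := fun z hz => Z.f_N i ho.ne hz
      obtain ⟨c, hc⟩ := ih _ (by
        rw [← hn, ht_sub, ht_al]; have := Rt.ht_pos Z hR; omega) (hF x hx) (hF y hy) (hinj x hx h0) rfl
      refine ⟨c, ?_⟩
      by_contra hne
      refine hinj (y - c • x) (sub_mem hy (Submodule.smul_mem _ _ hx)) (sub_ne_zero.2 hne) ?_
      rw [map_sub, map_smul, hc, sub_self]
    · have := Rt.not_off Z hR ho
      subst this
      obtain ⟨c, rfl⟩ := Z.N_al i hx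
      obtain ⟨d, rfl⟩ := Z.N_al i hy
      have hc : c ≠ 0 := by rintro rfl; simp at h0
      exact ⟨d / c, by rw [smul_smul, div_mul_cancel₀ _ hc]⟩

lemma strg {γ i} (ho : off γ i) : Strg (Z.E i) (Z.F i) (fun n => Z.N (γ + n • al i)) (wt C γ i) where
  toStrg0 := Z.strg0 ho
  dim n x y hx hy h0 := Z.dim_le hx hy h0

lemma Rt.sr {γ i} (h : Z.Rt γ) (ho : off γ i) : Z.Rt (sr C i γ) := by
  obtain ⟨x, hx, h0⟩ := h
  obtain ⟨y, hy, hy0⟩ := (Z.strg ho).refl (n := 0) (by simpa using hx) h0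
  refine ⟨y, ?_, hy0⟩
  convert hy using 2
  simp [_root_.sr, sub_eq_add_neg]

lemma root_ind {P : (Fin r → ℤ) → Prop} (h1 : ∀ i, P (al i))
    (h2 : ∀ γ i, Z.Rt γ → off γ i → 0 < wt C γ i → Z.Rt (_root_.sr C i γ) → P (_root_.sr C i γ) → P γ) {γ} (h : Z.Rt γ) : P γ := by
  obtain ⟨n, hn⟩ : ∃ n : ℕ, (ht γ).toNat = n := ⟨_, rfl⟩
  induction n using Nat.strong_induction_on generalizing γ with
  | _ n ih =>
    obtain ⟨i, h3, h4⟩ := exists_wt_pos C (Rt.ne0 Z h) (Rt.nonneg Z h)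
    by_cases ho : off γ i
    · refine h2 γ i h ho h4 (Rt.sr Z h ho) (ih _ ?_ (Rt.sr Z h ho) rfl)
      rw [← hn, ht_sr]; have := Rt.ht_pos Z h; omega
    · rw [Rt.not_off Z h ho]; exact h1 i

def RR (β : Fin r → ℤ) : Prop := Z.Rt β ∨ Z.Rt (-β)

lemma RR.sr {β} (h : Z.RR β) (i) : Z.RR (_root_.sr C i β) := by
  have key : ∀ γ, Z.Rt γ → Z.RR (_root_.sr C i γ) := by
    intro γ h
    by_cases ho : off γ i
    · exact Or.inl (Rt.sr Z h ho)
    · rw [Rt.not_off Z h ho, sr_al]; right; rw [neg_neg]; exact Z.Rt_al i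
  rcases h with h | h
  · exact key _ h
  · have := key _ h
    rw [sr_neg] at this
    rcases this with h | h
    · exact Or.inr h
    · rw [neg_neg] at h; exact Or.inl h

lemma Rt.norm {γ} (h : Z.Rt γ) : ip C γ γ = 2 ∨ ip C γ γ = 4 ∨ ip C γ γ = 6 := by
  refine Z.root_ind (P := fun γ => ip C γ γ = 2 ∨ ip C γ γ = 4 ∨ ip C γ γ = 6) ?_ ?_ h
  · intro i
    rw [ip_al, wt_al, C.diag]
    rcases C.dval i with h | h | h <;> rw [h] <;> simp
  · intro γ i _ _ _ _ h
    rwa [ip_sr] at h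

lemma Rt.not_two {γ} (h : Z.Rt γ) : ¬ Z.Rt (2 • γ) := by
  refine Z.root_ind (P := fun γ => ¬ Z.Rt ((2 : ℕ) • γ)) ?_ ?_ h
  · intro i h2
    have : ¬ off ((2 : ℕ) • al i) i := by
      rintro ⟨j, h1, h2⟩; simp [al, Pi.single_apply, h1] at h2
    have := congrFun (Rt.not_off Z h2 this) i
    simp [al] at this
  · intro γ i _ ho _ _ h h2
    apply h
    have h3 := Rt.sr Z (i := i) h2 (by
      obtain ⟨j, h1, h2⟩ := ho; exact ⟨j, h1, by simpa using h2⟩)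
    have := sr_smul C i 2 γ
    rw [← Nat.cast_smul_eq_nsmul ℤ] at h3 ⊢
    push_cast at h3 ⊢
    rwa [this] at h3

lemma Rt.string {γ β} (h : Z.Rt γ) (hβ : Z.RR β) : ∃ m : ℤ, 2 * ip C β γ = m * ip C γ γ ∧ Z.RR (β - m • γ) := by
  refine Z.root_ind (P := fun γ => ∀ β, Z.RR β → ∃ m : ℤ, 2 * ip C β γ = m * ip C γ γ ∧ Z.RR (β - m • γ)) ?_ ?_ h β hβ
  · intro i β hβ
    refine ⟨wt C β i, ?_, RR.sr Z hβ i⟩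
    rw [ip_al, ip_al, wt_al, C.diag]; ring
  · intro γ i _ _ _ _ h β hβ
    obtain ⟨m, h1, h2⟩ := h _ (RR.sr Z hβ i)
    rw [ip_sr, ip_sr] at h1
    refine ⟨m, h1, ?_⟩
    have := RR.sr Z h2 i
    rwa [sr_sub, sr_smul, sr_sr, sr_sr] at this

lemma Rt.diff {β γ} (h1 : Z.Rt β) (h2 : Z.Rt γ) (hp : 0 < ip C β γ) (hne : β ≠ γ) :
    Z.Rt (β - γ) ∨ Z.Rt (γ - β) := by
  obtain ⟨m, e1, r1⟩ := Rt.string Z h2 (Or.inl h1)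
  obtain ⟨n, e2, r2⟩ := Rt.string Z h1 (Or.inl h2)
  have p1 := ip_pos C (Rt.ne0 Z h1)
  have p2 := ip_pos C (Rt.ne0 Z h2)
  have p3 := ip_pos C (sub_ne_zero.2 hne)
  rw [ip_sub_left, ip_sub_right, ip_sub_right] at p3
  rw [ip_symm C γ β] at e2 p3
  by_cases hm : m = 1
  · rw [hm, one_smul] at r1
    rcases r1 with r1 | r1
    · exact Or.inl r1
    · rw [neg_sub] at r1; exact Or.inr r1
  by_cases hn : n = 1
  · rw [hn, one_smul] at r2
    rcases r2 with r1 | r1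
    · exact Or.inr r1
    · rw [neg_sub] at r1; exact Or.inl r1
  exfalso
  have hm' : 2 ≤ m := by
    have : 0 < m := by by_contra h; push Not at h; nlinarith
    omega
  have hn' : 2 ≤ n := by
    have : 0 < n := by by_contra h; push Not at h; nlinarith
    omega
  nlinarith

lemma Rt.wt_bound {β i} (h : Z.Rt β) (ho : off β i) : -3 ≤ wt C β i ∧ wt C β i ≤ 3 := by
  have h1 : (2 : ℤ) • β - wt C β i • al i ≠ 0 := by
    obtain ⟨j, h1, h2⟩ := ho
    intro h
    have := congrFun h j
    simp [al, Pi.single_apply, h1] at this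
    exact h2 this
  have h2 := ip_pos C h1
  simp only [ip_sub_left, ip_sub_right, ip_smul_left, ip_smul_right, ip_al, ip_al_left, wt_sub, wt_smul, wt_al, C.diag] at h2
  have h3 : ip C β β ≤ 6 := by rcases Rt.norm Z h with h | h | h <;> omega
  have h4 := d_pos C i
  set m := wt C β i
  have h5 : C.d i * (m * m) < 12 := by nlinarith
  have h6 : m * m < 12 := by nlinarith [mul_self_nonneg m]
  constructor <;> nlinarith

lemma E_pow_mem (i) {γ x} (hx : x ∈ Z.N γ) (m : ℕ) : (Z.E i ^ m) x ∈ Z.N (γ + (m : ℤ) • al i) := by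
  induction m with
  | zero => simpa using hx
  | succ m ih =>
    rw [pow_succ', Module.End.mul_apply]
    have := Z.e_N i ih
    rw [LieAlgebra.ad_apply]
    convert this using 2
    push_cast; rw [add_smul, one_smul]; abel

lemma E4 {γ i x} (ho : off γ i) (hx : x ∈ Z.N γ) : (Z.E i ^ 4) x = 0 := by
  by_contra h
  have h0 : x ≠ 0 := by rintro rfl; simp at h
  have h1 := Rt.wt_bound Z ⟨x, hx, h0⟩ ho
  have h2 := Rt.wt_bound Z ⟨_, Z.E_pow_mem i hx 4, h⟩ (ho.add _)
  rw [wt_add, wt_smul, wt_al, C.diag] at h2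
  push_cast at h2
  omega

lemma F4 {γ i x} (ho : off γ i) (hx : x ∈ Z.N γ) : (Z.F i ^ 4) x = 0 := by
  by_contra h
  have h0 : x ≠ 0 := by rintro rfl; simp at h
  have h1 := Rt.wt_bound Z ⟨x, hx, h0⟩ ho
  have h2 := Rt.wt_bound Z ⟨_, Z.F_pow_mem i ho hx 4, h⟩ (by
    have := ho.add (-4); rwa [neg_smul, ← sub_eq_add_neg] at this)
  rw [wt_sub, wt_smul, wt_al, C.diag] at h2
  push_cast at h2
  omega

end CL

/-! truncated exponentials -/

def texp {V : Type*} [AddCommGroup V] [Module ℚ V] (D : Module.End ℚ V) : Module.End ℚ V :=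
  1 + D + (1 / 2 : ℚ) • D ^ 2 + (1 / 6 : ℚ) • D ^ 3

lemma texp_apply {V : Type*} [AddCommGroup V] [Module ℚ V] (D : Module.End ℚ V) (x : V) :
    texp D x = x + D x + (1 / 2 : ℚ) • D (D x) + (1 / 6 : ℚ) • D (D (D x)) := rfl

lemma texp_inj {V : Type*} [AddCommGroup V] [Module ℚ V] {D : Module.End ℚ V} {x : V}
    (h4 : (D ^ 4) x = 0) (h : texp D x = 0) : x = 0 := by
  have h4' : D (D (D (D x))) = 0 := h4
  rw [texp_apply] at h
  have h3 : D (D (D x)) = 0 := by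
    have := congrArg (fun z => D (D (D z))) h
    simpa [h4'] using this
  have h2 : D (D x) = 0 := by
    have := congrArg (fun z => D (D z)) h
    simpa [h3] using this
  have h1 : D x = 0 := by
    have := congrArg (fun z => D z) h
    simpa [h3, h2] using this
  simpa [h1] using h

lemma texp_lie {L : Type*} [LieRing L] [LieAlgebra ℚ L] (a x y : L)
    (hx : (LieAlgebra.ad ℚ L a ^ 4) x = 0) (hy : (LieAlgebra.ad ℚ L a ^ 4) y = 0)
    (hxy : (LieAlgebra.ad ℚ L a ^ 4) ⁅x, y⁆ = 0) :
    texp (LieAlgebra.ad ℚ L a) ⁅x, y⁆ = ⁅texp (LieAlgebra.ad ℚ L a) x, texp (LieAlgebra.ad ℚ L a) y⁆ := by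
  set D := LieAlgebra.ad ℚ L a with hD
  have lz : ∀ u v : L, D ⁅u, v⁆ = ⁅D u, v⁆ + ⁅u, D v⁆ := fun u v => by
    simp only [hD, LieAlgebra.ad_apply]; exact leibniz_lie a u v
  have hx' : D (D (D (D x))) = 0 := hx
  have hy' : D (D (D (D y))) = 0 := hy
  have h4 : D (D (D (D ⁅x, y⁆))) = 0 := hxy
  have h5 : D (D (D (D (D ⁅x, y⁆)))) = 0 := by rw [h4, map_zero]
  have h6 : D (D (D (D (D (D ⁅x, y⁆))))) = 0 := by rw [h5, map_zero]
  simp only [lz, map_add, hx', hy', lie_zero, zero_lie, add_zero, zero_add, map_zero] at h4 h5 h6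
  simp only [texp_apply, lz, map_add, lie_add, add_lie, lie_smul, smul_lie, smul_add, smul_smul]
  set p13 := ⁅D x, D (D (D y))⁆
  set p22 := ⁅D (D x), D (D y)⁆
  set p31 := ⁅D (D (D x)), D y⁆
  set p23 := ⁅D (D x), D (D (D y))⁆
  set p32 := ⁅D (D (D x)), D (D y)⁆
  set p33 := ⁅D (D (D x)), D (D (D y))⁆
  have e4 : (1 / 6 : ℚ) • p13 + (1 / 4 : ℚ) • p22 + (1 / 6 : ℚ) • p31 = 0 := by
    have := congrArg (fun z => (1 / 24 : ℚ) • z) h4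
    simp only [smul_zero] at this
    rw [← this]; module
  have e5 : (1 / 12 : ℚ) • p23 + (1 / 12 : ℚ) • p32 = 0 := by
    have := congrArg (fun z => (1 / 120 : ℚ) • z) h5
    simp only [smul_zero] at this
    rw [← this]; module
  have e6 : (1 / 36 : ℚ) • p33 = 0 := by
    have := congrArg (fun z => (1 / 720 : ℚ) • z) h6
    simp only [smul_zero] at this
    rw [← this]; module
  rw [← sub_eq_zero]
  have := congrArg₂ (· + ·) (congrArg₂ (· + ·) e4 e5) e6
  simp only [add_zero] at this
  rw [← neg_eq_zero, ← this]
  module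
end

section
set_option linter.all false
/-! ### Part 8 : brackets of root vectors -/

lemma eig_mem {V : Type*} [AddCommGroup V] [Module ℚ V] (T : Module.End ℚ V) (M : ℤ → Submodule ℚ V)
    (c : ℤ → ℚ) (hc : Function.Injective c) (hM : ∀ n x, x ∈ M n → T x = c n • x) {y : V}
    (hy : y ∈ ⨆ n, M n) {n₀ : ℤ} (hT : T y = c n₀ • y) : y ∈ M n₀ := by
  rw [iSup_split_single M n₀, Submodule.mem_sup] at hy
  obtain ⟨a, ha, b, hb, rfl⟩ := hy
  have h1 : b ∈ T.eigenspace (c n₀) := by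
    rw [Module.End.mem_eigenspace_iff]
    rw [map_add, smul_add, hM _ _ ha] at hT
    exact add_left_cancel hT
  have h2 : b ∈ ⨆ μ, ⨆ (_ : μ ≠ c n₀), T.eigenspace μ := by
    refine (iSup₂_le ?_ : (⨆ n, ⨆ (_ : n ≠ n₀), M n) ≤ _) hb
    intro n hn
    refine le_trans ?_ (le_iSup₂_of_le (c n) (fun h => hn (hc h)) le_rfl)
    intro x hx
    rw [Module.End.mem_eigenspace_iff]; exact hM n x hx
  have h3 := (Module.End.eigenspaces_iSupIndep T) (c n₀)
  have : b = 0 := Submodule.disjoint_def.1 h3 b h1 h2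
  rw [this, add_zero]; exact ha

namespace CL
variable {C : CartanData r} {L : Type} [LieRing L] [LieAlgebra ℚ L] (Z : CL C L)

def S (i : Fin r) : Submodule ℚ L := Submodule.span ℚ {x | ∃ β, off β i ∧ x ∈ Z.N β}

lemma N_S {i β x} (ho : off β i) (hx : x ∈ Z.N β) : x ∈ Z.S i := Submodule.subset_span ⟨β, ho, hx⟩

lemma S_ind {i : Fin r} {P : L → Prop} (h0 : P 0) (ha : ∀ x y, P x → P y → P (x + y)) (hs : ∀ (c : ℚ) x, P x → P (c • x))
    (hw : ∀ β x, off β i → x ∈ Z.N β → P x) {x} (hx : x ∈ Z.S i) : P x := by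
  refine Submodule.span_induction ?_ h0 (fun x y _ _ => ha x y) (fun c x _ => hs c x) hx
  rintro x ⟨w, hw', hx⟩
  exact hw _ _ hw' hx

lemma S_E {i x} (hx : x ∈ Z.S i) : Z.E i x ∈ Z.S i := by
  refine Z.S_ind (i := i) (P := fun x => Z.E i x ∈ Z.S i) (by simp) (fun x y hx hy => by rw [map_add]; exact add_mem hx hy)
    (fun c x hx => by rw [map_smul]; exact Submodule.smul_mem _ _ hx) ?_ hx
  intro β x ho hx
  have := ho.add 1
  rw [one_smul] at this
  exact Z.N_S this (Z.e_N i hx)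

lemma S_F {i x} (hx : x ∈ Z.S i) : Z.F i x ∈ Z.S i := by
  refine Z.S_ind (i := i) (P := fun x => Z.F i x ∈ Z.S i) (by simp) (fun x y hx hy => by rw [map_add]; exact add_mem hx hy)
    (fun c x hx => by rw [map_smul]; exact Submodule.smul_mem _ _ hx) ?_ hx
  intro β x ho hx
  have := ho.add (-1)
  rw [neg_smul, one_smul, ← sub_eq_add_neg] at this
  exact Z.N_S this (Z.f_N i ho.ne hx)

lemma S_H {i x} (hx : x ∈ Z.S i) : Z.H i x ∈ Z.S i := by
  refine Z.S_ind (i := i) (P := fun x => Z.H i x ∈ Z.S i) (by simp) (fun x y hx hy => by rw [map_add]; exact add_mem hx hy)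
    (fun c x hx => by rw [map_smul]; exact Submodule.smul_mem _ _ hx) ?_ hx
  intro β x ho hx
  rw [LieAlgebra.ad_apply, Z.h_N i hx]
  exact Submodule.smul_mem _ _ (Z.N_S ho hx)

lemma S_lie {i x y} (hx : x ∈ Z.S i) (hy : y ∈ Z.S i) : ⁅x, y⁆ ∈ Z.S i := by
  refine Z.S_ind (i := i) (P := fun x => ⁅x, y⁆ ∈ Z.S i) (by simp) (fun x y hx hy => by rw [add_lie]; exact add_mem hx hy)
    (fun c x hx => by rw [smul_lie]; exact Submodule.smul_mem _ _ hx) ?_ hx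
  intro β x ho hx
  refine Z.S_ind (i := i) (P := fun y => ⁅x, y⁆ ∈ Z.S i) (by simp) (fun x y hx hy => by rw [lie_add]; exact add_mem hx hy)
    (fun c x hx => by rw [lie_smul]; exact Submodule.smul_mem _ _ hx) ?_ hy
  intro γ y ho' hy
  by_cases h1 : x = 0
  · subst h1; simp
  by_cases h2 : y = 0
  · subst h2; simp
  refine Z.N_S ?_ (Z.N_lie hx hy)
  obtain ⟨j, h3, h4⟩ := ho
  have h5 := Rt.nonneg Z ⟨x, hx, h1⟩ j
  have h6 := Rt.nonneg Z ⟨y, hy, h2⟩ j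
  refine ⟨j, h3, ?_⟩
  simp only [Pi.add_apply]; omega

lemma S_E4 {i x} (hx : x ∈ Z.S i) : (Z.E i ^ 4) x = 0 := by
  refine Z.S_ind (i := i) (P := fun x => (Z.E i ^ 4) x = 0) (by simp) (fun x y hx hy => by rw [map_add, hx, hy, add_zero])
    (fun c x hx => by rw [map_smul, hx, smul_zero]) ?_ hx
  intro β x ho hx
  exact Z.E4 ho hx

lemma S_F4 {i x} (hx : x ∈ Z.S i) : (Z.F i ^ 4) x = 0 := by
  refine Z.S_ind (i := i) (P := fun x => (Z.F i ^ 4) x = 0) (by simp) (fun x y hx hy => by rw [map_add, hx, hy, add_zero])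
    (fun c x hx => by rw [map_smul, hx, smul_zero]) ?_ hx
  intro β x ho hx
  exact Z.F4 ho hx

abbrev G (i : Fin r) : Module.End ℚ L := LieAlgebra.ad ℚ L (-Z.f i)
lemma G_eq (i) : Z.G i = - Z.F i := by simp [G, F]
lemma S_G {i x} (hx : x ∈ Z.S i) : Z.G i x ∈ Z.S i := by
  rw [G_eq]; exact neg_mem (Z.S_F hx)
lemma S_G4 {i x} (hx : x ∈ Z.S i) : (Z.G i ^ 4) x = 0 := by
  rw [G_eq, Even.neg_pow (by decide)]; exact Z.S_F4 hx

def tau (i : Fin r) : Module.End ℚ L := texp (Z.E i) * texp (Z.G i) * texp (Z.E i)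

lemma texp_mem {V : Type*} [AddCommGroup V] [Module ℚ V] {D : Module.End ℚ V} {S : Submodule ℚ V}
    (h : ∀ x ∈ S, D x ∈ S) {x} (hx : x ∈ S) : texp D x ∈ S := by
  rw [texp_apply]
  exact add_mem (add_mem (add_mem hx (h _ hx)) (S.smul_mem _ (h _ (h _ hx)))) (S.smul_mem _ (h _ (h _ (h _ hx))))

lemma tau_H (i) {x} (hx : x ∈ Z.S i) : Z.H i (Z.tau i x) = - Z.tau i (Z.H i x) := by
  set ES : Module.End ℚ (Z.S i) := (Z.E i).restrict (fun x => Z.S_E)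
  set GS : Module.End ℚ (Z.S i) := (Z.G i).restrict (fun x => Z.S_G)
  set HS : Module.End ℚ (Z.S i) := (Z.H i).restrict (fun x => Z.S_H)
  have cE : ∀ y, ((ES y : Z.S i) : L) = Z.E i y := fun y => rfl
  have cG : ∀ y, ((GS y : Z.S i) : L) = Z.G i y := fun y => rfl
  have cH : ∀ y, ((HS y : Z.S i) : L) = Z.H i y := fun y => rfl
  have E4 : ES ^ 4 = 0 := by
    apply LinearMap.ext; intro y; apply Subtype.ext
    have := Z.S_E4 y.2
    exact this
  have G4 : GS ^ 4 = 0 := by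
    apply LinearMap.ext; intro y; apply Subtype.ext
    have := Z.S_G4 y.2
    exact this
  have hefi : ⁅Z.e i, Z.f i⁆ = Z.h i := by rw [Z.ef]; simp
  have hhe : ⁅Z.h i, Z.e i⁆ = (2 : ℚ) • Z.e i := by rw [Z.he, C.diag]; norm_num
  have hhf : ⁅Z.h i, Z.f i⁆ = -(2 : ℚ) • Z.f i := by rw [Z.hf, C.diag]; norm_num
  have EH : ES * HS = HS * ES + (-2 : ℚ) • ES := by
    apply LinearMap.ext; intro y; apply Subtype.ext
    change ⁅Z.e i, ⁅Z.h i, (y : L)⁆⁆ = ⁅Z.h i, ⁅Z.e i, (y : L)⁆⁆ + (-2 : ℚ) • ⁅Z.e i, (y : L)⁆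
    rw [leibniz_lie (Z.h i), hhe, smul_lie]; module
  have GH : GS * HS = HS * GS + (2 : ℚ) • GS := by
    apply LinearMap.ext; intro y; apply Subtype.ext
    change ⁅-Z.f i, ⁅Z.h i, (y : L)⁆⁆ = ⁅Z.h i, ⁅-Z.f i, (y : L)⁆⁆ + (2 : ℚ) • ⁅-Z.f i, (y : L)⁆
    rw [leibniz_lie (Z.h i), lie_neg, hhf, neg_smul, neg_neg, smul_lie, neg_lie (Z.f i) (y : L)]; module
  have GE : GS * ES = ES * GS + HS := by
    apply LinearMap.ext; intro y; apply Subtype.ext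
    change ⁅-Z.f i, ⁅Z.e i, (y : L)⁆⁆ = ⁅Z.e i, ⁅-Z.f i, (y : L)⁆⁆ + ⁅Z.h i, (y : L)⁆
    rw [leibniz_lie (Z.e i), lie_neg, hefi, neg_lie (Z.h i)]; abel
  have e1 : texp ES * HS = (HS + (-2 : ℚ) • ES) * texp ES := by
    have := exp_conj (X := HS) (Y := (-2 : ℚ) • ES) (Z := 0) E4 EH (by simp) (by simp)
    simpa [texp] using this
  have e2 : texp ES * ES = ES * texp ES := by
    have := exp_conj (X := ES) (Y := 0) (Z := 0) E4 (by simp) (by simp) (by simp)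
    simpa [texp] using this
  have g1 : texp GS * HS = (HS + (2 : ℚ) • GS) * texp GS := by
    have := exp_conj (X := HS) (Y := (2 : ℚ) • GS) (Z := 0) G4 GH (by simp) (by simp)
    simpa [texp] using this
  have g2 : texp GS * ES = (ES + HS + GS) * texp GS := by
    have := exp_conj (X := ES) (Y := HS) (Z := (2 : ℚ) • GS) G4 GE GH (by simp)
    rw [smul_smul, show (1 / 2 : ℚ) * 2 = 1 by norm_num, one_smul] at this
    exact this
  have key : (texp ES * texp GS * texp ES) * HS = (-1 : ℚ) • (HS * (texp ES * texp GS * texp ES)) := by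
    have a1 : texp GS * (HS + (-2 : ℚ) • ES) = (-1 : ℚ) • ((HS + (2 : ℚ) • ES) * texp GS) := by
      rw [mul_add, g1, mul_smul_comm, g2, ← smul_mul_assoc, ← smul_mul_assoc, ← add_mul]; congr 1; module
    have a2 : texp ES * (HS + (2 : ℚ) • ES) = HS * texp ES := by
      rw [mul_add, e1, mul_smul_comm, e2, ← smul_mul_assoc, ← add_mul]; congr 1; module
    rw [mul_assoc, e1, ← mul_assoc, mul_assoc (texp ES), a1, mul_smul_comm, ← mul_assoc, a2, smul_mul_assoc]
    simp only [mul_assoc]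
  have := congrArg (fun T : Module.End ℚ (Z.S i) => ((T ⟨x, hx⟩ : Z.S i) : L)) key
  have this : Z.tau i (Z.H i x) = (-1 : ℚ) • Z.H i (Z.tau i x) := this
  rw [this, neg_smul, one_smul, neg_neg]

lemma tau_lie (i) {x y} (hx : x ∈ Z.S i) (hy : y ∈ Z.S i) : Z.tau i ⁅x, y⁆ = ⁅Z.tau i x, Z.tau i y⁆ := by
  have hE : ∀ x ∈ Z.S i, texp (Z.E i) x ∈ Z.S i := fun x hx => texp_mem (fun x => Z.S_E) hx
  have hG : ∀ x ∈ Z.S i, texp (Z.G i) x ∈ Z.S i := fun x hx => texp_mem (fun x => Z.S_G) hx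
  have lE : ∀ x ∈ Z.S i, ∀ y ∈ Z.S i, texp (Z.E i) ⁅x, y⁆ = ⁅texp (Z.E i) x, texp (Z.E i) y⁆ := fun x hx y hy =>
    texp_lie _ x y (Z.S_E4 hx) (Z.S_E4 hy) (Z.S_E4 (Z.S_lie hx hy))
  have lG : ∀ x ∈ Z.S i, ∀ y ∈ Z.S i, texp (Z.G i) ⁅x, y⁆ = ⁅texp (Z.G i) x, texp (Z.G i) y⁆ := fun x hx y hy =>
    texp_lie _ x y (Z.S_G4 hx) (Z.S_G4 hy) (Z.S_G4 (Z.S_lie hx hy))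
  simp only [tau, Module.End.mul_apply]
  rw [lE x hx y hy, lG _ (hE x hx) _ (hE y hy), lE _ (hG _ (hE x hx)) _ (hG _ (hE y hy))]

lemma tau_inj (i) {x} (hx : x ∈ Z.S i) (h : Z.tau i x = 0) : x = 0 := by
  have hE : ∀ x ∈ Z.S i, texp (Z.E i) x ∈ Z.S i := fun x hx => texp_mem (fun x => Z.S_E) hx
  have hG : ∀ x ∈ Z.S i, texp (Z.G i) x ∈ Z.S i := fun x hx => texp_mem (fun x => Z.S_G) hx
  simp only [tau, Module.End.mul_apply] at h
  have h1 := texp_inj (Z.S_E4 (hG _ (hE x hx))) h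
  have h2 := texp_inj (Z.S_G4 (hE x hx)) h1
  exact texp_inj (Z.S_E4 hx) h2

lemma tau_mem {i γ x} (ho : off γ i) (hx : x ∈ Z.N γ) : Z.tau i x ∈ Z.N (sr C i γ) := by
  have h0 : x ∈ ⨆ n : ℤ, Z.N (γ + n • al i) := by
    refine Submodule.mem_iSup_of_mem 0 ?_
    simpa using hx
  have hS := Z.strg0 ho
  have hE : ∀ y ∈ ⨆ n : ℤ, Z.N (γ + n • al i), Z.E i y ∈ ⨆ n : ℤ, Z.N (γ + n • al i) := by
    intro y hy
    refine Submodule.iSup_induction _ (motive := fun y => Z.E i y ∈ ⨆ n : ℤ, Z.N (γ + n • al i)) hy ?_ (by simp) ?_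
    · intro n y hy; exact Submodule.mem_iSup_of_mem (n + 1) (hS.hE n y hy)
    · intro a b ha hb; rw [map_add]; exact add_mem ha hb
  have hG : ∀ y ∈ ⨆ n : ℤ, Z.N (γ + n • al i), Z.G i y ∈ ⨆ n : ℤ, Z.N (γ + n • al i) := by
    intro y hy
    rw [G_eq]
    refine neg_mem ?_
    refine Submodule.iSup_induction _ (motive := fun y => Z.F i y ∈ ⨆ n : ℤ, Z.N (γ + n • al i)) hy ?_ (by simp) ?_
    · intro n y hy; exact Submodule.mem_iSup_of_mem (n - 1) (hS.hF n y hy)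
    · intro a b ha hb; rw [map_add]; exact add_mem ha hb
  have h1 : Z.tau i x ∈ ⨆ n : ℤ, Z.N (γ + n • al i) := by
    simp only [tau, Module.End.mul_apply]
    exact texp_mem hE (texp_mem hG (texp_mem hE h0))
  have h2 := eig_mem (Z.H i) (fun n : ℤ => Z.N (γ + n • al i)) (fun n => ((wt C γ i + 2 * n : ℤ) : ℚ))
    (by intro a b h; simp only [Int.cast_inj] at h; omega)
    (by
      intro n x hx
      have := Z.h_N i hx
      rw [LieAlgebra.ad_apply, this, wt_add, wt_smul, wt_al, C.diag, mul_comm n]) h1 (n₀ := - wt C γ i) (by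
      rw [Z.tau_H i (Z.N_S ho hx), LieAlgebra.ad_apply, Z.h_N i hx, map_smul, ← neg_smul]
      congr 1; push_cast; ring)
  simpa [sr, sub_eq_add_neg] using h2

theorem lie_ne_zero {β γ x y} (hx : x ∈ Z.N β) (hy : y ∈ Z.N γ) (hx0 : x ≠ 0) (hy0 : y ≠ 0) (h : Z.Rt (β + γ)) :
    ⁅x, y⁆ ≠ 0 := by
  obtain ⟨n, hn⟩ : ∃ n : ℕ, (ht (β + γ)).toNat = n := ⟨_, rfl⟩
  induction n using Nat.strong_induction_on generalizing β γ x y with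
  | _ n ih =>
    obtain ⟨i, h3, h4⟩ := exists_wt_pos C (Rt.ne0 Z h) (Rt.nonneg Z h)
    have hβ : Z.Rt β := ⟨x, hx, hx0⟩
    have hγ : Z.Rt γ := ⟨y, hy, hy0⟩
    have key : ∀ γ x y, x ∈ Z.N (al i) → y ∈ Z.N γ → x ≠ 0 → y ≠ 0 → Z.Rt (al i + γ) → ⁅x, y⁆ ≠ 0 := by
      intro γ x y hx hy hx0 hy0 h
      obtain ⟨c, rfl⟩ := Z.N_al i hx
      have hc : c ≠ 0 := by rintro rfl; simp at hx0
      have ho : off γ i := by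
        by_contra ho
        have := Rt.not_off Z ⟨y, hy, hy0⟩ ho
        subst this
        rw [← two_smul ℕ] at h
        exact Rt.not_two Z (Z.Rt_al i) h
      obtain ⟨z, hz, hz0⟩ := h
      rw [smul_lie]
      refine smul_ne_zero hc ?_
      exact (Z.strg ho).E_inj (n := 0) (y := z) (by simpa using hy) hy0 (by simpa [add_comm] using hz) hz0
    by_cases h1 : off β i
    · by_cases h2 : off γ i
      · intro h0
        have hx' := Z.tau_mem h1 hx
        have hy' := Z.tau_mem h2 hy
        have ho : off (β + γ) i := by
          obtain ⟨j, h5, h6⟩ := h1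
          have := Rt.nonneg Z hβ j; have := Rt.nonneg Z hγ j
          refine ⟨j, h5, ?_⟩; simp only [Pi.add_apply]; omega
        have hr := Rt.sr Z h ho
        have hlt : (ht (sr C i (β + γ))).toNat < n := by
          rw [← hn, ht_sr]; have := Rt.ht_pos Z h; omega
        rw [sr_add] at hr hlt
        refine ih _ hlt hx' hy' ?_ ?_ hr rfl ?_
        · exact fun h => hx0 (Z.tau_inj i (Z.N_S h1 hx) h)
        · exact fun h => hy0 (Z.tau_inj i (Z.N_S h2 hy) h)
        · rw [← Z.tau_lie i (Z.N_S h1 hx) (Z.N_S h2 hy), h0, map_zero]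
      · have := Rt.not_off Z hγ h2
        subst this
        rw [← lie_skew, Ne, neg_eq_zero]
        exact key β y x hy hx hy0 hx0 (by rwa [add_comm])
    · have := Rt.not_off Z hβ h1
      subst this
      exact key γ x y hx hy hx0 hy0 h

end CL
end

section
set_option linter.all false
/-! ### Part 9 : specialization at q = 1 -/

/-- `x` is regular at `q = 1` with value `c` -/
def Sp (x : K) (c : ℚ) : Prop :=
  ∃ P Q : Polynomial ℚ, Q.eval 1 ≠ 0 ∧ x * algebraMap (Polynomial ℚ) K Q = algebraMap (Polynomial ℚ) K P
    ∧ P.eval 1 = c * Q.eval 1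

lemma Sp.add {x y : K} {c d : ℚ} (h : Sp x c) (h' : Sp y d) : Sp (x + y) (c + d) := by
  obtain ⟨P, Q, h1, h2, h3⟩ := h
  obtain ⟨P', Q', h1', h2', h3'⟩ := h'
  refine ⟨P * Q' + P' * Q, Q * Q', by simp [h1, h1'], ?_, by simp [h3, h3']; ring⟩
  rw [map_add, map_mul, map_mul, map_mul, ← h2, ← h2']; ring

lemma Sp.mul {x y : K} {c d : ℚ} (h : Sp x c) (h' : Sp y d) : Sp (x * y) (c * d) := by
  obtain ⟨P, Q, h1, h2, h3⟩ := h
  obtain ⟨P', Q', h1', h2', h3'⟩ := h'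
  refine ⟨P * P', Q * Q', by simp [h1, h1'], ?_, by simp [h3, h3']; ring⟩
  rw [map_mul, map_mul, ← h2, ← h2']; ring

lemma Sp.const (c : ℚ) : Sp (RatFunc.C c) c :=
  ⟨Polynomial.C c, 1, by simp, by rw [map_one, mul_one, RatFunc.algebraMap_C], by simp⟩

lemma Sp.zero : Sp 0 0 := ⟨0, 1, by simp, by simp, by simp⟩
lemma Sp.one : Sp 1 1 := ⟨1, 1, by simp, by simp, by simp⟩
lemma Sp.neg {x : K} {c : ℚ} (h : Sp x c) : Sp (-x) (-c) := by
  obtain ⟨P, Q, h1, h2, h3⟩ := h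
  exact ⟨-P, Q, h1, by rw [map_neg, ← h2]; ring, by simp [h3]⟩
lemma Sp.sub {x y : K} {c d : ℚ} (h : Sp x c) (h' : Sp y d) : Sp (x - y) (c - d) := by
  rw [sub_eq_add_neg, sub_eq_add_neg]; exact h.add h'.neg
lemma Sp.inv {x : K} {c : ℚ} (h : Sp x c) (hc : c ≠ 0) : Sp x⁻¹ c⁻¹ := by
  obtain ⟨P, Q, h1, h2, h3⟩ := h
  have hP : P.eval 1 ≠ 0 := by rw [h3]; exact mul_ne_zero hc h1
  have hx : x ≠ 0 := by
    rintro rfl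
    rw [zero_mul] at h2
    have : P = 0 := by
      apply RatFunc.algebraMap_injective (K := ℚ); rw [← h2, map_zero]
    simp [this] at hP
  refine ⟨Q, P, hP, ?_, ?_⟩
  · rw [← h2]; field_simp
  · rw [h3]; field_simp
lemma Sp.unique {x : K} {c d : ℚ} (h : Sp x c) (h' : Sp x d) : c = d := by
  obtain ⟨P, Q, h1, h2, h3⟩ := h
  obtain ⟨P', Q', h1', h2', h3'⟩ := h'
  have : P * Q' = P' * Q := by
    apply RatFunc.algebraMap_injective (K := ℚ)
    rw [map_mul, map_mul, ← h2, ← h2']; ring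
  have := congrArg (Polynomial.eval 1) this
  simp only [Polynomial.eval_mul, h3, h3'] at this
  have h4 : (c - d) * (Q.eval 1 * Q'.eval 1) = 0 := by linear_combination this
  rcases mul_eq_zero.1 h4 with h | h
  · linarith
  · exact absurd h (mul_ne_zero h1 h1')
lemma Sp.qq : Sp qq 1 := by
  refine ⟨Polynomial.X, 1, by simp, ?_, by simp⟩
  simp [RatFunc.algebraMap_X]
lemma Sp.qpow (n : ℤ) : Sp (_root_.qq ^ n) 1 := by
  have hn : ∀ m : ℕ, Sp (_root_.qq ^ m) 1 := by
    intro m; induction m with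
    | zero => simpa using Sp.one
    | succ m ih => rw [pow_succ]; simpa using ih.mul Sp.qq
  cases n with
  | ofNat m => simpa using hn m
  | negSucc m => rw [zpow_negSucc]; simpa using (hn (m+1)).inv one_ne_zero
lemma Sp.sum {ι : Type*} (s : Finset ι) {x : ι → K} {c : ι → ℚ} (h : ∀ i ∈ s, Sp (x i) (c i)) :
    Sp (∑ i ∈ s, x i) (∑ i ∈ s, c i) := by
  classical
  induction s using Finset.induction_on with
  | empty => simpa using Sp.zero
  | insert a s ha ih =>
    rw [Finset.sum_insert ha, Finset.sum_insert ha]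
    exact (h a (Finset.mem_insert_self _ _)).add (ih fun i hi => h i (Finset.mem_insert_of_mem hi))

lemma Sp.dich (x : K) : (∃ c, Sp x c) ∨ (∃ c, Sp x⁻¹ c) := by
  by_cases h : x.denom.eval 1 = 0
  · right
    have hc := RatFunc.isCoprime_num_denom x
    have hn : x.num.eval 1 ≠ 0 := by
      intro h'
      obtain ⟨a, b, hab⟩ := hc
      have := congrArg (Polynomial.eval 1) hab
      simp [h, h'] at this
    refine ⟨0, x.denom, x.num, hn, ?_, by simp [h]⟩
    have hx : x ≠ 0 := by rintro rfl; simp at hn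
    have hd : algebraMap (Polynomial ℚ) K x.denom ≠ 0 := by
      simpa using RatFunc.denom_ne_zero x
    have := RatFunc.num_div_denom x
    rw [div_eq_iff hd] at this
    rw [this]; field_simp
  · left
    have hd : algebraMap (Polynomial ℚ) K x.denom ≠ 0 := by
      simpa using RatFunc.denom_ne_zero x
    have := RatFunc.num_div_denom x
    rw [div_eq_iff hd] at this
    exact ⟨x.num.eval 1 / x.denom.eval 1, x.num, x.denom, h, this.symm, by field_simp⟩

lemma Sp.scale {ι : Type*} (s : Finset ι) (x : ι → K) (h : ∃ i ∈ s, x i ≠ 0) :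
    ∃ i ∈ s, x i ≠ 0 ∧ ∀ j ∈ s, ∃ c, Sp (x j / x i) c := by
  classical
  induction s using Finset.induction_on with
  | empty => simp at h
  | insert a s ha ih =>
    by_cases hs : ∃ i ∈ s, x i ≠ 0
    · obtain ⟨i, hi, h1, h2⟩ := ih hs
      by_cases hxa : x a = 0
      · refine ⟨i, Finset.mem_insert_of_mem hi, h1, fun j hj => ?_⟩
        rcases Finset.mem_insert.1 hj with rfl | hj
        · exact ⟨0, by rw [hxa, zero_div]; exact Sp.zero⟩
        · exact h2 j hj
      rcases Sp.dich (x a / x i) with hc | ⟨c, hc⟩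
      · refine ⟨i, Finset.mem_insert_of_mem hi, h1, fun j hj => ?_⟩
        rcases Finset.mem_insert.1 hj with rfl | hj
        · exact hc
        · exact h2 j hj
      · refine ⟨a, Finset.mem_insert_self _ _, hxa, fun j hj => ?_⟩
        rcases Finset.mem_insert.1 hj with rfl | hj
        · exact ⟨1, by rw [div_self hxa]; exact Sp.one⟩
        · obtain ⟨c', hc'⟩ := h2 j hj
          refine ⟨c' * c, ?_⟩
          have := hc'.mul hc
          rw [inv_div, div_mul_div_cancel₀ h1] at this
          exact this
    · push Not at hs
      obtain ⟨i, hi, h1⟩ := h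
      rcases Finset.mem_insert.1 hi with rfl | hi
      · refine ⟨i, Finset.mem_insert_self _ _, h1, fun j hj => ?_⟩
        rcases Finset.mem_insert.1 hj with rfl | hj
        · exact ⟨1, by rw [div_self h1]; exact Sp.one⟩
        · exact ⟨0, by rw [hs j hj, zero_div]; exact Sp.zero⟩
      · exact absurd (hs i hi) h1

/-- reduction of functions -/
def Red (u : Fn r K) (v : Fn r ℚ) : Prop := ∀ w, Sp (u w) (v w)

lemma Red.unique {u : Fn r K} {v v'} (h : Red u v) (h' : Red u v') : v = v' :=
  funext fun w => (h w).unique (h' w)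
lemma Red.zero : Red (0 : Fn r K) 0 := fun _ => Sp.zero
lemma Red.add {u u' : Fn r K} {v v'} (h : Red u v) (h' : Red u' v') : Red (u + u') (v + v') :=
  fun w => (h w).add (h' w)
lemma Red.sub {u u' : Fn r K} {v v'} (h : Red u v) (h' : Red u' v') : Red (u - u') (v - v') :=
  fun w => (h w).sub (h' w)
lemma Red.smul {u : Fn r K} {v} {x c} (hx : Sp x c) (h : Red u v) : Red (x • u) (c • v) :=
  fun w => hx.mul (h w)
lemma Red.de (w : Word r) : Red (_root_.de w) (_root_.de w) := by
  intro x; simp only [de_apply]; split_ifs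
  · exact Sp.one
  · exact Sp.zero
lemma Red.Dl {u : Fn r K} {v} (d) (h : Red u v) : Red (_root_.Dl d u) (_root_.Dl d v) := fun w => h _
lemma Red.Dr {u : Fn r K} {v} (d) (h : Red u v) : Red (_root_.Dr d u) (_root_.Dr d v) := fun w => h _
lemma Red.Dlw {u : Fn r K} {v} (d) (h : Red u v) : Red (_root_.Dlw d u) (_root_.Dlw d v) := fun w => h _
lemma Red.Drw {u : Fn r K} {v} (d) (h : Red u v) : Red (_root_.Drw d u) (_root_.Drw d v) := fun w => h _
lemma Red.comp {u : Fn r K} {v} (ν) (h : Red u v) : Red (_root_.comp ν u) (_root_.comp ν v) := by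
  intro w; simp only [comp_apply]; split_ifs
  · exact h w
  · exact Sp.zero
lemma Sp.chi {s : Fin r → K} {s1 : Fin r → ℚ} (h : ∀ i, Sp (s i) (s1 i)) (w) :
    Sp (_root_.chi s w) (_root_.chi s1 w) := by
  induction w with
  | nil => simpa using Sp.one
  | cons d w ih => simpa using (h d).mul ih
lemma Red.mulc {u : Fn r K} {v} {s : Fin r → K} {s1 : Fin r → ℚ} (hs : ∀ i, Sp (s i) (s1 i))
    (h : Red u v) : Red (_root_.mulc s u) (_root_.mulc s1 v) := fun w => (Sp.chi hs w).mul (h w)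
lemma Red.sh {t : Fin r → Fin r → K} {t' : Fin r → Fin r → ℚ} (ht : ∀ i j, Sp (t i j) (t' i j))
    {u u' : Fn r K} {v v'} (h : Red u v) (h' : Red u' v') :
    Red (_root_.sh t u u') (_root_.sh t' v v') := by
  intro w
  induction w generalizing u u' v v' with
  | nil => exact (h []).mul (h' [])
  | cons d w ih =>
    rw [sh_cons, sh_cons]
    exact (ih (h.Dl d) (h'.mulc (ht d))).add (ih h (h'.Dl d))

def RedF (f : Fr r K) (f' : Fr r ℚ) : Prop := Red ⇑f ⇑f'
lemma RedF.sub {u u' : Fr r K} {v v'} (h : RedF u v) (h' : RedF u' v') : RedF (u - u') (v - v') :=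
  fun w => (h w).sub (h' w)
lemma RedF.smul {u : Fr r K} {v} {x c} (hx : Sp x c) (h : RedF u v) : RedF (x • u) (c • v) :=
  fun w => hx.mul (h w)
lemma RedF.single (w : Word r) : RedF (Finsupp.single w 1) (Finsupp.single w 1) := by
  intro x; simp only [Finsupp.single_apply]; split_ifs
  · exact Sp.one
  · exact Sp.zero
lemma RedF.lift (f' : Fr r ℚ) : RedF (Finsupp.mapRange (RatFunc.C : ℚ →+* K) (map_zero _) f') f' := by
  intro w; rw [Finsupp.mapRange_apply]; exact Sp.const _
lemma RedF.cm {f g : Fr r K} {f' g'} (h : RedF f f') (h' : RedF g g') : RedF (cm f g) (cm f' g') := by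
  intro w
  have key : ∀ {k : Type} [CommRing k] (f g : Fr r k) (s s' : Finset (Word r)), f.support ⊆ s → g.support ⊆ s' →
      _root_.cm f g w = ∑ x ∈ s, ∑ y ∈ s', (Finsupp.single (x ++ y) (1:k)) w * (f x * g y) := by
    intro k _ f g s s' hs hs'
    rw [cm_apply, Finsupp.sum_of_support_subset f hs _ (by simp), Finsupp.finset_sum_apply]
    refine Finset.sum_congr rfl fun x _ => ?_
    rw [Finsupp.sum_of_support_subset g hs' _ (by simp), Finsupp.finset_sum_apply]
    refine Finset.sum_congr rfl fun y _ => ?_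
    simp only [Finsupp.single_apply]; split_ifs <;> simp
  rw [key f g (f.support ∪ f'.support) (g.support ∪ g'.support) Finset.subset_union_left Finset.subset_union_left,
    key f' g' (f.support ∪ f'.support) (g.support ∪ g'.support) Finset.subset_union_right Finset.subset_union_right]
  exact Sp.sum _ fun i _ => Sp.sum _ fun j _ => (RedF.single (i ++ j) w).mul ((h _).mul (h' _))
lemma RedF.pr {f : Fr r K} {f'} {u : Fn r K} {v} (h : RedF f f') (hu : Red u v) :
    Sp (pr f u) (pr f' v) := by
  rw [pr_def, pr_def, Finsupp.sum_of_support_subset f (s := f.support ∪ f'.support) Finset.subset_union_left _ (by simp),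
    Finsupp.sum_of_support_subset f' (s := f.support ∪ f'.support) Finset.subset_union_right _ (by simp)]
  exact Sp.sum _ fun i _ => (h _).mul (hu _)
lemma RedF.Lop {f : Fr r K} {f'} {u : Fn r K} {v} (h : RedF f f') (hu : Red u v) :
    Red (Lop f u) (Lop f' v) := by
  intro y; rw [Lop_apply, Lop_apply]; exact h.pr fun x => hu _

lemma Red.brk {c : Word r → Word r → K} (hc : ∀ w x, Sp (c w x) 1) {l : Word r} (hl : IsLyndon l) :
    RedF (brk c l) (brk c1 l) := by
  revert l
  apply lyndon_rec
  · intro i; rw [brk_letter, brk_letter]; exact RedF.single _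
  · intro l1 l2 _ _ _ _ he h1 h2
    rw [he, he]
    exact (h1.cm h2).sub (RedF.smul (hc _ _) (h2.cm h1))

lemma Red.cpr {c : Word r → Word r → K} (hc : ∀ w x, Sp (c w x) 1) {ls : List (Word r)}
    (hl : ∀ l ∈ ls, IsLyndon l) : RedF (cpr c ls) (cpr c1 ls) := by
  induction ls with
  | nil => exact RedF.single _
  | cons l ls ih =>
    rw [cpr_cons, cpr_cons]
    exact (Red.brk hc (hl l (by simp))).cm (ih fun x hx => hl x (by simp [hx]))

lemma cq_sp (p : Fin r → Fin r → ℤ) (w x : Word r) : Sp (cq p w x) 1 := Sp.qpow _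
lemma tq_sp (p : Fin r → Fin r → ℤ) (i j : Fin r) : Sp (tq p i j) (t1 i j) := Sp.qpow _

/-- scaling of a nonzero homogeneous function -/
lemma Red.scale {u : Fn r K} {ν} (hu : HomF u ν) (h0 : u ≠ 0) :
    ∃ (s : K) (v : Fn r ℚ), s ≠ 0 ∧ Red (s • u) v ∧ v ≠ 0 := by
  obtain ⟨w0, hw0⟩ := Function.ne_iff.1 h0
  have hw0 : u w0 ≠ 0 := hw0
  obtain ⟨i, hi, h1, h2⟩ := Sp.scale (finite_deg ν).toFinset u ⟨w0, by simpa using hu w0 hw0, hw0⟩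
  have h3 : ∀ w, ∃ c, Sp (u w / u i) c := by
    intro w
    by_cases hw : u w = 0
    · exact ⟨0, by rw [hw, zero_div]; exact Sp.zero⟩
    · exact h2 w (by simpa using hu w hw)
  choose v hv using h3
  refine ⟨(u i)⁻¹, v, inv_ne_zero h1, fun w => ?_, ?_⟩
  · rw [Pi.smul_apply, smul_eq_mul, mul_comm, ← div_eq_mul_inv]; exact hv w
  · intro h
    have h4 := hv i
    rw [div_self h1] at h4
    have := h4.unique Sp.one
    rw [h] at this; simp at this

/-! insertion operators -/
section PPsec
variable {k : Type*} [CommRing k]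
def ppW (i : Fin r) (b : Word r → k) : Word r → Fn r k → k
  | [], _ => 0
  | d :: w, u => ppW i b w (Dl d u) + if d = i then b w * u w else 0

lemma ppW_add (i : Fin r) (b : Word r → k) (w : Word r) (u v : Fn r k) :
    ppW i b w (u + v) = ppW i b w u + ppW i b w v := by
  induction w generalizing u v with
  | nil => simp [ppW]
  | cons d w ih => simp only [ppW, map_add, ih, Pi.add_apply]; split_ifs <;> ring
lemma ppW_smul (i : Fin r) (b : Word r → k) (w : Word r) (c : k) (u : Fn r k) :
    ppW i b w (c • u) = c * ppW i b w u := by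
  induction w generalizing u with
  | nil => simp [ppW]
  | cons d w ih => simp only [ppW, map_smul, ih, Pi.smul_apply, smul_eq_mul]; split_ifs <;> ring

def PP (i : Fin r) (b : Word r → k) : Fn r k →ₗ[k] Fn r k where
  toFun u := fun w => ppW i b w u
  map_add' u v := funext fun w => ppW_add i b w u v
  map_smul' c u := funext fun w => ppW_smul i b w c u

lemma PP_nil (i : Fin r) (b : Word r → k) (u) : PP i b u [] = 0 := rfl
lemma PP_cons (i : Fin r) (b : Word r → k) (u : Fn r k) (d w) :
    PP i b u (d :: w) = PP i b (Dl d u) w + if d = i then b w * u w else 0 := rfl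
lemma Dl_PP (i : Fin r) (b : Word r → k) (u : Fn r k) (d) :
    Dl d (PP i b u) = PP i b (Dl d u) + if d = i then b * u else 0 := by
  funext w; rw [Dl_apply, PP_cons, Pi.add_apply]; split_ifs <;> rfl

lemma PP_de_nil (i : Fin r) (b : Word r → k) (hb : b [] = 0) : PP i b (de []) = 0 := by
  apply fn_ext
  · rfl
  · intro d w; rw [PP_cons, Dl_de_nil, map_zero]
    by_cases hw : w = []
    · simp [hw, hb]
    · simp [de_apply, hw]

lemma PP_de (i j : Fin r) (hij : i ≠ j) (b : Word r → k) (hb : b [] = 0) (n : ℕ) :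
    PP i b (de (List.replicate n i ++ [j])) =
      (∑ m ∈ Finset.range (n+1), b (List.replicate m i ++ [j])) • de (List.replicate (n+1) i ++ [j]) := by
  induction n with
  | zero =>
    apply fn_ext
    · simp [PP_nil, de_apply]
    · intro d w
      simp only [List.replicate_zero, List.nil_append, PP_cons, Dl_de_cons]
      by_cases hd : d = j
      · rw [if_pos hd, PP_de_nil i b hb, if_neg (by rw [hd]; exact Ne.symm hij)]
        have : d ≠ i := by rw [hd]; exact Ne.symm hij
        simp [de_apply, this]
      · by_cases hd' : d = i
        · subst hd'
          by_cases hw : w = [j]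
          · simp [de_apply, hd, hw]
          · simp [de_apply, hd, hw]
        · simp [de_apply, hd, hd']
  | succ n ih =>
    apply fn_ext
    · simp [PP_nil, de_apply]
    · intro d w
      rw [PP_cons, List.replicate_succ, List.cons_append, Dl_de_cons, Finset.sum_range_succ]
      by_cases hd : d = i
      · subst hd
        rw [if_pos rfl, if_pos rfl, ih]
        by_cases hw : w = List.replicate (n+1) d ++ [j]
        · subst hw
          simp [de_apply, List.replicate_succ]
        · have : d :: w ≠ List.replicate (n+1+1) d ++ [j] := by
            rw [List.replicate_succ, List.cons_append]; simpa using hw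
          rw [Pi.smul_apply, Pi.smul_apply, de_apply, de_apply, de_apply, if_neg hw, if_neg this, if_neg]
          · simp
          · rw [← List.cons_append, ← List.replicate_succ]; exact hw
      · simp [de_apply, List.replicate_succ, hd]
end PPsec
end

section
set_option linter.all false
/-! ### Part 10 : the classical limit and its Lie algebra -/

abbrev qd : K := qq - qq⁻¹

lemma qd_ne : qd ≠ 0 := by
  intro h
  have h1 : (qq : K) * qq = 1 := by
    have h2 : (qq:K) = qq⁻¹ := sub_eq_zero.1 h
    nth_rewrite 2 [h2]
    exact mul_inv_cancel₀ qq_ne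
  have h2 : (algebraMap (Polynomial ℚ) K) (Polynomial.X * Polynomial.X) = algebraMap (Polynomial ℚ) K 1 := by
    rw [map_mul, RatFunc.algebraMap_X, map_one]; exact h1
  have h3 := RatFunc.algebraMap_injective (K := ℚ) h2
  have := congrArg (Polynomial.eval 0) h3
  simp at this

def qint (n : ℤ) : K := (qq ^ n - qq ^ (-n)) / qd

lemma qint_neg (n : ℤ) : qint (-n) = - qint n := by
  rw [qint, qint, neg_neg, ← neg_div, neg_sub]
lemma qint_zero : qint 0 = 0 := by simp [qint]
lemma qint_succ (n : ℤ) : qint (n + 1) = qq * qint n + qq ^ (-n) := by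
  rw [qint, qint, ← mul_div_assoc, ← sub_eq_iff_eq_add', ← sub_div, div_eq_iff qd_ne, neg_add, zpow_add₀ qq_ne, zpow_add₀ qq_ne,
    zpow_one, zpow_neg_one]
  ring
lemma qint_sp (n : ℤ) : Sp (qint n) n := by
  have h : ∀ m : ℕ, Sp (qint m) ((m : ℤ) : ℚ) := by
    intro m; induction m with
    | zero => simpa [qint_zero] using Sp.zero
    | succ m ih =>
      push_cast at ih ⊢
      rw [qint_succ]
      simpa using (Sp.qq.mul ih).add (Sp.qpow (-(m:ℤ)))
  rcases Int.eq_nat_or_neg n with ⟨m, rfl | rfl⟩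
  · exact h m
  · rw [qint_neg]; simpa using (h m).neg

section
variable (C : CartanData r)

def kap (i j : Fin r) : K := qq ^ (C.p i j)

lemma chi_kap (i : Fin r) (w : Word r) : chi (kap C i) w = qq ^ (ip C (al i) (dz w)) := by
  induction w with
  | nil => rw [dz_nil, ip_symm, ip_zero_left]; simp
  | cons d w ih =>
    rw [chi_cons, ih, dz_cons, ip_add_right, kap, ← zpow_add₀ qq_ne]
    congr 1
    rw [ip_al_left C i (al d), wt_al, add_comm]; rfl

lemma chi_tq' (i : Fin r) (w : Word r) : chi (tq C.p i) w = qq ^ (-ip C (al i) (dz w)) := by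
  induction w with
  | nil => rw [dz_nil, ip_symm, ip_zero_left]; simp
  | cons d w ih =>
    rw [chi_cons, ih, dz_cons, ip_add_right, tq, ← zpow_add₀ qq_ne]
    congr 1
    rw [ip_al_left C i (al d), wt_al, neg_add_rev]; rfl

def bq (i : Fin r) (w : Word r) : K := qint (ip C (al i) (dz w))
def b1 (i : Fin r) (w : Word r) : ℚ := ((ip C (al i) (dz w) : ℤ) : ℚ)

lemma bq_sp (i : Fin r) (w) : Sp (bq C i w) (b1 C i w) := qint_sp _

lemma PP_sh (i : Fin r) (v : Fn r K) :
    sh (tq C.p) (de [i]) v - sh (tq C.p) (mulc (kap C i) v) (de [i]) = (-qd) • PP i (bq C i) v := by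
  funext w
  induction w generalizing v with
  | nil => simp [sh_nil, de_apply, PP_nil]
  | cons d w ih =>
    have ih := ih (Dl d v)
    rw [Pi.sub_apply, Pi.smul_apply, smul_eq_mul] at ih ⊢
    rw [sh_cons, sh_cons, PP_cons, Dl_mulc, mulc_de, Dl_de_cons]
    have h1 : kap C i d * chi (tq C.p d) [i] = 1 := by
      rw [chi_cons, chi_nil, mul_one, kap, tq, ← zpow_add₀ qq_ne, p_symm C d i]; simp
    simp only [map_smul, LinearMap.smul_apply, Pi.smul_apply, smul_eq_mul]
    have h2 : chi (tq C.p d) [i] * (kap C i d * sh (tq C.p) (mulc (kap C i) (Dl d v)) (de [i]) w)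
      = sh (tq C.p) (mulc (kap C i) (Dl d v)) (de [i]) w := by
      rw [← mul_assoc, mul_comm (chi _ _), h1, one_mul]
    by_cases hd : d = i
    · subst hd
      rw [if_pos rfl, if_pos rfl, sh_one_left, sh_one_right, h2, mulc_apply, mulc_apply, chi_kap, chi_tq']
      have h3 : qd * bq C d w = qq ^ (ip C (al d) (dz w)) - qq ^ (-ip C (al d) (dz w)) := by
        rw [bq, qint, mul_div_cancel₀ _ qd_ne]
      linear_combination ih + (v w) * h3
    · rw [if_neg hd, if_neg hd]
      simp only [map_zero, LinearMap.zero_apply, Pi.zero_apply]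
      rw [h2]
      linear_combination ih

lemma UU_PP (i : Fin r) {u : Fn r K} (hu : u ∈ UU (tq C.p)) : PP i (bq C i) u ∈ UU (tq C.p) := by
  have h : (-qd) • PP i (bq C i) u ∈ UU (tq C.p) := by
    rw [← PP_sh]
    exact sub_mem (UU_sh _ (UU_letter _ i) hu) (UU_sh _ (UU_mulc _ _ hu) (UU_letter _ i))
  have := Submodule.smul_mem _ (-qd)⁻¹ h
  rwa [smul_smul, inv_mul_cancel₀ (neg_ne_zero.2 qd_ne), one_smul] at this

lemma Red.PP (i : Fin r) {b : Word r → K} {b' : Word r → ℚ} (hb : ∀ w, Sp (b w) (b' w)) {u : Fn r K} {v}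
    (h : Red u v) : Red (_root_.PP i b u) (_root_.PP i b' v) := by
  intro w
  induction w generalizing u v with
  | nil => exact Sp.zero
  | cons d w ih =>
    rw [PP_cons, PP_cons]
    refine (ih (h.Dl d)).add ?_
    split_ifs
    · exact (hb w).mul (h w)
    · exact Sp.zero

/-- classical limit of `UU` -/
def U1 : Submodule ℚ (Fn r ℚ) where
  carrier := {v | ∃ u ∈ UU (tq C.p), Red u v}
  add_mem' := by
    rintro v v' ⟨u, hu, h⟩ ⟨u', hu', h'⟩
    exact ⟨u + u', add_mem hu hu', h.add h'⟩
  zero_mem' := ⟨0, zero_mem _, Red.zero⟩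
  smul_mem' := by
    rintro c v ⟨u, hu, h⟩
    exact ⟨RatFunc.C c • u, Submodule.smul_mem _ _ hu, Red.smul (Sp.const c) h⟩

variable {C}
lemma U1_Dl (d) {v : Fn r ℚ} (h : v ∈ U1 C) : Dl d v ∈ U1 C := by
  obtain ⟨u, hu, h⟩ := h; exact ⟨_, UU_Dl _ d hu, h.Dl d⟩
lemma U1_Dr (d) {v : Fn r ℚ} (h : v ∈ U1 C) : Dr d v ∈ U1 C := by
  obtain ⟨u, hu, h⟩ := h; exact ⟨_, UU_Dr _ d hu, h.Dr d⟩
lemma U1_Drw (d) {v : Fn r ℚ} (h : v ∈ U1 C) : Drw d v ∈ U1 C := by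
  obtain ⟨u, hu, h⟩ := h; exact ⟨_, UU_Drw _ d hu, h.Drw d⟩
lemma U1_Dlw (d) {v : Fn r ℚ} (h : v ∈ U1 C) : Dlw d v ∈ U1 C := by
  obtain ⟨u, hu, h⟩ := h; exact ⟨_, UU_Dlw _ d hu, h.Dlw d⟩
lemma U1_comp (d) {v : Fn r ℚ} (h : v ∈ U1 C) : comp d v ∈ U1 C := by
  obtain ⟨u, hu, h⟩ := h; exact ⟨_, UU_comp _ d hu, h.comp d⟩
lemma U1_PP (i) {v : Fn r ℚ} (h : v ∈ U1 C) : PP i (b1 C i) v ∈ U1 C := by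
  obtain ⟨u, hu, h⟩ := h; exact ⟨_, UU_PP C i hu, h.PP i (bq_sp C i)⟩
lemma U1_sh {v v' : Fn r ℚ} (h : v ∈ U1 C) (h' : v' ∈ U1 C) : sh t1 v v' ∈ U1 C := by
  obtain ⟨u, hu, h⟩ := h
  obtain ⟨u', hu', h'⟩ := h'
  exact ⟨_, UU_sh _ hu hu', h.sh (tq_sp _) h'⟩
lemma U1_Lop (f : Fr r ℚ) {v : Fn r ℚ} (h : v ∈ U1 C) : Lop f v ∈ U1 C := by
  obtain ⟨u, hu, h⟩ := h; exact ⟨_, UU_Lop _ _ hu, (RedF.lift f).Lop h⟩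
lemma U1_de_nil : de [] ∈ U1 C := ⟨_, UU_one _, Red.de _⟩
lemma U1_letter (i) : de [i] ∈ U1 C := ⟨_, UU_letter _ i, Red.de _⟩

variable (C)
abbrev LL := Module.End ℚ (U1 C)
instance instLieRingLL : LieRing (LL C) := LieRing.ofAssociativeRing
instance instLieAlgLL : LieAlgebra ℚ (LL C) := LieAlgebra.ofAssociativeAlgebra

def eL (i : Fin r) : LL C := (Dl i).restrict (fun v hv => U1_Dl i hv)
def pL (i : Fin r) : LL C := (PP i (b1 C i)).restrict (fun v hv => U1_PP i hv)
def fL (i : Fin r) : LL C := (-((C.d i : ℚ)⁻¹)) • pL C i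
def hL (i : Fin r) : LL C := ⁅eL C i, fL C i⁆

variable {C}
lemma LL_ext {X Y : LL C} (h : ∀ u, ((X u : U1 C) : Fn r ℚ) = (Y u : U1 C)) : X = Y :=
  LinearMap.ext fun u => Subtype.ext (h u)

lemma LL_lie (X Y : LL C) : ⁅X, Y⁆ = X * Y - Y * X := rfl

lemma eL_coe (i) (u : U1 C) : ((eL C i u : U1 C) : Fn r ℚ) = Dl i (u : Fn r ℚ) := rfl
lemma pL_coe (i) (u : U1 C) : ((pL C i u : U1 C) : Fn r ℚ) = PP i (b1 C i) (u : Fn r ℚ) := rfl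

lemma ep (i j) (u : U1 C) : ((⁅eL C i, pL C j⁆ u : U1 C) : Fn r ℚ) = if i = j then b1 C j * (u : Fn r ℚ) else 0 := by
  rw [LL_lie, LinearMap.sub_apply, Submodule.coe_sub, Module.End.mul_apply, Module.End.mul_apply]
  rw [eL_coe, pL_coe, pL_coe, eL_coe, Dl_PP, add_sub_cancel_left]

lemma d_ne (i) : (C.d i : ℚ) ≠ 0 := by have := d_pos C i; positivity

lemma hL_coe (i) (u : U1 C) : ((hL C i u : U1 C) : Fn r ℚ) = fun w => -((wt C (dz w) i : ℤ) : ℚ) * (u : Fn r ℚ) w := by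
  rw [hL, fL, lie_smul, LinearMap.smul_apply, Submodule.coe_smul, ep, if_pos rfl]
  funext w
  rw [Pi.smul_apply, Pi.mul_apply, b1, ip_al_left, smul_eq_mul]
  have := d_ne (C := C) i
  push_cast
  field_simp

lemma PP_wt (i j : Fin r) (b : Word r → ℚ) (u : Fn r ℚ) (w : Word r) :
    PP j b (fun x => ((wt C (dz x) i : ℤ) : ℚ) * u x) w
      = (((wt C (dz w) i : ℤ) : ℚ) - ((C.a i j : ℤ) : ℚ)) * PP j b u w := by
  have gen : ∀ c : ℚ, PP j b (fun x => (((wt C (dz x) i : ℤ) : ℚ) + c) * u x) w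
      = (((wt C (dz w) i : ℤ) : ℚ) + c - ((C.a i j : ℤ) : ℚ)) * PP j b u w := by
    induction w generalizing u with
    | nil => intro c; simp [PP_nil]
    | cons d w ih =>
      intro c
      rw [PP_cons, PP_cons]
      have : Dl d (fun x => (((wt C (dz x) i : ℤ) : ℚ) + c) * u x)
        = fun x => (((wt C (dz x) i : ℤ) : ℚ) + (c + ((C.a i d : ℤ) : ℚ))) * (Dl d u) x := by
        funext x; simp only [Dl_apply]; rw [dz_cons, wt_add, wt_al]; push_cast; ring
      rw [this, ih (Dl d u), dz_cons, wt_add, wt_al]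
      split_ifs with h
      · subst h; push_cast; ring
      · push_cast; ring
  simpa using gen 0

def TT {k : Type*} [CommRing k] (i j : Fin r) (c : ℕ → k) : ℕ → (Fn r k →ₗ[k] Fn r k)
  | 0 => Dl j
  | n+1 => TT i j c n ∘ₗ Dl i - c n • (Dl i ∘ₗ TT i j c n)

def zz (i j : Fin r) (c : ℕ → K) : ℕ → Fr r K
  | 0 => Finsupp.single [j] 1
  | n+1 => cm (Finsupp.single [i] 1) (zz i j c n) - c n • cm (zz i j c n) (Finsupp.single [i] 1)

lemma Lop_letter {k : Type*} [CommRing k] (d : Fin r) : Lop (Finsupp.single [d] (1:k)) = Dl d := by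
  ext u y; simp [Lop_single]

lemma TT_zz (i j : Fin r) (c : ℕ → K) (n) : TT i j c n = Lop (zz i j c n) := by
  induction n with
  | zero => exact (Lop_letter j).symm
  | succ n ih => rw [TT, zz, Lop_sub, Lop_smul, Lop_cm, Lop_cm, Lop_letter, ih]

lemma Red.TT (i j : Fin r) {c : ℕ → K} {c' : ℕ → ℚ} (hc : ∀ n, Sp (c n) (c' n)) (n) {u v} (h : Red u v) :
    Red (_root_.TT i j c n u) (_root_.TT i j c' n v) := by
  induction n generalizing u v with
  | zero => exact h.Dl j
  | succ n ih => exact (ih (h.Dl i)).sub (Red.smul (hc n) ((ih h).Dl i))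

variable (C) in
def cS (i j : Fin r) (n : ℕ) : K := chi (kap C i) (List.replicate n i ++ [j])

lemma cS_sp (i j : Fin r) (n) : Sp (cS C i j n) 1 := by rw [cS, chi_kap]; exact Sp.qpow _

lemma XiF_zz (i j : Fin r) (hij : i ≠ j) (n : ℕ) : ∃ s : K,
    XiF (tq C.p) (zz i j (cS C i j) n) = s • de (List.replicate n i ++ [j]) ∧
    XiF (tq C.p) (zz i j (cS C i j) (n+1)) = (s * (-qd) * (∑ m ∈ Finset.range (n+1), bq C i (List.replicate m i ++ [j])))
      • de (List.replicate (n+1) i ++ [j]) := by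
  have hstep : ∀ n (s : K), XiF (tq C.p) (zz i j (cS C i j) n) = s • de (List.replicate n i ++ [j]) →
     XiF (tq C.p) (zz i j (cS C i j) (n+1)) = (s * (-qd) * (∑ m ∈ Finset.range (n+1), bq C i (List.replicate m i ++ [j])))
      • de (List.replicate (n+1) i ++ [j]) := by
    intro n s hs
    have hb : bq C i [] = 0 := by rw [bq, dz_nil, ip_symm, ip_zero_left, qint_zero]
    have h1 := PP_sh C i (de (List.replicate n i ++ [j]))
    rw [PP_de i j hij _ hb, mulc_de] at h1
    rw [zz, map_sub, map_smul, XiF_cm, XiF_cm, XiF_single, Xi_single, one_smul, hs, mul_smul, mul_smul, ← h1, smul_sub]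
    simp only [map_smul, LinearMap.smul_apply]
    rw [smul_comm s]; rfl
  induction n with
  | zero =>
    refine ⟨1, ?_, ?_⟩
    · simp [zz, XiF_single, Xi_single]
    · apply hstep; simp [zz, XiF_single, Xi_single]
  | succ n ih =>
    obtain ⟨s, h1, h2⟩ := ih
    exact ⟨_, h2, hstep _ _ h2⟩

lemma XiF_zz_zero (i j : Fin r) (hij : i ≠ j) : ∃ n, XiF (tq C.p) (zz i j (cS C i j) n) = 0 := by
  obtain ⟨n, hn⟩ : ∃ n : ℕ, C.a i j = -(n:ℤ) := by
    have := C.offdiag i j hij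
    exact ⟨(-C.a i j).toNat, by omega⟩
  obtain ⟨s, _, h2⟩ := XiF_zz (C := C) i j hij n
  refine ⟨n+1, ?_⟩
  rw [h2]
  suffices h : ∑ m ∈ Finset.range (n+1), bq C i (List.replicate m i ++ [j]) = 0 by
    rw [h, mul_zero, zero_smul]
  have hb : ∀ m : ℕ, bq C i (List.replicate m i ++ [j]) = qint (C.d i * (2 * m - n)) := by
    intro m
    have : dz (List.replicate m i ++ [j]) = (m:ℤ) • al i + al j := by
      rw [dz_append, dz_single]; congr 1
      induction m with
      | zero => simp [dz_nil]
      | succ m ih => rw [List.replicate_succ, dz_cons, ih]; push_cast; rw [add_smul, one_smul]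
    rw [bq, this, ip_add_right, ip_smul_right, ip_al_left, ip_al_left, wt_al, wt_al, C.diag, hn]
    congr 1; ring
  have h3 := Finset.sum_range_reflect (fun m => bq C i (List.replicate m i ++ [j])) (n+1)
  have h4 : ∑ m ∈ Finset.range (n+1), bq C i (List.replicate (n + 1 - 1 - m) i ++ [j])
      = - ∑ m ∈ Finset.range (n+1), bq C i (List.replicate m i ++ [j]) := by
    rw [← Finset.sum_neg_distrib]
    refine Finset.sum_congr rfl fun m hm => ?_
    rw [hb, hb, ← qint_neg]
    have : m ≤ n := by have := Finset.mem_range.1 hm; omega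
    congr 1
    rw [Nat.add_sub_cancel, Nat.cast_sub this]; ring
  rw [h4] at h3
  have h5 : (2:K) * ∑ m ∈ Finset.range (n+1), bq C i (List.replicate m i ++ [j]) = 0 := by
    linear_combination -h3
  rcases mul_eq_zero.1 h5 with h | h
  · exact absurd h (by norm_num)
  · exact h

lemma Lop_zero_of_XiF {t : Fin r → Fin r → K} {f : Fr r K} (h : XiF t f = 0) {u} (hu : u ∈ UU t) : Lop f u = 0 := by
  funext y
  exact (XiF_eq_zero_iff t f).1 h _ (UU_Drw t y hu)

lemma TT_zero (i j : Fin r) (hij : i ≠ j) : ∃ n, ∀ v ∈ U1 C, TT i j (fun _ => (1:ℚ)) n v = 0 := by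
  obtain ⟨n, hn⟩ := XiF_zz_zero (C := C) i j hij
  refine ⟨n, ?_⟩
  rintro v ⟨u, hu, h⟩
  have h1 := Red.TT i j (c' := fun _ => (1:ℚ)) (fun n => cS_sp (C := C) i j n) n h
  rw [TT_zz, Lop_zero_of_XiF hn hu] at h1
  exact h1.unique Red.zero

variable (C) in
def ZL : CL C (LL C) where
  e := eL C
  f := fL C
  h := hL C
  ef := by
    intro i j
    split_ifs with h
    · subst h; rfl
    · apply LL_ext; intro u
      rw [fL, lie_smul, LinearMap.smul_apply, Submodule.coe_smul, ep, if_neg h]; simp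
  he := by
    intro i j
    apply LL_ext; intro u
    rw [LL_lie, LinearMap.sub_apply, Submodule.coe_sub, Module.End.mul_apply,
      Module.End.mul_apply, hL_coe, eL_coe, eL_coe, hL_coe, LinearMap.smul_apply, Submodule.coe_smul, eL_coe]
    funext w
    simp only [Pi.sub_apply, Dl_apply, Pi.smul_apply, smul_eq_mul]
    rw [dz_cons, wt_add, wt_al]; push_cast; ring
  hf := by
    intro i j
    apply LL_ext; intro u
    rw [LL_lie, LinearMap.sub_apply, Submodule.coe_sub, Module.End.mul_apply,
      Module.End.mul_apply, hL_coe]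
    simp only [fL, LinearMap.smul_apply, Submodule.coe_smul, pL_coe, hL_coe]
    funext w
    have h1 : (fun w => -((wt C (dz w) i : ℤ) : ℚ) * (u : Fn r ℚ) w)
       = -(fun w => ((wt C (dz w) i : ℤ) : ℚ) * (u : Fn r ℚ) w) := by funext w; simp
    rw [h1, map_neg]
    simp only [Pi.sub_apply, Pi.smul_apply, Pi.neg_apply, smul_eq_mul]
    rw [PP_wt]; ring
  serre := by
    intro i j hij
    obtain ⟨n, hn⟩ := TT_zero (C := C) i j hij
    refine ⟨n, ?_⟩
    have key : ∀ m, ∀ u : U1 C, (((((LieAlgebra.ad ℚ (LL C) (eL C i)) ^ m) (eL C j)) u : U1 C) : Fn r ℚ)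
        = (-1 : ℚ) ^ m • TT i j (fun _ => (1:ℚ)) m u := by
      intro m
      induction m with
      | zero => intro u; simp [TT, eL_coe]
      | succ m ih =>
        intro u
        rw [pow_succ', Module.End.mul_apply, LieAlgebra.ad_apply, LL_lie,
          LinearMap.sub_apply, Submodule.coe_sub, Module.End.mul_apply, Module.End.mul_apply, eL_coe, ih, ih, eL_coe, TT]
        simp only [map_smul, LinearMap.sub_apply, LinearMap.comp_apply, LinearMap.smul_apply, one_smul]
        rw [pow_succ, mul_neg_one, neg_smul, smul_sub]; abel
    apply LL_ext; intro u
    rw [key, hn u u.2, smul_zero]; rfl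
  e0 := by
    intro i h
    have h1 := eL_coe (C := C) i ⟨_, U1_letter i⟩
    rw [h] at h1
    have h2 := congrFun h1 []
    simp [de_apply] at h2
end
end

section
set_option linter.all false
/-! ### Part 11 : PBW property of the classical limit -/

section
variable {C : CartanData r}

lemma sh1_comm (u v : Fn r ℚ) : sh t1 u v = sh t1 v u := by
  funext w
  induction w generalizing u v with
  | nil => simp [sh_nil, mul_comm]
  | cons d w ih => rw [sh_cons, sh_cons, mulc_one, mulc_one, ih (Dl d u), ih u, add_comm]

def mU : U1 C →ₗ[ℚ] U1 C →ₗ[ℚ] U1 C :=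
  LinearMap.mk₂ ℚ (fun u v => ⟨sh t1 u v, U1_sh u.2 v.2⟩)
    (fun u u' v => Subtype.ext (by simp)) (fun c u v => Subtype.ext (by simp))
    (fun u u' v => Subtype.ext (by simp)) (fun c u v => Subtype.ext (by simp))

lemma mU_coe (u v : U1 C) : ((mU u v : U1 C) : Fn r ℚ) = sh t1 u v := rfl
lemma mU_comm (u v : U1 C) : mU u v = mU v u := Subtype.ext (sh1_comm _ _)
lemma mU_assoc (u v w : U1 C) : mU (mU u v) w = mU u (mU v w) := Subtype.ext (sh_assoc _ _ _ _)
variable (C) in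
def oU : U1 C := ⟨de [], U1_de_nil⟩
lemma oU_mU (u : U1 C) : mU (oU C) u = u := Subtype.ext (sh_one_left _ _)

def eps : U1 C →ₗ[ℚ] ℚ where
  toFun u := (u : Fn r ℚ) []
  map_add' _ _ := rfl
  map_smul' _ _ := rfl
lemma eps_mU (u v : U1 C) : eps (mU u v) = eps u * eps v := rfl
lemma eps_oU : eps (oU C) = 1 := by simp [eps, oU, de_apply]

def DerU (X : LL C) : Prop := ∀ u v, X (mU u v) = mU (X u) v + mU u (X v)

lemma DerU_e (i) : DerU (eL C i) := fun u v => Subtype.ext (Der_Dl i u v)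

lemma DerU.lie {X Y : LL C} (h : DerU X) (h' : DerU Y) : DerU ⁅X, Y⁆ := by
  intro u v
  simp only [LL_lie, LinearMap.sub_apply, Module.End.mul_apply, h' u v, h u v, map_add, h _ _, h' _ _, map_sub]
  abel

lemma DerU_rnb (w : Word r) : DerU ((ZL C).rnb w) := by
  induction w with
  | nil => intro u v; simp [CL.rnb]
  | cons i w ih =>
    by_cases hw : w = []
    · subst hw; exact DerU_e i
    · rw [CL.rnb_cons _ i hw]; exact (DerU_e i).lie ih

lemma DerU_N {β} {X : LL C} (h : X ∈ (ZL C).N β) : DerU X := by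
  refine CL.N_ind (ZL C) (β := β) (P := DerU) ?_ ?_ ?_ ?_ h
  · intro u v; simp
  · intro x y hx hy u v
    simp only [LinearMap.add_apply, hx u v, hy u v, map_add]; abel
  · intro c x hx u v
    simp only [LinearMap.smul_apply, hx u v, map_smul, smul_add]
  · intro w _ _; exact DerU_rnb w

/-- `X` is given by the homogeneous functional `f` -/
def RepF (X : LL C) (f : Fr r ℚ) (β : Fin r → ℤ) : Prop :=
  (∀ w, f w ≠ 0 → dz w = β) ∧ ∀ u : U1 C, ((X u : U1 C) : Fn r ℚ) = Lop f u

lemma RepF.lie {X Y : LL C} {f g β γ} (h : RepF X f β) (h' : RepF Y g γ) : RepF ⁅X, Y⁆ (cm g f - cm f g) (β + γ) := by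
  constructor
  · intro w hw
    rw [Finsupp.sub_apply] at hw
    by_cases h1 : cm g f w = 0
    · rw [h1, zero_sub, neg_ne_zero] at hw
      obtain ⟨a, b, rfl, ha, hb⟩ := cm_supp hw
      rw [dz_append, h.1 a ha, h'.1 b hb]
    · obtain ⟨a, b, rfl, ha, hb⟩ := cm_supp h1
      rw [dz_append, h'.1 a ha, h.1 b hb, add_comm]
  · intro u
    rw [LL_lie, LinearMap.sub_apply, Submodule.coe_sub, Module.End.mul_apply, Module.End.mul_apply, h.2, h'.2, h'.2, h.2,
      Lop_sub, Lop_cm, Lop_cm]; rfl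

lemma RepF_e (i) : RepF (eL C i) (Finsupp.single [i] 1) (al i) := by
  constructor
  · intro w hw
    rw [Finsupp.single_apply] at hw
    split_ifs at hw with h
    · rw [← h, dz_single]
    · simp at hw
  · intro u; rw [Lop_letter]; rfl

lemma RepF_N {β} {X : LL C} (h : X ∈ (ZL C).N β) : ∃ f, RepF X f β := by
  have hz : RepF (0 : LL C) 0 β := ⟨by simp, fun u => by
    have : Lop (0 : Fr r ℚ) = 0 := by ext u y; simp [Lop_apply]
    rw [this]; rfl⟩
  refine CL.N_ind (ZL C) (β := β) (P := fun X => ∃ f, RepF X f β) ⟨0, hz⟩ ?_ ?_ ?_ h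
  · rintro x y ⟨f, hf⟩ ⟨g, hg⟩
    refine ⟨f + g, ?_, ?_⟩
    · intro w hw
      by_cases h1 : f w = 0
      · exact hg.1 w (by simpa [h1] using hw)
      · exact hf.1 w h1
    · intro u; rw [Lop_add, LinearMap.add_apply, Submodule.coe_add, hf.2, hg.2]; rfl
  · rintro c x ⟨f, hf⟩
    refine ⟨c • f, ?_, ?_⟩
    · intro w hw; exact hf.1 w (by intro h1; simp [h1] at hw)
    · intro u; rw [Lop_smul, LinearMap.smul_apply, Submodule.coe_smul, hf.2]; rfl
  · intro w hw0 hw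
    clear h
    have : ∀ w : Word r, w ≠ [] → ∃ f, RepF ((ZL C).rnb w) f (dz w) := by
      intro w
      induction w with
      | nil => simp
      | cons i w ih =>
        intro _
        by_cases hw : w = []
        · subst hw; rw [dz_single]; exact ⟨_, RepF_e i⟩
        · obtain ⟨f, hf⟩ := ih hw
          rw [CL.rnb_cons _ i hw, dz_cons, add_comm]
          exact ⟨_, (RepF_e i).lie hf⟩
    rw [← hw]; exact this w hw0

lemma RepF.eps {X : LL C} {f β} (h : RepF X f β) (u : U1 C) : _root_.eps (X u) = pr f (u : Fn r ℚ) := by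
  rw [pr_eq_Lop, ← h.2]; rfl

variable (C) in
open scoped Classical in
/-- chosen root vectors -/
def x0 (γ : Fin r → ℤ) : LL C := if h : (ZL C).Rt γ then h.choose else 0

lemma x0_mem {γ} (h : (ZL C).Rt γ) : x0 C γ ∈ (ZL C).N γ := by
  rw [x0, dif_pos h]; exact h.choose_spec.1
lemma x0_ne {γ} (h : (ZL C).Rt γ) : x0 C γ ≠ 0 := by
  rw [x0, dif_pos h]; exact h.choose_spec.2

lemma exists_dual {γ} (h : (ZL C).Rt γ) : ∃ u : U1 C, eps u = 0 ∧ eps (x0 C γ u) = 1 ∧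
    ∀ δ, (ZL C).Rt δ → δ ≠ γ → eps (x0 C δ u) = 0 := by
  obtain ⟨f, hf⟩ := RepF_N (x0_mem h)
  have h1 : ∃ u : U1 C, pr f (u : Fn r ℚ) ≠ 0 := by
    by_contra hc
    push Not at hc
    apply x0_ne h
    apply LL_ext; intro u
    rw [hf.2]
    funext y
    exact hc ⟨Drw y u, U1_Drw y u.2⟩
  obtain ⟨u, hu⟩ := h1
  obtain ⟨w, hw, hwγ⟩ := CL.Rt.word (ZL C) h
  have hc : pr f (comp (deg w) (u : Fn r ℚ)) = pr f (u : Fn r ℚ) := by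
    apply pr_congr
    intro x hx
    rw [comp_apply, if_pos]
    rw [← dz_eq_deg, hf.1 x hx, hwγ]
  refine ⟨(pr f (u : Fn r ℚ))⁻¹ • ⟨comp (deg w) u, U1_comp _ u.2⟩, ?_, ?_, ?_⟩
  · rw [map_smul]
    have : eps (⟨comp (deg w) u, U1_comp _ u.2⟩ : U1 C) = 0 := by
      show comp (deg w) (u : Fn r ℚ) [] = 0
      rw [comp_apply, if_neg]
      rw [← dz_eq_deg, dz_nil, eq_comm, dz_eq_zero]; exact hw
    rw [this, smul_zero]
  · rw [map_smul, map_smul, hf.eps]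
    show _ * pr f (comp (deg w) (u : Fn r ℚ)) = 1
    rw [hc, inv_mul_cancel₀ hu]
  · intro δ hδ hne
    obtain ⟨g, hg⟩ := RepF_N (x0_mem hδ)
    rw [map_smul, map_smul, hg.eps]
    have : pr g (comp (deg w) (u : Fn r ℚ)) = pr g 0 := by
      apply pr_congr
      intro x hx
      rw [comp_apply, if_neg]; · rfl
      rw [← dz_eq_deg, hg.1 x hx, hwγ]; exact hne
    show _ * pr g (comp (deg w) (u : Fn r ℚ)) = 0
    rw [this, map_zero, mul_zero]

variable (C) in
open scoped Classical in
def uD (γ : Fin r → ℤ) : U1 C := if h : (ZL C).Rt γ then (exists_dual h).choose else 0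
lemma uD_eps (γ) : eps (uD C γ) = 0 := by
  rw [uD]; split_ifs with h
  · exact (exists_dual h).choose_spec.1
  · simp
lemma uD_one {γ} (h : (ZL C).Rt γ) : eps (x0 C γ (uD C γ)) = 1 := by
  rw [uD, dif_pos h]; exact (exists_dual h).choose_spec.2.1
lemma uD_zero {γ δ} (h : (ZL C).Rt γ) (h' : (ZL C).Rt δ) (hne : δ ≠ γ) : eps (x0 C δ (uD C γ)) = 0 := by
  rw [uD, dif_pos h]; exact (exists_dual h).choose_spec.2.2 δ h' hne

variable (C) in
def opX : List (Fin r → ℤ) → LL C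
  | [] => 1
  | γ :: gs => opX gs * x0 C γ

lemma opX_append (a b : List (Fin r → ℤ)) : opX C (a ++ b) = opX C b * opX C a := by
  induction a with
  | nil => simp [opX]
  | cons γ a ih => rw [List.cons_append, opX, opX, ih, mul_assoc]

variable (C) in
def vv : List (Fin r → ℤ) → U1 C
  | [] => oU C
  | γ :: gs => mU (uD C γ) (vv gs)

lemma vv_perm {a b : List (Fin r → ℤ)} (h : a.Perm b) : vv C a = vv C b := by
  induction h with
  | nil => rfl
  | cons x _ ih => rw [vv, vv, ih]
  | swap x y l => rw [vv, vv, vv, vv, ← mU_assoc, ← mU_assoc, mU_comm (uD C y)]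
  | trans _ _ h1 h2 => rw [h1, h2]

variable (C) in
def II : ℕ → Submodule ℚ (U1 C)
  | 0 => ⊤
  | k+1 => Submodule.span ℚ {x | ∃ u v, eps u = 0 ∧ v ∈ II k ∧ mU u v = x}

lemma II_ideal (k : ℕ) (a : U1 C) {v} (hv : v ∈ II C k) : mU a v ∈ II C k := by
  cases k with
  | zero => trivial
  | succ k =>
    rw [II] at hv ⊢
    induction hv using Submodule.span_induction with
    | mem x hx =>
      obtain ⟨u, v, h1, h2, rfl⟩ := hx
      apply Submodule.subset_span
      exact ⟨mU a u, v, by rw [eps_mU, h1, mul_zero], h2, mU_assoc _ _ _⟩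
    | zero => simp
    | add x y _ _ hx hy => rw [map_add]; exact add_mem hx hy
    | smul c x _ hx => rw [map_smul]; exact Submodule.smul_mem _ _ hx

lemma II_mul {k : ℕ} {u v : U1 C} (hu : eps u = 0) (hv : v ∈ II C k) : mU u v ∈ II C (k+1) := by
  rw [II]; exact Submodule.subset_span ⟨u, v, hu, hv, rfl⟩

lemma II_der {X : LL C} (hX : DerU X) (k : ℕ) {v} (hv : v ∈ II C (k+1)) : X v ∈ II C k := by
  induction k generalizing v with
  | zero => trivial
  | succ k ih =>
    rw [II] at hv
    induction hv using Submodule.span_induction with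
    | mem x hx =>
      obtain ⟨u, v, h1, h2, rfl⟩ := hx
      rw [hX]
      exact add_mem (II_ideal _ _ h2) (II_mul h1 (ih h2))
    | zero => simp
    | add x y _ _ hx hy => rw [map_add]; exact add_mem hx hy
    | smul c x _ hx => rw [map_smul]; exact Submodule.smul_mem _ _ hx

lemma II_eps {k : ℕ} {v} (hv : v ∈ II C (k+1)) : eps v = 0 := by
  rw [II] at hv
  induction hv using Submodule.span_induction with
  | mem x hx =>
    obtain ⟨u, v, h1, h2, rfl⟩ := hx
    rw [eps_mU, h1, zero_mul]
  | zero => simp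
  | add x y _ _ hx hy => rw [map_add, hx, hy, add_zero]
  | smul c x _ hx => rw [map_smul, hx, smul_zero]

lemma II_opX {gs : List (Fin r → ℤ)} (hg : ∀ γ ∈ gs, (ZL C).Rt γ) {k} (hk : gs.length < k) {v} (hv : v ∈ II C k) :
    eps (opX C gs v) = 0 := by
  induction gs generalizing k v with
  | nil =>
    obtain ⟨m, rfl⟩ : ∃ m, k = m + 1 := ⟨k - 1, by simp at hk; omega⟩
    exact II_eps hv
  | cons γ gs ih =>
    obtain ⟨m, rfl⟩ : ∃ m, k = m + 1 := ⟨k - 1, by simp at hk; omega⟩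
    rw [opX, Module.End.mul_apply]
    refine ih (fun δ hδ => hg δ (by simp [hδ])) (k := m) (by simp at hk; omega) ?_
    exact II_der (DerU_N (x0_mem (hg γ (by simp)))) m hv

lemma vv_mem (ms : List (Fin r → ℤ)) : vv C ms ∈ II C ms.length := by
  induction ms with
  | nil => trivial
  | cons m ms ih => exact II_mul (uD_eps m) ih

lemma x0_vv {γ} (hγ : (ZL C).Rt γ) {ms : List (Fin r → ℤ)} (hm : ∀ m ∈ ms, (ZL C).Rt m) :
    x0 C γ (vv C ms) - (ms.count γ : ℚ) • vv C (ms.erase γ) ∈ II C ms.length := by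
  induction ms with
  | nil => trivial
  | cons m ms ih =>
    have ih := ih (fun x hx => hm x (by simp [hx]))
    have hmm := hm m (by simp)
    rw [vv, DerU_N (x0_mem hγ)]
    have h2 := II_mul (uD_eps (C := C) m) ih
    rw [map_sub, map_smul] at h2
    by_cases h : γ = m
    · subst h
      rw [List.count_cons_self, List.erase_cons_head]
      have h1 : mU (x0 C γ (uD C γ) - oU C) (vv C ms) ∈ II C (ms.length + 1) :=
        II_mul (by rw [map_sub, uD_one hγ, eps_oU, sub_self]) (vv_mem ms)
      have h3 := add_mem h1 h2
      have h4 : (ms.count γ : ℚ) • mU (uD C γ) (vv C (ms.erase γ)) = (ms.count γ : ℚ) • vv C ms := by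
        by_cases hc : γ ∈ ms
        · rw [← vv_perm (List.perm_cons_erase hc).symm]; rfl
        · rw [List.count_eq_zero_of_not_mem hc]; simp
      rw [h4] at h3
      show _ ∈ II C (ms.length + 1)
      convert h3 using 1
      rw [map_sub, LinearMap.sub_apply, oU_mU]; push_cast
      rw [add_smul, one_smul]; abel
    · rw [List.count_cons_of_ne (Ne.symm h), List.erase_cons_tail (by simpa using Ne.symm h)]
      have h1 : mU (x0 C γ (uD C m)) (vv C ms) ∈ II C (ms.length + 1) :=
        II_mul (uD_zero hmm hγ h) (vv_mem ms)
      have h3 := add_mem h1 h2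
      show _ ∈ II C (ms.length + 1)
      convert h3 using 1
      rw [vv]; abel

lemma opX_vv {gs ms : List (Fin r → ℤ)} (hg : ∀ γ ∈ gs, (ZL C).Rt γ) (hm : ∀ m ∈ ms, (ZL C).Rt m)
    (hl : gs.length = ms.length) : ∃ n : ℕ, eps (opX C gs (vv C ms)) = n ∧ (n ≠ 0 ↔ gs.Perm ms) := by
  induction gs generalizing ms with
  | nil =>
    have : ms = [] := List.eq_nil_of_length_eq_zero hl.symm
    subst this
    exact ⟨1, by simp [opX, vv, eps_oU], by simp⟩
  | cons γ gs ih =>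
    have hγ := hg γ (by simp)
    have hg' : ∀ γ ∈ gs, (ZL C).Rt γ := fun δ hδ => hg δ (by simp [hδ])
    have h1 := II_opX hg' (k := ms.length) (by simp at hl; omega) (x0_vv hγ hm)
    rw [map_sub, map_sub, map_smul, map_smul, sub_eq_zero] at h1
    rw [opX, Module.End.mul_apply, h1]
    by_cases hc : γ ∈ ms
    · obtain ⟨n, h2, h3⟩ := ih (ms := ms.erase γ) hg' (fun m h => hm m (List.mem_of_mem_erase h))
        (by rw [List.length_erase_of_mem hc]; simp at hl; omega)
      refine ⟨ms.count γ * n, by rw [h2]; push_cast; rfl, ?_⟩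
      rw [List.cons_perm_iff_perm_erase, ← h3]
      have := List.count_pos_iff.2 hc
      simp [hc]
      intros; omega
    · refine ⟨0, by rw [List.count_eq_zero_of_not_mem hc]; simp, ?_⟩
      rw [List.cons_perm_iff_perm_erase]; simp [hc]

lemma PBW_ind (S : Finset (List (Fin r → ℤ))) (hS : ∀ gs ∈ S, ∀ γ ∈ gs, (ZL C).Rt γ)
    (hP : ∀ gs ∈ S, ∀ hs ∈ S, gs.Perm hs → gs = hs) (c : List (Fin r → ℤ) → ℚ)
    (h : ∀ v : U1 C, ∑ gs ∈ S, c gs * eps (opX C gs v) = 0) : ∀ gs ∈ S, c gs = 0 := by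
  classical
  by_contra hc
  push Not at hc
  obtain ⟨g1, hg1, hc1⟩ := hc
  obtain ⟨g0, hg0, hmax⟩ := Finset.exists_max_image (S.filter fun gs => c gs ≠ 0) List.length ⟨g1, by simp [hg1, hc1]⟩
  rw [Finset.mem_filter] at hg0
  have h1 := h (vv C g0)
  rw [Finset.sum_eq_single g0] at h1
  · obtain ⟨n, h2, h3⟩ := opX_vv (hS g0 hg0.1) (hS g0 hg0.1) rfl
    rw [h2] at h1
    rcases mul_eq_zero.1 h1 with h4 | h4
    · exact hg0.2 h4
    · exact (h3.2 (List.Perm.refl _)) (by exact_mod_cast h4)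
  · intro gs hgs hne
    by_cases hcg : c gs = 0
    · rw [hcg, zero_mul]
    have hle := hmax gs (by simp [hgs, hcg])
    rcases hle.lt_or_eq with hlt | heq
    · rw [II_opX (hS gs hgs) hlt (vv_mem g0), mul_zero]
    · obtain ⟨n, h2, h3⟩ := opX_vv (hS gs hgs) (hS g0 hg0.1) heq
      rw [h2]
      by_cases hn : n = 0
      · simp [hn]
      · exact absurd (hP gs hgs g0 hg0.1 (h3.1 hn)) hne
  · intro h; exact absurd hg0.1 h

lemma opX_swap (v : U1 C) (a b : List (Fin r → ℤ)) {γ δ} (hγ : (ZL C).Rt γ) (hδ : (ZL C).Rt δ)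
    (hs : (ZL C).Rt (γ + δ) → eps (opX C (a ++ (γ + δ) :: b) v) = 0) :
    eps (opX C (a ++ γ :: δ :: b) v) = eps (opX C (a ++ δ :: γ :: b) v) := by
  have h1 : opX C (a ++ γ :: δ :: b) - opX C (a ++ δ :: γ :: b) = opX C b * ⁅x0 C δ, x0 C γ⁆ * opX C a := by
    rw [opX_append, opX_append, opX, opX, opX, opX]
    apply LinearMap.ext; intro u
    simp only [LL_lie, LinearMap.sub_apply, Module.End.mul_apply, map_sub]
  have hm : ⁅x0 C δ, x0 C γ⁆ ∈ (ZL C).N (γ + δ) := by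
    rw [add_comm]; exact CL.N_lie _ (x0_mem hδ) (x0_mem hγ)
  rw [← sub_eq_zero, ← map_sub, ← LinearMap.sub_apply, h1]
  by_cases hR : (ZL C).Rt (γ + δ)
  · obtain ⟨c, hc⟩ := CL.dim_le (ZL C) (x0_mem hR) hm (x0_ne hR)
    have h2 := hs hR
    rw [opX_append, opX] at h2
    rw [hc, mul_smul_comm, smul_mul_assoc, LinearMap.smul_apply, map_smul, h2, smul_zero]
  · have : ⁅x0 C δ, x0 C γ⁆ = 0 := by
      by_contra h; exact hR ⟨_, hm, h⟩
    rw [this]; simp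

lemma PBW_span {β : Fin r → ℤ} (v : U1 C)
    (H : ∀ gs : List (Fin r → ℤ), (∀ γ ∈ gs, (ZL C).Rt γ) → gs.sum = β → ∃ gs', gs'.Perm gs ∧ eps (opX C gs' v) = 0)
    (w : Word r) (hw : dz w = β) : (v : Fn r ℚ) w = 0 := by
  have key : ∀ n, ∀ gs : List (Fin r → ℤ), gs.length = n → (∀ γ ∈ gs, (ZL C).Rt γ) → gs.sum = β → eps (opX C gs v) = 0 := by
    intro n
    induction n using Nat.strong_induction_on with
    | _ n ih =>
      intro gs hl hR hs
      obtain ⟨gs', hp, h0⟩ := H gs hR hs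
      have : ∀ (x y : List (Fin r → ℤ)), x.Perm y → ∀ a, (a ++ x).length = n → (∀ γ ∈ a ++ x, (ZL C).Rt γ) → (a ++ x).sum = β →
          eps (opX C (a ++ x) v) = eps (opX C (a ++ y) v) := by
        intro x y hxy
        induction hxy with
        | nil => intros; rfl
        | cons z _ ih1 =>
          intro a h1 h2 h3
          have := ih1 (a ++ [z]) (by simpa using h1) (by simpa using h2) (by simpa using h3)
          simpa using this
        | swap x y l =>
          intro a h1 h2 h3
          apply opX_swap
          · exact h2 y (by simp)
          · exact h2 x (by simp)
          · intro hR
            refine ih (n - 1) (by simp at h1; omega) _ (by simp at h1 ⊢; omega) ?_ ?_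
            · intro γ hγ
              simp only [List.mem_append, List.mem_cons] at hγ h2
              rcases hγ with hγ | hγ | hγ
              · exact h2 γ (Or.inl hγ)
              · rw [hγ]; exact hR
              · exact h2 γ (by simp [hγ])
            · rw [← h3]; simp [add_assoc]
        | trans hxy _ ih1 ih2 =>
          intro a h1 h2 h3
          have hp := List.Perm.append_left a hxy
          rw [ih1 a h1 h2 h3, ih2 a (hp.length_eq ▸ h1) (fun γ hγ => h2 γ (hp.mem_iff.2 hγ)) (by rw [← hp.sum_eq]; exact h3)]
      have h4 := this gs gs' hp.symm [] (by simpa using hl) (by simpa using hR) (by simpa using hs)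
      simp only [List.nil_append] at h4
      rw [h4, h0]
  have h1 : ∀ w : Word r, ∃ c : ℚ, ∀ u : U1 C, (u : Fn r ℚ) w = c * eps (opX C (w.map al) u) := by
    intro w
    induction w with
    | nil => exact ⟨1, fun u => by simp [opX, eps]⟩
    | cons i w ih =>
      obtain ⟨c, hc⟩ := ih
      obtain ⟨c', hc'⟩ := CL.dim_le (ZL C) (x0_mem (CL.Rt_al (ZL C) i)) (CL.e_mem (ZL C) i) (x0_ne (CL.Rt_al (ZL C) i))
      refine ⟨c * c', fun u => ?_⟩
      have h2 := hc (eL C i u)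
      have h3 : (ZL C).e i = eL C i := rfl
      rw [← h3, hc'] at h2
      have h4 : (((c' • x0 C (al i)) u : U1 C) : Fn r ℚ) w = (u : Fn r ℚ) (i :: w) := by
        rw [← hc', h3]; rfl
      rw [h4] at h2
      rw [h2, LinearMap.smul_apply, map_smul, map_smul, List.map_cons, opX, Module.End.mul_apply, smul_eq_mul, mul_assoc]
  obtain ⟨c, hc⟩ := h1 w
  rw [hc, key _ _ rfl, mul_zero]
  · intro γ hγ
    obtain ⟨i, _, rfl⟩ := List.mem_map.1 hγ
    exact CL.Rt_al _ i
  · rw [← hw]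
    clear hw hc
    induction w with
    | nil => simp [dz_nil]
    | cons i w ih => rw [List.map_cons, List.sum_cons, ih, dz_cons, add_comm]
end
end

section
set_option linter.all false
/-! ### Part 12 : good words, preliminaries for the main induction -/

section
variable (C : CartanData r)

/-- good Lyndon words -/
def GdL (l : Word r) : Prop := Good (tq C.p) l ∧ IsLyndon l
def bb (g : Word r) : Fr r K := cpr (cq C.p) (fac g)
def rr (g : Word r) : Fn r K := XiF (tq C.p) (bb C g)

variable {C}

lemma bb_tri (g : Word r) : Tri (bb C g) g := by
  have := cpr_tri (cq C.p) (fac_SL g).1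
  rwa [fac_flatten] at this
lemma bb_hom (g : Word r) : HomF (⇑(bb C g)) (deg g) := fun w hw => ((bb_tri g).2 w hw).2
lemma rr_hom (g : Word r) : HomF (rr C g) (deg g) := HomF_XiF _ (bb_hom g)
lemma rr_mem (g : Word r) : rr C g ∈ UU (tq C.p) := XiF_mem _ _
lemma bb_flat {ls : List (Word r)} (h : SL ls) : bb C ls.flatten = cpr (cq C.p) ls := by
  rw [bb, fac_eq h]
lemma bb_append {ls ms : List (Word r)} (h : SL (ls ++ ms)) :
    bb C (ls.flatten ++ ms.flatten) = cm (bb C ls.flatten) (bb C ms.flatten) := by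
  rw [← List.flatten_append, bb_flat h, bb_flat h.left, bb_flat h.right, cpr_append]
lemma rr_append {ls ms : List (Word r)} (h : SL (ls ++ ms)) :
    rr C (ls.flatten ++ ms.flatten) = sh (tq C.p) (rr C ls.flatten) (rr C ms.flatten) := by
  rw [rr, bb_append h, XiF_cm]; rfl
lemma rr_symm (g h : Word r) : pr (bb C g) (rr C h) = pr (bb C h) (rr C g) := pr_XiF _ _ _
lemma rr_nil : rr C [] = de [] := by
  rw [rr, bb, fac_nil, cpr_nil, XiF_single]; simp [Xi_nil]
lemma bb_lyndon {l : Word r} (hl : IsLyndon l) : bb C l = brk (cq C.p) l := by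
  rw [bb, fac_lyndon hl, cpr_single]

lemma good_nil : Good (tq C.p) ([] : Word r) :=
  ⟨de [], UU_one _, HomF.de _, by simp [de_apply], fun w hw => by rw [de_ne hw]⟩

lemma exists_good {u : Fn r K} (hu : u ∈ UU (tq C.p)) {ν} (hν : HomF u ν) {w0 : Word r} (h0 : u w0 ≠ 0) :
    ∃ g, Good (tq C.p) g ∧ deg g = ν ∧ w0 ≤ g ∧ u g ≠ 0 ∧ (∀ w, u w ≠ 0 → w ≤ g) ∧ pr (bb C g) u ≠ 0 := by
  obtain ⟨g, h1, h2, h3⟩ := exists_max hν h0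
  have hd := hν g h1
  refine ⟨g, ⟨u, hu, hd ▸ hν, h1, h3⟩, hd, h2, h1, h3, ?_⟩
  rw [(bb_tri g).pr h3]; exact h1

lemma eq_zero_of_pr {u : Fn r K} (hu : u ∈ UU (tq C.p)) {ν} (hν : HomF u ν)
    (h : ∀ g, Good (tq C.p) g → deg g = ν → pr (bb C g) u = 0) : u = 0 := by
  by_contra hne
  obtain ⟨w, hw⟩ := Function.ne_iff.1 hne
  obtain ⟨g, h1, h2, _, _, _, h3⟩ := exists_good hu hν hw
  exact h3 (h g h1 h2)

lemma mem_flatten_good {ls : List (Word r)} (h : Good (tq C.p) ls.flatten) {a} (ha : a ∈ ls) : Good (tq C.p) a := by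
  obtain ⟨x, y, rfl⟩ := List.append_of_mem ha
  rw [List.flatten_append, List.flatten_cons] at h
  exact Good.left _ (Good.right _ h)

lemma fac_good {g : Word r} (h : Good (tq C.p) g) {a} (ha : a ∈ fac g) : GdL C a :=
  ⟨mem_flatten_good (by rwa [fac_flatten]) ha, (fac_SL g).1 a ha⟩

lemma IsMx.good {u : Fn r K} (hu : u ∈ UU (tq C.p)) {g : Word r} (h : IsMx u g) : Good (tq C.p) g :=
  ⟨u, hu, h.1, h.2.1, h.2.2⟩

lemma sh_tq_ne (a b : Word r) : sh (tq C.p) (de a) (de b) (a ++ b) ≠ 0 := by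
  intro h
  have h1 := Red.sh (tq_sp C.p) (Red.de a) (Red.de b) (a ++ b)
  rw [h] at h1
  have h2 := sh1_pos (shuf_append a b)
  rw [Sp.unique h1 Sp.zero] at h2
  exact lt_irrefl _ h2

lemma elim {ν : Fin r → ℕ} {P : Word r → Prop} (hP : ∀ w g, w ≤ g → P g → P w)
    (hmx : ∀ g, Good (tq C.p) g → deg g = ν → P g → IsMx (rr C g) g) (φ : Fn r K →ₗ[K] K)
    (hφ : ∀ g, Good (tq C.p) g → deg g = ν → P g → φ (rr C g) = 0)
    {v : Fn r K} (hv : v ∈ UU (tq C.p)) (hν : HomF v ν) (hw : ∀ w, v w ≠ 0 → P w) : φ v = 0 := by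
  by_contra hne
  let S : Set (Word r) := {g | deg g = ν ∧ P g ∧ ∃ v ∈ UU (tq C.p), HomF v ν ∧ φ v ≠ 0 ∧ v g ≠ 0 ∧ ∀ w, v w ≠ 0 → w ≤ g}
  have hS : S.Finite := (finite_deg ν).subset fun g hg => hg.1
  have key : ∀ v ∈ UU (tq C.p), HomF v ν → φ v ≠ 0 → (∀ w, v w ≠ 0 → P w) → ∃ g ∈ S, v g ≠ 0 := by
    intro v hv hν hne hw
    have h0 : v ≠ 0 := by rintro rfl; simp at hne
    obtain ⟨w, hw0⟩ := Function.ne_iff.1 h0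
    obtain ⟨g, h1, h2, h3⟩ := exists_max hν hw0
    exact ⟨g, ⟨hν g h1, hw g h1, v, hv, hν, hne, h1, h3⟩, h1⟩
  obtain ⟨g0, hg0, _⟩ := key v hv hν hne hw
  obtain ⟨g, hg, hmin⟩ := Set.exists_min_image S id hS ⟨g0, hg0⟩
  obtain ⟨hd, hPg, v, hv, hν, hne, hvg, hvm⟩ := hg
  have hgood : Good (tq C.p) g := ⟨v, hv, hd ▸ hν, hvg, hvm⟩
  have hx := hmx g hgood hd hPg
  have h5 : ∀ w, (v - (v g / rr C g g) • rr C g) w ≠ 0 → w ≤ g := by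
    intro w hw
    by_cases h1 : v w = 0
    · apply hx.2.2; intro h2; apply hw; simp [h1, h2]
    · exact hvm w h1
  obtain ⟨g', hg', hne'⟩ := key (v - (v g / rr C g g) • rr C g)
    (sub_mem hv (Submodule.smul_mem _ _ (rr_mem g))) (hν.sub ((hd ▸ hx.1).smul _))
    (by rw [map_sub, map_smul, hφ g hgood hd hPg, smul_zero, sub_zero]; exact hne) 
    (fun w hw => hP _ _ (h5 w hw) hPg)
  have h6 : g' = g := le_antisymm (h5 g' hne') (hmin g' hg')
  apply hne'
  rw [h6]; simp [div_mul_cancel₀ _ hx.2.1]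

variable (C) in
structure HH (n : ℕ) : Prop where
  m1 : ∀ l l', GdL C l → GdL C l' → l.length < n → deg l = deg l' → l = l'
  m2 : ∀ w : Word r, w ≠ [] → w.length < n → (ZL C).Rt (dz w) → ∃ l, GdL C l ∧ deg l = deg w
  m3 : ∀ l, GdL C l → l.length < n → (ZL C).Rt (dz l)
  x : ∀ l, GdL C l → l.length < n → ∃ X ∈ (ZL C).N (dz l), X ≠ 0 ∧ RepF X (brk c1 l) (dz l)
  ts : ∀ l, GdL C l → l.length < n → ∀ ls : List (Word r), (∀ a ∈ ls, GdL C a) → deg ls.flatten = deg l →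
    (∃ a ∈ ls, l ≤ a) ∧ (∃ b ∈ ls, b ≤ l)
  px : ∀ l, GdL C l → l.length < n → IsMx (rr C l) l
  po : ∀ l g, GdL C l → l.length < n → Good (tq C.p) g → deg g = deg l → g ≠ l → pr (bb C g) (rr C l) = 0

variable {n : ℕ}

lemma HH.mx (H : HH C n) {ls : List (Word r)} (h : SL ls) (hg : ∀ a ∈ ls, GdL C a ∧ a.length < n) :
    IsMx (rr C ls.flatten) ls.flatten := by
  induction ls with
  | nil =>
    show IsMx (rr C []) []
    rw [rr_nil]
    exact ⟨HomF.de _, by simp [de_apply], fun w hw => by rw [de_ne hw]⟩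
  | cons l ls ih =>
    have h1 := ih h.tail fun a ha => hg a (by simp [ha])
    have h2 := rr_append (C := C) (ls := [l]) (ms := ls) h
    rw [List.flatten_singleton] at h2
    rw [List.flatten_cons, h2]
    exact IsMx.sh _ h (H.px l (hg l (by simp)).1 (hg l (by simp)).2) h1 (sh_tq_ne _ _)

lemma HH.mkgood (H : HH C n) {ls : List (Word r)} (h : SL ls) (hg : ∀ a ∈ ls, GdL C a ∧ a.length < n) :
    Good (tq C.p) ls.flatten := (H.mx h hg).good (rr_mem _)

lemma mem_length {ls : List (Word r)} {a : Word r} (ha : a ∈ ls) : a.length ≤ ls.flatten.length := by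
  obtain ⟨x, y, rfl⟩ := List.append_of_mem ha
  simp; omega

lemma HH.mxg (H : HH C n) {g : Word r} (hg : Good (tq C.p) g) (hn : g.length < n) : IsMx (rr C g) g := by
  have := H.mx (fac_SL g) fun a ha => ⟨fac_good hg ha, lt_of_le_of_lt (mem_length ha) (by rwa [fac_flatten])⟩
  rwa [fac_flatten] at this

/-- a proper factor of a non Lyndon word is shorter -/
lemma mem_fac_lt {g : Word r} (hg : ¬ IsLyndon g) {a : Word r} (ha : a ∈ fac g) : a.length < g.length := by
  have h1 : a.length ≤ g.length := by have := mem_length ha; rwa [fac_flatten] at this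
  rcases h1.lt_or_eq with h | h
  · exact h
  exfalso
  obtain ⟨x, y, he⟩ := List.append_of_mem ha
  have h2 := fac_flatten g
  rw [he, List.flatten_append, List.flatten_cons] at h2
  have h3 := congrArg List.length h2
  simp only [List.length_append] at h3
  have hx : x.flatten = [] := List.eq_nil_of_length_eq_zero (by omega)
  have hy : y.flatten = [] := List.eq_nil_of_length_eq_zero (by omega)
  rw [hx, hy] at h2
  simp at h2
  exact hg (h2 ▸ (fac_SL g).1 a ha)

lemma HH.mxn (H : HH C n) {g : Word r} (hg : Good (tq C.p) g) (hn : g.length ≤ n) (hl : ¬ IsLyndon g) : IsMx (rr C g) g := by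
  have := H.mx (fac_SL g) fun a ha => ⟨fac_good hg ha, lt_of_lt_of_le (mem_fac_lt hl ha) hn⟩
  rwa [fac_flatten] at this

/-- smallest good word -/
lemma HH.T (H : HH C n) {l : Word r} (hl : GdL C l) (hn : l.length < n) {g : Word r} (hg : Good (tq C.p) g)
    (hd : deg g = deg l) : l ≤ g := by
  obtain ⟨⟨a, ha, hla⟩, _⟩ := H.ts l hl hn (fac g) (fun a ha => fac_good hg ha) (by rw [fac_flatten, hd])
  rw [← not_lt]
  intro h
  have := (fac_SL g).all_lt (m := l) (by rwa [fac_flatten]) a ha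
  exact absurd hla (not_le.2 this)

lemma HH.T0 (H : HH C n) {l : Word r} (hl : GdL C l) (hn : l.length < n) {u : Fn r K} (hu : u ∈ UU (tq C.p))
    (hν : HomF u (deg l)) (hlt : ∀ w, u w ≠ 0 → w < l) : u = 0 := by
  by_contra hne
  obtain ⟨w, hw⟩ := Function.ne_iff.1 hne
  obtain ⟨g, h1, h2, _, h3, _, _⟩ := exists_good hu hν hw
  exact absurd (H.T hl hn h1 h2) (not_le.2 (hlt g h3))
end
end

section
set_option linter.all false
/-! ### Part 13 : good Lyndon words and roots -/

section
variable {C : CartanData r} {n : ℕ}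

lemma pr_cm {k : Type*} [CommRing k] (f g : Fr r k) (u : Fn r k) : pr (cm f g) u = pr g (Lop f u) := by
  rw [pr_eq_Lop, Lop_cm, pr_eq_Lop g]; rfl

lemma HH.classical (H : HH C n) {ls : List (Word r)} (hg : ∀ a ∈ ls, GdL C a ∧ a.length < n) :
    ∃ c : ℚ, c ≠ 0 ∧ ∀ v : U1 C, pr (cpr c1 ls) (v : Fn r ℚ) = c * eps (opX C (ls.map dz) v) := by
  induction ls with
  | nil => exact ⟨1, one_ne_zero, fun v => by rw [cpr_nil, pr_single]; simp [opX, eps]⟩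
  | cons l ls ih =>
    obtain ⟨c, hc, h⟩ := ih fun a ha => hg a (by simp [ha])
    obtain ⟨hl, hn⟩ := hg l (by simp)
    obtain ⟨X, hX, hX0, hr⟩ := H.x l hl hn
    have hR := H.m3 l hl hn
    obtain ⟨d, hd⟩ := CL.dim_le (ZL C) (x0_mem hR) hX (x0_ne hR)
    have hd0 : d ≠ 0 := by rintro rfl; exact hX0 (by rw [hd, zero_smul])
    refine ⟨c * d, mul_ne_zero hc hd0, fun v => ?_⟩
    rw [cpr_cons, pr_cm, ← hr.2, h, hd, LinearMap.smul_apply, map_smul, map_smul, List.map_cons, opX,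
      Module.End.mul_apply, smul_eq_mul, mul_assoc]

lemma PBW_ind2 {ι : Type*} (s : Finset ι) (φ : ι → List (Fin r → ℤ)) (hs : ∀ i ∈ s, ∀ γ ∈ φ i, (ZL C).Rt γ)
    (hP : ∀ i ∈ s, ∀ j ∈ s, (φ i).Perm (φ j) → i = j) (c : ι → ℚ)
    (h : ∀ v : U1 C, ∑ i ∈ s, c i * eps (opX C (φ i) v) = 0) : ∀ i ∈ s, c i = 0 := by
  classical
  intro i0 hi0
  haveI : Nonempty ι := ⟨i0⟩
  have hinj : Set.InjOn φ s := fun i hi j hj hij => hP i hi j hj (by rw [hij])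
  have hinv : ∀ i ∈ s, Function.invFunOn φ s (φ i) = i := fun i hi => hinj.leftInvOn_invFunOn hi
  have := PBW_ind (C := C) (s.image φ) ?_ ?_ (fun gs => c (Function.invFunOn φ s gs)) ?_ (φ i0) (Finset.mem_image_of_mem _ hi0)
  · rwa [hinv i0 hi0] at this
  · intro gs hgs
    obtain ⟨i, hi, rfl⟩ := Finset.mem_image.1 hgs
    exact hs i hi
  · intro gs hgs gs' hgs' hp
    obtain ⟨i, hi, rfl⟩ := Finset.mem_image.1 hgs
    obtain ⟨j, hj, rfl⟩ := Finset.mem_image.1 hgs'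
    rw [hP i hi j hj hp]
  · intro v
    rw [Finset.sum_image hinj, ← h v]
    apply Finset.sum_congr rfl
    intro i hi
    rw [hinv i hi]

lemma HH.fac_inj (H : HH C n) {ls ms : List (Word r)} (hls : SL ls) (hms : SL ms)
    (hl : ∀ a ∈ ls, GdL C a ∧ a.length < n) (hm : ∀ a ∈ ms, GdL C a ∧ a.length < n)
    (hp : (ls.map dz).Perm (ms.map dz)) : ls = ms := by
  classical
  let σ : (Fin r → ℤ) → Word r := fun γ => if h : ∃ a, (GdL C a ∧ a.length < n) ∧ dz a = γ then h.choose else []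
  have hσ : ∀ a, GdL C a ∧ a.length < n → σ (dz a) = a := by
    intro a ha
    have h : ∃ b, (GdL C b ∧ b.length < n) ∧ dz b = dz a := ⟨a, ha, rfl⟩
    have h1 : σ (dz a) = h.choose := dif_pos h
    rw [h1]
    exact H.m1 _ _ h.choose_spec.1.1 ha.1 h.choose_spec.1.2 ((dz_eq_deg _ _).1 h.choose_spec.2)
  have h1 := hp.map σ
  rw [List.map_map, List.map_map] at h1
  have h2 : ∀ ks : List (Word r), (∀ a ∈ ks, GdL C a ∧ a.length < n) → ks.map (σ ∘ dz) = ks := by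
    intro ks hk
    conv_rhs => rw [← List.map_id ks]
    exact List.map_congr_left fun a ha => hσ a (hk a ha)
  rw [h2 ls hl, h2 ms hm] at h1
  exact List.Perm.eq_of_pairwise (fun a b _ _ h h' => le_antisymm h' h) hls.2 hms.2 h1

lemma not_lyndon_of {ls : List (Word r)} (h : SL ls) (h2 : 2 ≤ ls.length) : ¬ IsLyndon ls.flatten := by
  intro hl
  have := fac_lyndon hl
  rw [fac_eq h] at this
  rw [this] at h2; simp at h2

lemma fac_length {g : Word r} (hg : ¬ IsLyndon g) (hne : g ≠ []) : 2 ≤ (fac g).length := by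
  rcases h : fac g with _ | ⟨a, _ | ⟨b, l⟩⟩
  · have := fac_flatten g; rw [h] at this; exact absurd this.symm hne
  · have := fac_flatten g; rw [h] at this; simp at this
    exact absurd ((fac_SL g).1 a (by rw [h]; simp)) (this ▸ hg)
  · simp

lemma HH.Z (H : HH C n) {w0 : Word r} (h0 : w0 ≠ []) (hn : w0.length ≤ n) {f : Fr r K} {f' : Fr r ℚ} (hf : RedF f f')
    {X : LL C} (hX : X ∈ (ZL C).N (dz w0)) (hX0 : X ≠ 0) (hr : RepF X f' (dz w0)) :
    ∃ u ∈ UU (tq C.p), HomF u (deg w0) ∧ (∀ g, Good (tq C.p) g → deg g = deg w0 → ¬ IsLyndon g → pr (bb C g) u = 0)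
      ∧ pr f u ≠ 0 := by
  classical
  by_contra hcon
  push Not at hcon
  have hR : (ZL C).Rt (dz w0) := ⟨X, hX, hX0⟩
  let E : Submodule K (Fn r K) := 
    { carrier := {u | u ∈ UU (tq C.p) ∧ HomF u (deg w0)}
      add_mem' := fun ha hb => ⟨add_mem ha.1 hb.1, ha.2.add hb.2⟩
      zero_mem' := ⟨zero_mem _, HomF.zero _⟩
      smul_mem' := fun c u hu => ⟨Submodule.smul_mem _ _ hu.1, hu.2.smul c⟩ }
  let ι := {g : Word r // Good (tq C.p) g ∧ deg g = deg w0 ∧ ¬ IsLyndon g}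
  haveI : Finite ι := ((finite_deg (deg w0)).subset (fun g (hg : Good (tq C.p) g ∧ deg g = deg w0 ∧ ¬ IsLyndon g) => hg.2.1)).to_subtype
  haveI : Fintype ι := Fintype.ofFinite ι
  have hspan := mem_span_of_iInf_ker_le_ker (L := fun g : ι => (pr (bb C g.1)).comp E.subtype)
    (K := (pr f).comp E.subtype) (by
      intro u hu
      rw [Submodule.mem_iInf] at hu
      exact hcon u u.2.1 u.2.2 fun g h1 h2 h3 => hu ⟨g, h1, h2, h3⟩)
  obtain ⟨c, hc⟩ := (Submodule.mem_span_range_iff_exists_fun K).1 hspan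
  let x : Option ι → K := fun o => o.elim (-1) c
  let F : Option ι → Fr r K := fun o => o.elim f fun g => bb C g.1
  let F' : Option ι → Fr r ℚ := fun o => o.elim f' fun g => cpr c1 (fac g.1)
  let φ : Option ι → List (Fin r → ℤ) := fun o => o.elim [dz w0] fun g => (fac g.1).map dz
  have hfac : ∀ g : ι, ∀ a ∈ fac g.1, GdL C a ∧ a.length < n := fun g a ha =>
    ⟨fac_good g.2.1 ha, lt_of_lt_of_le (mem_fac_lt g.2.2.2 ha) (by rw [length_of_deg g.2.2.1]; exact hn)⟩
  have hgne : ∀ g : ι, g.1 ≠ [] := fun g h => h0 (List.eq_nil_of_length_eq_zero (by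
    rw [← length_of_deg g.2.2.1, h]; rfl))
  have hFF : ∀ o, RedF (F o) (F' o) := by
    rintro (_ | g)
    · exact hf
    · exact Red.cpr (cq_sp C.p) (fac_SL g.1).1
  have hF'd : ∀ o w, F' o w ≠ 0 → deg w = deg w0 := by
    rintro (_ | g) w hw
    · exact (dz_eq_deg _ _).1 (hr.1 w hw)
    · have := (cpr_tri c1 (fac_SL g.1).1).2 w hw
      rw [fac_flatten] at this
      rw [this.2, g.2.2.1]
  have hsum : ∀ u ∈ UU (tq C.p), HomF u (deg w0) → ∑ o, x o * pr (F o) u = 0 := by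
    intro u hu hν
    have h1 := LinearMap.congr_fun hc ⟨u, hu, hν⟩
    simp only [LinearMap.sum_apply, LinearMap.smul_apply, LinearMap.comp_apply, Submodule.subtype_apply, smul_eq_mul] at h1
    rw [Fintype.sum_option]
    show -1 * pr f u + ∑ g, c g * pr (bb C g.1) u = 0
    rw [h1]; ring
  obtain ⟨i0, _, hi0, hsc⟩ := Sp.scale Finset.univ x ⟨none, Finset.mem_univ _, by simp [x]⟩
  have hsc' : ∀ j, ∃ c, Sp (x j / x i0) c := fun j => hsc j (Finset.mem_univ j)
  choose b hb using hsc'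
  have hcl : ∀ o, ∃ d : ℚ, d ≠ 0 ∧ ∀ v : U1 C, pr (F' o) (v : Fn r ℚ) = d * eps (opX C (φ o) v) := by
    rintro (_ | g)
    · obtain ⟨d, hd⟩ := CL.dim_le (ZL C) (x0_mem hR) hX (x0_ne hR)
      have hd0 : d ≠ 0 := by rintro rfl; exact hX0 (by rw [hd, zero_smul])
      refine ⟨d, hd0, fun v => ?_⟩
      show pr f' (v : Fn r ℚ) = d * eps (opX C [dz w0] v)
      rw [← hr.eps, hd, opX, opX, one_mul]; rfl
    · exact H.classical (hfac g)
  choose d hd0 hd using hcl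
  have hrel : ∀ v : U1 C, ∑ o, (b o * d o) * eps (opX C (φ o) v) = 0 := by
    intro v
    obtain ⟨u, hu, huv⟩ := v.2
    have h1 := hsum (comp (deg w0) u) (UU_comp _ _ hu) (HomF.comp _ _)
    have h2 : Sp (∑ o, (x o / x i0) * pr (F o) (comp (deg w0) u)) (∑ o, b o * pr (F' o) (comp (deg w0) (v : Fn r ℚ))) :=
      Sp.sum _ fun o _ => (hb o).mul ((hFF o).pr (huv.comp _))
    have h3 : ∑ o, (x o / x i0) * pr (F o) (comp (deg w0) u) = 0 := by
      have : ∀ o, (x o / x i0) * pr (F o) (comp (deg w0) u) = (x i0)⁻¹ * (x o * pr (F o) (comp (deg w0) u)) := fun o => by ring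
      simp only [this]
      rw [← Finset.mul_sum, h1, mul_zero]
    rw [h3] at h2
    rw [← Sp.unique h2 Sp.zero]
    apply Finset.sum_congr rfl
    intro o _
    rw [mul_assoc, ← hd]
    congr 1
    apply pr_congr
    intro w hw
    rw [comp_apply, if_pos (hF'd o w hw)]
  have hz := PBW_ind2 (C := C) Finset.univ φ ?_ ?_ _ hrel i0 (Finset.mem_univ _)
  · have : b i0 = 1 := by
      have := hb i0
      rw [div_self hi0] at this
      exact Sp.unique this Sp.one
    rw [this, one_mul] at hz
    exact hd0 i0 hz
  · rintro (_ | g) _ γ hγ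
    · have : γ = dz w0 := by simpa [φ] using hγ
      rw [this]; exact hR
    · obtain ⟨a, ha, rfl⟩ := List.mem_map.1 hγ
      exact H.m3 a (hfac g a ha).1 (hfac g a ha).2
  · have hlen : ∀ g : ι, 2 ≤ (φ (some g)).length := fun g => by
      show 2 ≤ ((fac g.1).map dz).length
      rw [List.length_map]; exact fac_length g.2.2.2 (hgne g)
    rintro (_ | g) _ (_ | g') _ hp
    · rfl
    · have := hp.length_eq; have h2 := hlen g'; rw [← this] at h2; simp [φ] at h2
    · have := hp.length_eq; have h2 := hlen g; rw [this] at h2; simp [φ] at h2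
    · have h3 := H.fac_inj (fac_SL g.1) (fac_SL g'.1) (hfac g) (hfac g') hp
      congr 1
      apply Subtype.ext
      rw [← fac_flatten g.1, h3, fac_flatten]
end
end

section
set_option linter.all false
/-! ### Part 14 : multiplicity one at the next level -/

section
variable (C : CartanData r)
def fl (β : Fin r → ℤ) : Fr r ℚ :=
  open Classical in if h : (ZL C).Rt β then (RepF_N (x0_mem h)).choose else 0
def flq (β : Fin r → ℤ) : Fr r K := Finsupp.mapRange (RatFunc.C : ℚ →+* K) (map_zero _) (fl C β)
variable {C} {n : ℕ}
lemma fl_rep {β} (h : (ZL C).Rt β) : RepF (x0 C β) (fl C β) β := by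
  rw [fl, dif_pos h]; exact (RepF_N (x0_mem h)).choose_spec
lemma flq_red (β) : RedF (flq C β) (fl C β) := RedF.lift _

lemma dz_flatten (ls : List (Word r)) : dz ls.flatten = (ls.map dz).sum := by
  induction ls with
  | nil => simp [dz_nil]
  | cons a ls ih => rw [List.flatten_cons, dz_append, ih, List.map_cons, List.sum_cons]

lemma roots_words {gs : List (Fin r → ℤ)} (h : ∀ γ ∈ gs, (ZL C).Rt γ) :
    ∃ ws : List (Word r), (∀ a ∈ ws, a ≠ []) ∧ ws.map dz = gs := by
  induction gs with
  | nil => exact ⟨[], by simp, rfl⟩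
  | cons γ gs ih =>
    obtain ⟨ws, h1, h2⟩ := ih fun γ hγ => h γ (by simp [hγ])
    obtain ⟨w, hw, hw2⟩ := CL.Rt.word (ZL C) (h γ (by simp))
    refine ⟨w :: ws, ?_, by rw [List.map_cons, hw2, h2]⟩
    intro a ha
    rcases List.mem_cons.1 ha with rfl | ha
    exacts [hw, h1 a ha]

lemma mem_length_lt {ls : List (Word r)} (hne : ∀ a ∈ ls, a ≠ []) (h2 : 2 ≤ ls.length) {a : Word r} (ha : a ∈ ls) :
    a.length < ls.flatten.length := by
  obtain ⟨x, y, rfl⟩ := List.append_of_mem ha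
  simp at h2
  have : ∃ b ∈ x ++ y, b.length ≠ 0 := by
    rcases x with _ | ⟨b, x⟩
    · rcases y with _ | ⟨b, y⟩
      · simp at h2
      · exact ⟨b, by simp, fun h => hne b (by simp) (List.eq_nil_of_length_eq_zero h)⟩
    · exact ⟨b, by simp, fun h => hne b (by simp) (List.eq_nil_of_length_eq_zero h)⟩
  obtain ⟨b, hb, hb0⟩ := this
  have h3 := mem_length hb
  simp only [List.flatten_append, List.flatten_cons, List.length_append] at h3 ⊢
  omega

lemma HH.words_gd (H : HH C n) {ws : List (Word r)} (h : ∀ a ∈ ws, a ≠ [] ∧ a.length < n ∧ (ZL C).Rt (dz a)) :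
    ∃ ls : List (Word r), (∀ a ∈ ls, GdL C a ∧ a.length < n) ∧ ls.map dz = ws.map dz := by
  induction ws with
  | nil => exact ⟨[], by simp, rfl⟩
  | cons w ws ih =>
    obtain ⟨ls, h1, h2⟩ := ih fun γ hγ => h γ (by simp [hγ])
    obtain ⟨hw1, hw2, hw3⟩ := h w (by simp)
    obtain ⟨l, hl, hd⟩ := H.m2 w hw1 hw2 hw3
    refine ⟨l :: ls, ?_, by rw [List.map_cons, List.map_cons, h2, (dz_eq_deg _ _).2 hd]⟩
    intro a ha
    rcases List.mem_cons.1 ha with rfl | ha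
    exacts [⟨hl, by rw [length_of_deg hd]; exact hw2⟩, h1 a ha]

lemma HH.use1 (H : HH C n) {w0 : Word r} (h0 : w0 ≠ []) (hn : w0.length ≤ n) {u : Fn r K} (hu : u ∈ UU (tq C.p))
    (hν : HomF u (deg w0)) (hk : ∀ g, Good (tq C.p) g → deg g = deg w0 → ¬ IsLyndon g → pr (bb C g) u = 0)
    (hf : (ZL C).Rt (dz w0) → pr (flq C (dz w0)) u = 0) : u = 0 := by
  classical
  by_contra hne
  obtain ⟨s, v, hs, hsv, hv0⟩ := Red.scale hν hne
  let V : U1 C := ⟨v, s • u, Submodule.smul_mem _ _ hu, hsv⟩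
  apply hv0
  funext w
  show v w = 0
  by_cases hw : deg w = deg w0
  swap
  · have h1 := hsv w
    have h2 : u w = 0 := by by_contra h; exact hw (hν w h)
    rw [Pi.smul_apply, h2, smul_zero] at h1
    exact Sp.unique h1 Sp.zero
  refine PBW_span (β := dz w0) V ?_ w ((dz_eq_deg _ _).2 hw)
  intro gs hgs hsum
  obtain ⟨ws, hws, rfl⟩ := roots_words hgs
  rcases ws with _ | ⟨a, _ | ⟨b, ws⟩⟩
  · exact absurd (dz_eq_zero.1 (by simpa using hsum.symm)) h0
  · have ha : dz a = dz w0 := by simpa using hsum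
    refine ⟨_, List.Perm.refl _, ?_⟩
    have hR : (ZL C).Rt (dz w0) := hgs _ (by simp [ha])
    have h1 := (flq_red (C := C) (dz w0)).pr hsv
    rw [map_smul, hf hR, smul_zero] at h1
    have h2 := (fl_rep hR).eps V
    rw [List.map_cons, List.map_nil, ha, opX, opX, one_mul, h2]
    exact Sp.unique h1 Sp.zero
  · rw [← dz_flatten] at hsum
    have hd := (dz_eq_deg _ _).1 hsum
    obtain ⟨ls, hls, hm⟩ := H.words_gd (ws := a :: b :: ws) fun c hc =>
      ⟨hws c hc, lt_of_lt_of_le (mem_length_lt hws (by simp) hc) (by rw [length_of_deg hd]; exact hn),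
        hgs _ (List.mem_map_of_mem hc)⟩
    have hp := List.perm_insertionSort (fun a b : Word r => b ≤ a) ls
    set ms := List.insertionSort (fun a b : Word r => b ≤ a) ls with hms
    have hmm : ∀ a ∈ ms, GdL C a ∧ a.length < n := fun a ha => hls a (hp.mem_iff.1 ha)
    have hSL : SL ms := ⟨fun a ha => (hmm a ha).1.2, List.pairwise_insertionSort _ _⟩
    have hlen : 2 ≤ ms.length := by
      rw [hp.length_eq]
      have := congrArg List.length hm
      simp at this; omega
    obtain ⟨c, hc, hcv⟩ := H.classical hmm
    refine ⟨ms.map dz, hm ▸ hp.map dz, ?_⟩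
    have hdeg : deg ms.flatten = deg w0 := by
      rw [← dz_eq_deg, dz_flatten, (hp.map dz).sum_eq, hm, ← dz_flatten]; exact hsum
    have h1 := hk _ (H.mkgood hSL hmm) hdeg (not_lyndon_of hSL hlen)
    rw [bb_flat hSL] at h1
    have h2 := RedF.pr (Red.cpr (cq_sp C.p) hSL.1) hsv
    rw [map_smul, h1, smul_zero] at h2
    have h3 := hcv V
    have h4 : pr (cpr c1 ms) (V : Fn r ℚ) = 0 := Sp.unique h2 Sp.zero
    rw [h4] at h3
    exact (mul_eq_zero.1 h3.symm).resolve_left hc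

/-- dual functionals to the good words -/
lemma dual_good {h : Word r} (hg : Good (tq C.p) h) : ∃ u ∈ UU (tq C.p), HomF u (deg h) ∧ pr (bb C h) u = 1 ∧
    ∀ g, Good (tq C.p) g → deg g = deg h → g ≠ h → pr (bb C g) u = 0 := by
  classical
  by_contra hcon
  let S : Set (Word r) := {k | deg k = deg h ∧ Good (tq C.p) k ∧ ¬ ∃ u ∈ UU (tq C.p), HomF u (deg k) ∧ pr (bb C k) u = 1 ∧
    ∀ g, Good (tq C.p) g → deg g = deg k → g ≠ k → pr (bb C g) u = 0}
  have hS : S.Finite := (finite_deg (deg h)).subset fun g hg => hg.1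
  obtain ⟨k, hk, hmin⟩ := Set.exists_min_image S id hS ⟨h, rfl, hg, hcon⟩
  obtain ⟨hd, hgk, hno⟩ := hk
  apply hno
  obtain ⟨u, hu, hν, hne, hmax⟩ := hgk
  have hTf : {g | deg g = deg k ∧ Good (tq C.p) g ∧ g < k}.Finite := (finite_deg (deg k)).subset fun g hg => hg.1
  let T : Finset (Word r) := hTf.toFinset
  have hT : ∀ g, g ∈ T ↔ deg g = deg k ∧ Good (tq C.p) g ∧ g < k := fun g => by simp [T]
  have hex : ∀ g : Word r, ∃ u : Fn r K, g ∈ T → u ∈ UU (tq C.p) ∧ HomF u (deg g) ∧ pr (bb C g) u = 1 ∧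
      ∀ g', Good (tq C.p) g' → deg g' = deg g → g' ≠ g → pr (bb C g') u = 0 := by
    intro g
    by_cases hgT : g ∈ T
    · obtain ⟨h1, h2, h3⟩ := (hT g).1 hgT
      by_contra hc
      push Not at hc
      have : g ∈ S := ⟨h1.trans hd, h2, by
        rintro ⟨u, a, b, c, d⟩
        obtain ⟨_, h5⟩ := hc u
        obtain ⟨g', a', b', c', d'⟩ := h5 a b c
        exact d' (d g' a' b' c')⟩
      exact absurd (hmin g this) (not_le.2 h3)
    · exact ⟨0, fun h => absurd h hgT⟩
  choose D hD using hex
  have hkk : pr (bb C k) u = u k := (bb_tri k).pr hmax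
  refine ⟨(u k)⁻¹ • (u - ∑ g ∈ T, pr (bb C g) u • D g), ?_, ?_, ?_, ?_⟩
  · exact Submodule.smul_mem _ _ (sub_mem hu (Submodule.sum_mem _ fun g hg => Submodule.smul_mem _ _ (hD g hg).1))
  · refine HomF.smul _ (hν.sub ?_)
    intro w hw
    rw [Finset.sum_apply] at hw
    obtain ⟨g, hg, hgw⟩ := Finset.exists_ne_zero_of_sum_ne_zero hw
    rw [← ((hT g).1 hg).1]
    exact (hD g hg).2.1 w fun h => hgw (by rw [Pi.smul_apply, h, smul_zero])
  · rw [map_smul, map_sub, map_sum, Finset.sum_eq_zero, sub_zero, hkk, smul_eq_mul, inv_mul_cancel₀ hne]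
    intro g hg
    have h1 := (hT g).1 hg
    rw [map_smul, (hD g hg).2.2.2 k ⟨u, hu, hν, hne, hmax⟩ h1.1.symm (ne_of_gt h1.2.2), smul_zero]
  · intro g hg hgd hgk
    rw [map_smul, map_sub, map_sum]
    by_cases hgT : g ∈ T
    · rw [Finset.sum_eq_single_of_mem g hgT, map_smul, (hD g hgT).2.2.1, smul_eq_mul, smul_eq_mul, mul_one, sub_self, mul_zero]
      intro b hb hbg
      have h1 := (hT b).1 hb
      rw [map_smul, (hD b hb).2.2.2 g hg (hgd.trans h1.1.symm) (Ne.symm hbg), smul_zero]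
    · have hlt : k < g := lt_of_le_of_ne (not_lt.1 fun h => hgT ((hT g).2 ⟨hgd, hg, h⟩)) (Ne.symm hgk)
      rw [Finset.sum_eq_zero, sub_zero, (bb_tri g).pr_zero, smul_zero]
      · intro w hw; exact lt_of_le_of_lt (hmax w hw) hlt
      · intro b hb
        have h1 := (hT b).1 hb
        rw [map_smul, (hD b hb).2.2.2 g hg (hgd.trans h1.1.symm) (fun h => hgT (h ▸ hb)), smul_zero]

lemma GdL.ne {l : Word r} (h : GdL C l) : l ≠ [] := h.2.1

lemma HH.M1 (H : HH C n) {l l' : Word r} (hl : GdL C l) (hl' : GdL C l') (hn : l.length ≤ n) (hd : deg l = deg l') : l = l' := by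
  by_contra hne
  obtain ⟨u, hu, hν, h1, hz⟩ := dual_good hl.1
  obtain ⟨u', hu', hν', h1', hz'⟩ := dual_good hl'.1
  have h0 := H.use1 hl.ne hn (u := pr (flq C (dz l)) u' • u - pr (flq C (dz l)) u • u')
    (sub_mem (Submodule.smul_mem _ _ hu) (Submodule.smul_mem _ _ hu')) ((hν.smul _).sub ((hd ▸ hν').smul _))
    (fun g hg hgd hgl => by
      rw [map_sub, map_smul, map_smul, hz g hg hgd (fun h => hgl (h ▸ hl.2)), hz' g hg (hgd.trans hd) (fun h => hgl (h ▸ hl'.2))]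
      simp)
    (fun hR => by rw [map_sub, map_smul, map_smul]; simp only [smul_eq_mul]; ring)
  have h2 := congrArg (pr (bb C l)) h0
  rw [map_sub, map_smul, map_smul, h1, hz' l hl.1 hd hne, map_zero, smul_zero, sub_zero, smul_eq_mul, mul_one] at h2
  have h3 := H.use1 hl.ne hn (u := u') hu' (hd ▸ hν')
    (fun g hg hgd hgl => hz' g hg (hgd.trans hd) (fun h => hgl (h ▸ hl'.2))) (fun _ => h2)
  rw [h3, map_zero] at h1'
  exact zero_ne_one h1'

lemma HH.M3 (H : HH C n) {l : Word r} (hl : GdL C l) (hn : l.length ≤ n) : (ZL C).Rt (dz l) := by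
  by_contra hR
  obtain ⟨u, hu, hν, h1, hz⟩ := dual_good hl.1
  have h3 := H.use1 hl.ne hn hu hν
    (fun g hg hgd hgl => hz g hg hgd (fun h => hgl (h ▸ hl.2))) (fun h => absurd h hR)
  rw [h3, map_zero] at h1
  exact zero_ne_one h1

lemma HH.M2 (H : HH C n) {w : Word r} (h0 : w ≠ []) (hn : w.length ≤ n) (hR : (ZL C).Rt (dz w)) :
    ∃ l, GdL C l ∧ deg l = deg w := by
  obtain ⟨u, hu, hν, hk, hne⟩ := H.Z h0 hn (flq_red (dz w)) (x0_mem hR) (x0_ne hR) (fl_rep hR)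
  have hu0 : u ≠ 0 := by rintro rfl; simp at hne
  obtain ⟨w1, hw⟩ := Function.ne_iff.1 hu0
  obtain ⟨g, hg, hd, _, _, _, hp⟩ := exists_good hu hν hw
  exact ⟨g, ⟨hg, by by_contra h; exact hp (hk g hg hd h)⟩, hd⟩

end
end

section
set_option linter.all false
/-! ### Part 15 : convexity at the next level -/

section
variable {C : CartanData r} {n : ℕ}

lemma HH.rep2 (H : HH C n) {l1 l2 : Word r} (h1 : GdL C l1) (h2 : GdL C l2) (hn1 : l1.length < n) (hn2 : l2.length < n)
    (hR : (ZL C).Rt (dz (l1 ++ l2))) : ∃ X ∈ (ZL C).N (dz (l1 ++ l2)), X ≠ 0 ∧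
      RepF X (cm (brk c1 l1) (brk c1 l2) - cm (brk c1 l2) (brk c1 l1)) (dz (l1 ++ l2)) := by
  obtain ⟨X1, hX1, hX10, hr1⟩ := H.x l1 h1 hn1
  obtain ⟨X2, hX2, hX20, hr2⟩ := H.x l2 h2 hn2
  have he : dz (l1 ++ l2) = dz l2 + dz l1 := by rw [dz_append, add_comm]
  rw [he] at hR ⊢
  exact ⟨⁅X2, X1⁆, CL.N_lie _ hX2 hX1, CL.lie_ne_zero _ hX2 hX1 hX20 hX10 hR, hr2.lie hr1⟩

lemma HH.XX (H : HH C n) {l : Word r} (hl : GdL C l) (hn : l.length ≤ n) :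
    ∃ X ∈ (ZL C).N (dz l), X ≠ 0 ∧ RepF X (brk c1 l) (dz l) := by
  have hR := H.M3 hl hn
  have key : ∀ l, IsLyndon l → GdL C l → l.length ≤ n → (ZL C).Rt (dz l) → 
      ∃ X ∈ (ZL C).N (dz l), X ≠ 0 ∧ RepF X (brk c1 l) (dz l) := by
    apply lyndon_rec
    · intro i hi _ hR
      rw [dz_single, brk_letter]
      exact ⟨_, CL.e_mem _ i, (ZL C).e0 i, RepF_e i⟩
    · intro l1 l2 h1 h2 h12 hlt hb _ _ hl hn hR
      have hn1 := List.length_pos_of_ne_nil h1.1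
      have hn2 := List.length_pos_of_ne_nil h2.1
      rw [List.length_append] at hn
      obtain ⟨X, a, b, c⟩ := H.rep2 (C := C) ⟨Good.left _ hl.1, h1⟩ ⟨Good.right _ hl.1, h2⟩ (by omega) (by omega) hR
      refine ⟨X, a, b, ?_⟩
      rw [hb]
      rwa [one_smul]
  exact key l hl.2 hl hn hR

lemma HH.conv (H : HH C n) {l1 l2 l : Word r} (h1 : GdL C l1) (h2 : GdL C l2) (hl : GdL C l) (hlt : l1 < l2)
    (hd : deg l = deg (l1 ++ l2)) (hn : l.length ≤ n) : l1 < l ∧ l < l2 := by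
  have hp1 := List.length_pos_of_ne_nil h1.2.1
  have hp2 := List.length_pos_of_ne_nil h2.2.1
  have hlen : l.length = l1.length + l2.length := by rw [length_of_deg hd, List.length_append]
  have hn1 : l1.length < n := by omega
  have hn2 : l2.length < n := by omega
  have hR : (ZL C).Rt (dz (l1 ++ l2)) := (dz_eq_deg _ _).2 hd ▸ H.M3 hl hn
  obtain ⟨X, hX, hX0, hr⟩ := H.rep2 h1 h2 hn1 hn2 hR
  set f : Fr r K := cm (brk (cq C.p) l1) (brk (cq C.p) l2) - cq C.p l1 l2 • cm (brk (cq C.p) l2) (brk (cq C.p) l1) with hfdef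
  have hred : RedF f (cm (brk c1 l1) (brk c1 l2) - cm (brk c1 l2) (brk c1 l1)) := by
    have ha : RedF (brk (cq C.p) l1) (brk c1 l1) := Red.brk (cq_sp C.p) h1.2
    have hb : RedF (brk (cq C.p) l2) (brk c1 l2) := Red.brk (cq_sp C.p) h2.2
    have := (ha.cm hb).sub (RedF.smul (cq_sp C.p l1 l2) (hb.cm ha))
    rwa [one_smul] at this
  obtain ⟨u, hu, hν, hk, hne⟩ := H.Z (w0 := l1 ++ l2) (by simp [h1.2.1]) (by simp; omega) hred hX hX0 hr
  constructor
  · by_contra hc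
    have hll1 : l < l1 := lt_of_le_of_ne (not_lt.1 hc) (by rintro rfl; omega)
    have hw : ∃ w, f w ≠ 0 ∧ u w ≠ 0 := by
      by_contra hcc
      push Not at hcc
      apply hne
      rw [pr_def, Finsupp.sum]
      exact Finset.sum_eq_zero fun x hx => by rw [hcc x (Finsupp.mem_support_iff.1 hx), mul_zero]
    obtain ⟨w, hfw, huw⟩ := hw
    have hlw : l < w := by
      by_cases h3 : cm (brk (cq C.p) l1) (brk (cq C.p) l2) w = 0
      · have h4 : cm (brk (cq C.p) l2) (brk (cq C.p) l1) w ≠ 0 := by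
          intro h4; apply hfw; rw [hfdef, Finsupp.sub_apply, Finsupp.smul_apply, h3, h4]; simp
        exact lt_of_lt_of_le (lt_of_lt_of_le (hll1.trans hlt) (le_append_right _ _))
          (((brk_tri _ h2.2).cm (brk_tri _ h1.2)).2 w h4).1
      · exact lt_of_lt_of_le (lt_of_lt_of_le hll1 (le_append_right _ _))
          (((brk_tri _ h1.2).cm (brk_tri _ h2.2)).2 w h3).1
    obtain ⟨g, hg, hgd, hwg, _, _, hpg⟩ := exists_good hu hν huw
    have hgl : IsLyndon g := by by_contra h; exact hpg (hk g hg hgd h)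
    have := H.M1 hl ⟨hg, hgl⟩ hn (hd.trans hgd.symm)
    rw [this] at hlw
    exact absurd hwg (not_le.2 hlw)
  · by_contra hc
    have hll2 : l2 < l := lt_of_le_of_ne (not_lt.1 hc) (by rintro rfl; omega)
    have hXf : XiF (tq C.p) f = sh (tq C.p) (rr C l1) (rr C l2) - cq C.p l1 l2 • sh (tq C.p) (rr C l2) (rr C l1) := by
      rw [hfdef, map_sub, map_smul, XiF_cm, XiF_cm, ← bb_lyndon h1.2, ← bb_lyndon h2.2]; rfl
    have hw1 : ∀ w, rr C l1 w ≠ 0 → w < l := fun w hw => lt_of_le_of_lt ((H.px l1 h1 hn1).2.2 w hw) (hlt.trans hll2)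
    have hw2 : ∀ w, rr C l2 w ≠ 0 → w < l := fun w hw => lt_of_le_of_lt ((H.px l2 h2 hn2).2.2 w hw) hll2
    have hs1 := sh_lt (tq C.p) hl.2 hw1 hw2
    have hs2 := sh_lt (tq C.p) hl.2 hw2 hw1
    obtain ⟨f', hf'⟩ := hu
    apply hne
    rw [← hf', pr_XiF]
    refine elim (ν := deg (l1 ++ l2)) (P := fun w => w < l) (fun w g h h' => lt_of_le_of_lt h h') ?_ _ ?_ (XiF_mem _ _) ?_ ?_
    · intro g hg hgd hgl
      refine H.mxn hg (by rw [length_of_deg (hgd.trans hd.symm)]; exact hn) fun h => ?_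
      exact absurd (H.M1 hl ⟨hg, h⟩ hn (hd.trans hgd.symm)) (ne_of_gt hgl)
    · intro g hg hgd hgl
      rw [rr, pr_XiF, hf']
      refine hk g hg hgd fun h => ?_
      exact absurd (H.M1 hl ⟨hg, h⟩ hn (hd.trans hgd.symm)) (ne_of_gt hgl)
    · rw [hXf, deg_append]
      refine ((rr_hom l1).sh _ (rr_hom l2)).sub (HomF.smul _ ?_)
      rw [add_comm]
      exact (rr_hom l2).sh _ (rr_hom l1)
    · intro w hw
      rw [hXf] at hw
      by_cases h3 : sh (tq C.p) (rr C l1) (rr C l2) w = 0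
      · apply hs2; intro h4; apply hw; rw [Pi.sub_apply, Pi.smul_apply, h3, h4]; simp
      · exact hs1 w h3

lemma deg_flatten_perm {ls ms : List (Word r)} (h : ls.Perm ms) : deg ls.flatten = deg ms.flatten := by
  rw [← dz_eq_deg, dz_flatten, dz_flatten]; exact (h.map dz).sum_eq

lemma ip_list (β : Fin r → ℤ) (ls : List (Fin r → ℤ)) (h : 0 < ip C β ls.sum) : ∃ γ ∈ ls, 0 < ip C β γ := by
  induction ls with
  | nil => rw [List.sum_nil, ip_symm, ip_zero_left] at h; exact absurd h (lt_irrefl _)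
  | cons γ ls ih =>
    rw [List.sum_cons, ip_add_right] at h
    by_cases h1 : 0 < ip C β γ
    · exact ⟨γ, by simp, h1⟩
    · obtain ⟨δ, h2, h3⟩ := ih (by linarith)
      exact ⟨δ, by simp [h2], h3⟩

lemma HH.TS (H : HH C n) {l : Word r} (hl : GdL C l) (hn : l.length ≤ n) {ls : List (Word r)} (hls : ∀ a ∈ ls, GdL C a)
    (hd : deg ls.flatten = deg l) : (∃ a ∈ ls, l ≤ a) ∧ (∃ b ∈ ls, b ≤ l) := by
  classical
  have hR := H.M3 hl hn
  have hs : (ls.map dz).sum = dz l := by rw [← dz_flatten]; exact (dz_eq_deg _ _).2 hd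
  obtain ⟨γ, hγ, hpos⟩ := ip_list (C := C) (dz l) (ls.map dz) (by rw [hs]; exact ip_pos C (CL.Rt.ne0 _ hR))
  obtain ⟨g, hg, rfl⟩ := List.mem_map.1 hγ
  have hgl : g.length ≤ l.length := by rw [← length_of_deg hd]; exact mem_length hg
  by_cases he : dz l = dz g
  · have := H.M1 hl (hls g hg) hn ((dz_eq_deg _ _).1 he)
    exact ⟨⟨g, hg, this.le⟩, ⟨g, hg, this.ge⟩⟩
  have hRg := H.M3 (hls g hg) (hgl.trans hn)
  rcases CL.Rt.diff (ZL C) hR hRg hpos he with hRd | hRd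
  swap
  · exfalso
    obtain ⟨w, hw, hwd⟩ := CL.Rt.word (ZL C) hRd
    have h3 : dz g = dz (l ++ w) := by rw [dz_append, hwd]; abel
    have h4 := length_of_deg ((dz_eq_deg _ _).1 h3)
    have := List.length_pos_of_ne_nil hw
    rw [List.length_append] at h4; omega
  obtain ⟨w, hw, hwd⟩ := CL.Rt.word (ZL C) hRd
  have h3 : dz l = dz (w ++ g) := by rw [dz_append, hwd]; abel
  have h3' := (dz_eq_deg _ _).1 h3
  have h4 := length_of_deg h3'
  have hwp := List.length_pos_of_ne_nil hw
  have hgp := List.length_pos_of_ne_nil (hls g hg).2.1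
  rw [List.length_append] at h4
  obtain ⟨l', hl', hd'⟩ := H.m2 w hw (by omega) (hwd ▸ hRd)
  have hll := length_of_deg hd'
  have hdl : deg l = deg (l' ++ g) := by rw [h3', deg_append, deg_append, hd']
  have hperm := List.perm_cons_erase hg
  have hde : deg (ls.erase g).flatten = deg l' := by
    have := deg_flatten_perm hperm
    rw [hd, hdl, List.flatten_cons, deg_append, deg_append, add_comm] at this
    exact (add_left_cancel this).symm
  obtain ⟨⟨a, ha, hla⟩, ⟨b, hb, hbl⟩⟩ := H.ts l' hl' (by omega) (ls.erase g) (fun a ha => hls a (List.mem_of_mem_erase ha)) hde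
  have hne : l' ≠ g := by
    rintro rfl
    apply CL.Rt.not_two (ZL C) hRg
    have : dz l = 2 • dz l' := by rw [(dz_eq_deg _ _).2 hdl, dz_append, two_smul]
    rw [← this]; exact hR
  rcases lt_or_gt_of_ne hne with hlt | hlt
  · obtain ⟨c1, c2⟩ := H.conv hl' (hls g hg) hl hlt hdl hn
    exact ⟨⟨g, hg, c2.le⟩, ⟨b, List.mem_of_mem_erase hb, hbl.trans c1.le⟩⟩
  · obtain ⟨c1, c2⟩ := H.conv (hls g hg) hl' hl hlt (by rw [hdl, deg_append, deg_append, add_comm]) hn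
    exact ⟨⟨a, List.mem_of_mem_erase ha, c2.le.trans hla⟩, ⟨g, hg, c1.le⟩⟩

end
end

section
set_option linter.all false
/-! ### Part 16 : vanishing lemmas -/

section
variable {k : Type*} [CommRing k] (t : Fin r → Fin r → k)

lemma pr_sh_zero {fa f : Fr r k} {b : Fn r k} (hb : b ∈ UU t) (h : ∀ y, pr fa (Drw y (XiF t f)) = 0) :
    pr f (sh t (XiF t fa) b) = 0 := by
  obtain ⟨fb, rfl⟩ := hb
  rw [← XiF_cm, pr_XiF, pr_cm]
  have : Lop fa (XiF t f) = 0 := by funext y; exact h y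
  rw [this, map_zero]

lemma pr_Dlw {fa f : Fr r k} {x : Word r} (h : XiF t fa = Dlw x (XiF t f)) {w : Fn r k} (hw : w ∈ UU t) :
    pr fa w = pr f (sh t (Xi t x) w) := by
  obtain ⟨fw, rfl⟩ := hw
  have h1 : Xi t x = XiF t (Finsupp.single x 1) := by rw [XiF_single, one_smul]
  rw [pr_XiF, h, h1, ← XiF_cm, pr_XiF t f, pr_cm]
  congr 1
  funext y
  rw [Lop_single, one_mul]; rfl

/-- Left expansion, first version. -/
lemma Dlw_sh_left (φ : Fn r k →ₗ[k] k) (x : Word r) {u v : Fn r k} (hv : ∃ y, HomF v (deg y))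
    (h : ∀ x1 x2, x1 ≠ [] → φ (sh t (Dlw x1 u) (Dlw x2 v)) = 0) :
    φ (Dlw x (sh t u v)) = φ (sh t u (Dlw x v)) := by
  induction x generalizing u v with
  | nil => rfl
  | cons d x ih =>
    obtain ⟨y, hy⟩ := hv
    rw [Dlw_cons, Dl_sh, map_add, map_add, mulc_hom _ hy, map_smul, map_smul, map_smul]
    rw [ih (u := Dl d u) ⟨y, hy⟩ (fun x1 x2 hx => h (d :: x1) x2 (by simp))]
    rw [show sh t (Dl d u) (Dlw x v) = sh t (Dlw [d] u) (Dlw x v) from rfl, h [d] x (by simp), smul_zero, zero_add]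
    refine ih ?_ (fun x1 x2 hx => h x1 (d :: x2) hx)
    by_cases h0 : Dl d v = 0
    · exact ⟨[], by rw [h0]; exact HomF.zero _⟩
    · obtain ⟨w, hw⟩ := Function.ne_iff.1 h0
      have h1 := hy _ hw
      exact ⟨w, HomF_Dlw (x := [d]) (by rw [← deg_append]; exact h1 ▸ hy)⟩

lemma Dlw_sh_right (φ : Fn r k →ₗ[k] k) (x : Word r) {u v : Fn r k} {y : Word r} (hv : HomF u (deg y))
    (h : ∀ x1 x2, x2 ≠ [] → φ (sh t (Dlw x1 v) (Dlw x2 u)) = 0) :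
    φ (Dlw x (sh t v u)) = (x.map fun d => chi (t d) y).prod * φ (sh t (Dlw x v) u) := by
  induction x generalizing u v y with
  | nil => simp [Dlw_nil]
  | cons d x ih =>
    rw [Dlw_cons, Dl_sh, map_add, map_add, mulc_hom _ hv, map_smul, map_smul, map_smul]
    rw [ih (v := Dl d v) hv (fun x1 x2 hx => h (d :: x1) x2 hx)]
    have hz : φ (Dlw x (sh t v (Dl d u))) = 0 := by
      by_cases h0 : Dl d u = 0
      · rw [h0]; simp
      · obtain ⟨w, hw⟩ := Function.ne_iff.1 h0
        have h1 := hv _ hw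
        have h2 := ih (u := Dl d u) (v := v) (y := w)
          (HomF_Dlw (x := [d]) (by rw [← deg_append]; exact h1 ▸ hv))
          (fun x1 x2 hx => h x1 (d :: x2) (by simp))
        rw [h2, show sh t (Dlw x v) (Dl d u) = sh t (Dlw x v) (Dlw [d] u) from rfl,
          h x [d] (by simp), mul_zero]
    rw [hz, add_zero, List.map_cons, List.prod_cons, smul_eq_mul, mul_assoc, Dlw_cons]

/-- elements of `UU` supported on words smaller than `m` -/
def Er (m : Word r) : Submodule k (Fn r k) where
  carrier := {e | e ∈ UU t ∧ ∀ w, e w ≠ 0 → w < m}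
  add_mem' := by
    rintro a b ⟨h1, h2⟩ ⟨h3, h4⟩
    refine ⟨add_mem h1 h3, fun w hw => ?_⟩
    by_cases h : a w = 0
    · apply h4; intro h'; apply hw; rw [Pi.add_apply, h, h', add_zero]
    · exact h2 w h
  zero_mem' := ⟨zero_mem _, fun w hw => absurd rfl hw⟩
  smul_mem' := by
    rintro c a ⟨h1, h2⟩
    refine ⟨Submodule.smul_mem _ _ h1, fun w hw => h2 w fun h => hw ?_⟩
    rw [Pi.smul_apply, h, smul_zero]

lemma Er_Dr {m : Word r} {e : Fn r k} (he : e ∈ Er t m) (c : Fin r) : Dr c e ∈ Er t m :=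
  ⟨UU_Dr t c he.1, fun w hw => lt_trans (lt_append_right w (s := [c]) (by simp)) (he.2 _ hw)⟩
lemma Er_Drw {m : Word r} {e : Fn r k} (he : e ∈ Er t m) (y : Word r) : Drw y e ∈ Er t m :=
  ⟨UU_Drw t y he.1, fun w hw => lt_of_le_of_lt (le_append_right w y) (he.2 _ hw)⟩
lemma Er_mulc {m : Word r} {e : Fn r k} (he : e ∈ Er t m) (s) : mulc s e ∈ Er t m :=
  ⟨UU_mulc t s he.1, fun w hw => he.2 w fun h => hw (by rw [mulc_apply, h, mul_zero])⟩
lemma Er_sh {m : Word r} (hm : IsLyndon m) {e e' : Fn r k} (he : e ∈ Er t m) (he' : e' ∈ Er t m) : sh t e e' ∈ Er t m :=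
  ⟨UU_sh t he.1 he'.1, sh_lt t hm he.2 he'.2⟩

lemma Drw_sh_left {m : Word r} (hm : IsLyndon m) {u v : Fn r k} (hu : u ∈ Er t m) (hv : ∀ c, Dr c v ∈ Er t m)
    (y : Word r) : Drw y (sh t u v) - sh t (Drw y u) v ∈ Er t m := by
  induction y with
  | nil => rw [Drw_nil, Drw_nil, sub_self]; exact zero_mem _
  | cons d y ih =>
    have h1 := Er_Dr t ih d
    rw [map_sub, Dr_sh] at h1
    rw [Drw_cons, Drw_cons]
    have h2 := Er_sh t hm (Er_mulc t (Er_Drw t hu y) (fun i => t i d)) (hv d)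
    have := add_mem h1 h2
    convert this using 1
    abel

lemma Drw_sh_right {m : Word r} (hm : IsLyndon m) {u v : Fn r k} (hu : u ∈ Er t m) (hv : ∀ c, Dr c v ∈ Er t m)
    {z : Word r} (hz : HomF v (deg z)) (y : Word r) :
    Drw y (sh t v u) - (y.map fun c => chi (fun i => t i c) z).prod • sh t v (Drw y u) ∈ Er t m := by
  induction y with
  | nil => rw [Drw_nil, Drw_nil]; simp
  | cons d y ih =>
    have h1 := Er_Dr t ih d
    rw [map_sub, map_smul, Dr_sh, mulc_hom _ hz, map_smul, LinearMap.smul_apply, smul_add, smul_smul] at h1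
    rw [Drw_cons, Drw_cons, List.map_cons, List.prod_cons]
    have h2 := Submodule.smul_mem _ (y.map fun c => chi (fun i => t i c) z).prod (Er_sh t hm (hv d) (Er_Drw t hu y))
    have := add_mem h1 h2
    convert this using 1
    rw [mul_comm (chi _ z)]
    abel

lemma hom_nil {u : Fn r k} (h : HomF u (deg [])) : u = u [] • de [] := by
  funext w
  by_cases hw : w = []
  · subst hw; simp [de_apply]
  · have : u w = 0 := by
      by_contra h0
      exact hw (List.eq_nil_of_length_eq_zero (by rw [length_of_deg (h w h0)]; rfl))
    simp [this, de_apply, hw]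

lemma Drw_hom {u : Fn r k} {ν} (h : HomF u ν) (y : Word r) :
    Drw y u = 0 ∨ ∃ x, HomF (Drw y u) (deg x) ∧ deg x + deg y = ν := by
  by_cases h0 : Drw y u = 0
  · exact Or.inl h0
  · obtain ⟨w, hw⟩ := Function.ne_iff.1 h0
    have h1 := h _ hw
    rw [deg_append] at h1
    exact Or.inr ⟨w, HomF_Drw (by rw [h1]; exact h), h1⟩
lemma Dlw_hom {u : Fn r k} {ν} (h : HomF u ν) (y : Word r) :
    Dlw y u = 0 ∨ ∃ x, HomF (Dlw y u) (deg x) ∧ deg y + deg x = ν := by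
  by_cases h0 : Dlw y u = 0
  · exact Or.inl h0
  · obtain ⟨w, hw⟩ := Function.ne_iff.1 h0
    have h1 := h _ hw
    rw [deg_append] at h1
    exact Or.inr ⟨w, HomF_Dlw (by rw [h1]; exact h), h1⟩

lemma Dlw_scalar {u : Fn r k} {l x : Word r} (h : HomF u (deg l)) (hx : deg x = deg l) :
    Dlw x u = u x • de [] := by
  have h1 := hom_nil (u := Dlw x u) (HomF_Dlw (by rw [deg_nil, add_zero, hx]; exact h))
  rw [h1]
  congr 1
  show u (x ++ []) = u x
  rw [List.append_nil]
lemma Drw_scalar {u : Fn r k} {l x : Word r} (h : HomF u (deg l)) (hx : deg x = deg l) :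
    Drw x u = u x • de [] := 
  hom_nil (u := Drw x u) (HomF_Drw (by rw [deg_nil, zero_add, hx]; exact h))
end

section
variable {C : CartanData r} {n : ℕ}

lemma SL.split {ls : List (Word r)} (h : SL ls) (l : Word r) :
    ∃ A B, ls = A ++ B ∧ (∀ a ∈ A, l ≤ a) ∧ (∀ b ∈ B, b < l) := by
  induction ls with
  | nil => exact ⟨[], [], rfl, by simp, by simp⟩
  | cons c ls ih =>
    by_cases hc : l ≤ c
    · obtain ⟨A, B, h1, h2, h3⟩ := ih h.tail
      refine ⟨c :: A, B, by rw [h1]; rfl, ?_, h3⟩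
      intro a ha
      rcases List.mem_cons.1 ha with rfl | ha
      exacts [hc, h2 a ha]
    · exact ⟨[], c :: ls, rfl, by simp, fun b hb => lt_of_le_of_lt (h.le_head hb) (not_le.1 hc)⟩

lemma HH.ap (H : HH C n) {l : Word r} (hl : GdL C l) (hn : l.length < n) {a w : Fn r K} {x y : Word r}
    (ha : a ∈ UU (tq C.p)) (hw : w ∈ UU (tq C.p)) (hx : HomF a (deg x)) (hy : HomF w (deg y)) (hx0 : x ≠ []) (hy0 : y ≠ [])
    (hlt : ∀ z, w z ≠ 0 → z < l) : pr (bb C l) (sh (tq C.p) a w) = 0 := by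
  by_cases hd : deg l = deg x + deg y
  swap
  · exact pr_hom_ne (bb_hom l) (hx.sh _ hy) hd
  have hlen : l.length = x.length + y.length := by
    rw [← deg_append] at hd; rw [length_of_deg hd, List.length_append]
  have hxp := List.length_pos_of_ne_nil hx0
  have hyp := List.length_pos_of_ne_nil hy0
  refine elim (ν := deg x) (P := fun _ => True) (fun _ _ _ _ => trivial) ?_ ((pr (bb C l)).comp ((sh (tq C.p)).flip w)) ?_ ha hx
    (fun _ _ => trivial)
  · intro g hg hgd _
    exact H.mxg hg (by rw [length_of_deg hgd]; omega)
  intro h hh hhd _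
  show pr (bb C l) (sh (tq C.p) (rr C h) w) = 0
  have hhl := length_of_deg hhd
  obtain ⟨A, B, hAB, hA, hB⟩ := (fac_SL h).split l
  have hSL : SL (A ++ B) := hAB ▸ fac_SL h
  have hmem : ∀ a ∈ A ++ B, GdL C a ∧ a.length < n := by
    intro a ha
    rw [← hAB] at ha
    have := mem_length ha
    rw [fac_flatten] at this
    exact ⟨fac_good hh ha, by omega⟩
  have hfl : h = A.flatten ++ B.flatten := by rw [← List.flatten_append, ← hAB, fac_flatten]
  have hrr : rr C h = sh (tq C.p) (rr C A.flatten) (rr C B.flatten) := by rw [← rr_append hSL, ← hfl]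
  rw [hrr, sh_assoc]
  have hBx := H.mx hSL.right (fun a ha => hmem a (by simp [ha]))
  have hw1 : ∀ z, sh (tq C.p) (rr C B.flatten) w z ≠ 0 → z < l :=
    sh_lt _ hl.2 (fun z hz => lt_of_le_of_lt (hBx.2.2 z hz) (flatten_lt hl.2 hB)) hlt
  have hw1m : sh (tq C.p) (rr C B.flatten) w ∈ UU (tq C.p) := UU_sh _ (rr_mem _) hw
  have hw1h : HomF (sh (tq C.p) (rr C B.flatten) w) (deg (B.flatten ++ y)) := by
    rw [deg_append]; exact (rr_hom _).sh _ hy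
  have hdl : deg l = deg A.flatten + deg (B.flatten ++ y) := by
    rw [deg_append, ← add_assoc, ← deg_append, ← hfl, hhd]; exact hd
  rcases A with _ | ⟨c, A⟩
  · rw [List.flatten_nil, rr_nil, sh_one_left]
    rw [H.T0 hl hn hw1m (by rw [hdl]; simpa [deg_nil] using hw1h) hw1, map_zero]
  refine elim (ν := deg (B.flatten ++ y)) (P := fun z => z < l) (fun w g h h' => lt_of_le_of_lt h h') ?_
    ((pr (bb C l)).comp (sh (tq C.p) (rr C (c :: A).flatten))) ?_ hw1m hw1h hw1
  all_goals 
    intro g hg hgd hgl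
    have hgln : g.length < n := by
      have h1 := length_of_deg hgd
      rw [List.length_append] at h1
      have h2 := congrArg List.length hfl
      rw [List.length_append] at h2
      omega
  · exact H.mxg hg hgln
  show pr (bb C l) (sh (tq C.p) (rr C (c :: A).flatten) (rr C g)) = 0
  have hS2 : SL ((c :: A) ++ fac g) := by
    refine hSL.left.append (fac_SL g) fun a ha b hb => ?_
    exact ((fac_SL g).all_lt (m := l) (by rwa [fac_flatten]) b hb).le.trans (hA a ha)
  have h1 := rr_append (C := C) hS2
  rw [fac_flatten] at h1
  rw [← h1, rr_symm]
  have h2 : (c :: A).flatten ++ g = ((c :: A) ++ fac g).flatten := by rw [List.flatten_append, fac_flatten]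
  have hgne : fac g ≠ [] := by
    intro h3
    have h4 := fac_flatten g
    rw [h3] at h4
    have h5 := length_of_deg hgd
    rw [← h4, List.length_append] at h5
    simp at h5; omega
  refine H.po l _ hl hn ?_ ?_ ?_
  · rw [h2]
    refine H.mkgood hS2 fun a ha => ?_
    rcases List.mem_append.1 ha with ha | ha
    · exact hmem a (by simp only [List.mem_append]; exact Or.inl ha)
    · exact ⟨fac_good hg ha, lt_of_le_of_lt (mem_length ha) (by rwa [fac_flatten])⟩
  · rw [deg_append, hgd, hdl]
  · intro h3
    have := List.length_pos_of_ne_nil hgne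
    exact not_lyndon_of hS2 (by simp; omega) (h2 ▸ h3 ▸ hl.2)

lemma HH.apx (H : HH C n) {l : Word r} (hl : GdL C l) (hn : l.length < n) {x : Word r} (hx : deg x ≠ deg l)
    {D : Fn r K} (hD : D ∈ UU (tq C.p)) {y : Word r} (hy : HomF D (deg y)) (hlt : ∀ z, D z ≠ 0 → z < l) :
    pr (bb C l) (sh (tq C.p) (Xi (tq C.p) x) D) = 0 := by
  by_cases hx0 : x = []
  · subst hx0
    rw [Xi_nil, sh_one_left]
    by_cases h : deg l = deg y
    · rw [H.T0 hl hn hD (h ▸ hy) hlt, map_zero]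
    · exact pr_hom_ne (bb_hom l) hy h
  by_cases hy0 : y = []
  · subst hy0
    rw [hom_nil hy, map_smul, sh_one_right, map_smul, pr_hom_ne (bb_hom l) (HomF.Xi _ x) (Ne.symm hx), smul_zero]
  exact H.ap hl hn (Xi_mem _ _) hD (HomF.Xi _ _) hy hx0 hy0 hlt

lemma HH.B (H : HH C n) {l m : Word r} (hl : GdL C l) (hn : l.length < n) (hm : GdL C m) (hmn : m.length < n) (hml : m ≤ l)
    {x : Word r} (hx : deg x ≠ deg l) (hne : m = l → x ≠ []) {b : Fn r K} (hb : b ∈ UU (tq C.p)) :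
    pr (bb C m) (sh (tq C.p) (Dlw x (rr C l)) b) = 0 := by
  obtain ⟨fa, hfa⟩ := UU_Dlw (tq C.p) x (rr_mem (C := C) l)
  rw [← hfa]
  refine pr_sh_zero _ hb fun y => ?_
  rw [pr_Dlw (tq C.p) hfa (UU_Drw _ _ (XiF_mem _ _))]
  show pr (bb C l) (sh (tq C.p) (Xi (tq C.p) x) (Drw y (rr C m))) = 0
  rcases Drw_hom (rr_hom (C := C) m) y with h | ⟨z, hz, hzd⟩
  · rw [h]; simp
  by_cases hy : y = []
  · subst hy
    rw [Drw_nil]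
    rcases hml.lt_or_eq with hlt | heq
    · exact H.apx hl hn hx (rr_mem _) (rr_hom _) fun w hw => lt_of_le_of_lt ((H.px m hm hmn).2.2 w hw) hlt
    · refine pr_hom_ne (bb_hom l) ((HomF.Xi _ x).sh _ (rr_hom m)) ?_
      rw [← deg_append, heq]
      intro h
      have h1 := length_of_deg h
      have h2 := List.length_pos_of_ne_nil (hne heq)
      rw [List.length_append] at h1; omega
  · exact H.apx hl hn hx (UU_Drw _ _ (rr_mem _)) hz fun w hw => 
      lt_of_lt_of_le (lt_of_lt_of_le (lt_append_right w hy) ((H.px m hm hmn).2.2 _ hw)) hml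

lemma HH.B' (H : HH C n) {l m : Word r} (hl : GdL C l) (hn : l.length < n) (hm : GdL C m) (hmn : m.length < n) (hml : m ≤ l)
    {x : Word r} (hne : m = l → x ≠ []) : pr (bb C m) (Dlw x (rr C l)) = 0 := by
  by_cases hx : deg x = deg l
  · rw [Dlw_scalar (rr_hom l) hx, map_smul, pr_hom_ne (bb_hom m) (HomF.de []), smul_zero]
    intro h
    have := length_of_deg h
    exact hm.2.1 (List.eq_nil_of_length_eq_zero this)
  · rw [← sh_one_right (tq C.p) (Dlw x (rr C l))]
    exact H.B hl hn hm hmn hml hx hne (UU_one _)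
end
end

section
set_option linter.all false
/-! ### Part 17 : the orthogonality and maximality at the next step -/

section
variable {C : CartanData r} {n : ℕ}

lemma pp_symm (C : CartanData r) (i j : Fin r) : C.p i j = C.p j i := C.dsymm i j

lemma perm_of_deg {w x : Word r} (h : deg w = deg x) : w.Perm x := by
  rw [List.perm_iff_count]; intro i; exact congrFun h i

lemma pairW_cons_right (p : Fin r → Fin r → ℤ) (w : Word r) (d : Fin r) (x : Word r) :
    pairW p w (d :: x) = pairW p w [d] + pairW p w x := by
  induction w with
  | nil => simp [pairW]
  | cons a w ih =>
    simp only [pairW, List.map_cons, List.sum_cons, List.map_nil, List.sum_nil, add_zero] at ih ⊢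
    rw [ih]; ring

lemma pairW_cons_left (p : Fin r → Fin r → ℤ) (w : Word r) (d : Fin r) (x : Word r) :
    pairW p (d :: w) x = pairW p [d] x + pairW p w x := by
  simp [pairW]

lemma pairW_single_comm (C : CartanData r) (d : Fin r) (w : Word r) : pairW C.p [d] w = pairW C.p w [d] := by
  simp only [pairW, List.map_cons, List.sum_cons, List.map_nil, List.sum_nil, add_zero]
  congr 1
  apply List.map_congr_left
  intro i _
  exact pp_symm C d i

lemma pairW_comm (C : CartanData r) (w x : Word r) : pairW C.p w x = pairW C.p x w := by
  induction w with
  | nil => simp [pairW]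
  | cons d w ih => rw [pairW_cons_left, pairW_cons_right, ih, pairW_single_comm]

lemma kapq (C : CartanData r) (w x : Word r) :
    (x.map fun d => chi (fun i => tq C.p i d) w).prod = qq ^ (-(pairW C.p w x)) := by
  induction x with
  | nil => simp [pairW]
  | cons d x ih =>
    rw [List.map_cons, List.prod_cons, ih, chi_tq, pairW_cons_right C.p w d x, neg_add, zpow_add₀ qq_ne]

lemma tq_symm (C : CartanData r) (d : Fin r) : tq C.p d = fun i => tq C.p i d := by
  funext i; rw [tq, tq, pp_symm]

lemma kap1 (C : CartanData r) {l1 l2 y : Word r} (hy : deg y = deg l1) :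
    cq C.p l1 l2 * (y.map fun d => chi (fun i => tq C.p i d) l2).prod = 1 := by
  rw [kapq, cq, pairW_comm C l2 y, pairW_perm C.p (perm_of_deg hy) (List.Perm.refl l2), ← zpow_add₀ qq_ne, add_neg_cancel, zpow_zero]

lemma kap2 (C : CartanData r) {l1 l2 x : Word r} (hx : deg x = deg l2) :
    cq C.p l1 l2 * (x.map fun d => chi (tq C.p d) l1).prod = 1 := by
  have : (x.map fun d => chi (tq C.p d) l1) = (x.map fun d => chi (fun i => tq C.p i d) l1) := by
    apply List.map_congr_left; intro d _; rw [tq_symm C d]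
  rw [this, kapq, cq, pairW_perm C.p (List.Perm.refl l1) (perm_of_deg hx), ← zpow_add₀ qq_ne, add_neg_cancel, zpow_zero]

variable (C) in
/-- the q-commutator of two root vectors -/
def RR (l1 l2 : Word r) : Fn r K :=
  sh (tq C.p) (rr C l1) (rr C l2) - cq C.p l1 l2 • sh (tq C.p) (rr C l2) (rr C l1)

/-- main cancellation, left version -/
lemma HH.P3 (H : HH C n) {l1 l2 m : Word r} (h1 : GdL C l1) (h2 : GdL C l2) (hm : GdL C m)
    (hn1 : l1.length < n) (hn2 : l2.length < n) (hmn : m.length < n) (hlt : l1 < l2) (hml : m ≤ l1) (x : Word r) :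
    pr (bb C m) (Dlw x (RR C l1 l2)) = 0 := by
  have hm2 : m < l2 := lt_of_le_of_lt hml hlt
  have hne2 : m ≠ l2 := hm2.ne
  rw [RR, map_sub, map_sub, map_smul, map_smul]
  rw [Dlw_sh_left (tq C.p) (pr (bb C m)) x ⟨l2, rr_hom l2⟩]
  rw [Dlw_sh_right (tq C.p) (pr (bb C m)) x (rr_hom l1)]
  · by_cases hx : deg x = deg l2
    · rw [Dlw_scalar (rr_hom l2) hx]
      simp only [map_smul, LinearMap.smul_apply, sh_one_left, sh_one_right, smul_eq_mul]
      rw [← mul_assoc, kap2 C hx, one_mul, sub_self]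
    · rw [H.B h2 hn2 hm hmn hm2.le hx (fun h => absurd h hne2) (rr_mem l1), mul_zero, smul_zero, sub_zero]
      rcases hml.lt_or_eq with hl | hl
      · have := H.B h1 hn1 hm hmn hml (x := []) (fun h => h1.ne (List.eq_nil_of_length_eq_zero (length_of_deg h).symm))
          (fun h => absurd h hl.ne) (UU_Dlw (tq C.p) x (rr_mem (C := C) l2))
        exact this
      · rcases Dlw_hom (rr_hom (C := C) l2) x with h | ⟨z, hz, hzd⟩
        · rw [h]; simp
        · refine pr_hom_ne (bb_hom m) ((rr_hom l1).sh _ hz) ?_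
          rw [hl]
          intro h
          apply hx
          have h0 : deg z = 0 := by
            funext i
            have := congrFun h i
            simp only [Pi.add_apply] at this
            show deg z i = 0
            omega
          rw [← hzd, h0, add_zero]
  · intro x1 x2 hx2
    by_cases hx : deg x1 = deg l2
    · rw [Dlw_scalar (rr_hom l2) hx, map_smul, LinearMap.smul_apply, sh_one_left, map_smul,
        H.B' h1 hn1 hm hmn hml (fun _ => hx2), smul_zero]
    · exact H.B h2 hn2 hm hmn hm2.le hx (fun h => absurd h hne2) (UU_Dlw _ _ (rr_mem _))
  · intro x1 x2 hx1
    by_cases hx : deg x1 = deg l1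
    · rw [Dlw_scalar (rr_hom l1) hx, map_smul, LinearMap.smul_apply, sh_one_left, map_smul,
        H.B' h2 hn2 hm hmn hm2.le (fun h => absurd h hne2), smul_zero]
    · exact H.B h1 hn1 hm hmn hml hx (fun _ => hx1) (UU_Dlw _ _ (rr_mem _))

lemma RR_mem (l1 l2 : Word r) : RR C l1 l2 ∈ UU (tq C.p) :=
  sub_mem (UU_sh _ (rr_mem _) (rr_mem _)) (Submodule.smul_mem _ _ (UU_sh _ (rr_mem _) (rr_mem _)))

lemma RR_hom (l1 l2 : Word r) : HomF (RR C l1 l2) (deg (l1 ++ l2)) := by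
  rw [deg_append]
  refine ((rr_hom l1).sh _ (rr_hom l2)).sub (HomF.smul _ ?_)
  rw [add_comm]
  exact (rr_hom l2).sh _ (rr_hom l1)

/-- main cancellation, right version -/
lemma HH.P2 (H : HH C n) {l1 l2 : Word r} (h1 : GdL C l1) (h2 : GdL C l2)
    (hn1 : l1.length < n) (hn2 : l2.length < n) (hlt : l1 < l2) {y : Word r} (hy : deg y = deg l1) :
    Drw y (RR C l1 l2) = 0 := by
  have hu : rr C l1 ∈ Er (tq C.p) l2 := ⟨rr_mem _, fun w hw => lt_of_le_of_lt ((H.px l1 h1 hn1).2.2 w hw) hlt⟩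
  have hv : ∀ c, Dr c (rr C l2) ∈ Er (tq C.p) l2 := fun c =>
    ⟨UU_Dr _ c (rr_mem _), fun w hw => lt_of_lt_of_le (lt_append_right w (s := [c]) (by simp)) ((H.px l2 h2 hn2).2.2 _ hw)⟩
  have e1 := Drw_sh_left (tq C.p) h2.2 hu hv y
  have e2 := Drw_sh_right (tq C.p) h2.2 hu hv (rr_hom l2) y
  rw [Drw_scalar (rr_hom l1) hy, map_smul, LinearMap.smul_apply, sh_one_left] at e1
  rw [Drw_scalar (rr_hom l1) hy, map_smul, sh_one_right] at e2
  have e3 := sub_mem e1 (Submodule.smul_mem _ (cq C.p l1 l2) e2)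
  rw [smul_sub, smul_smul, kap1 C hy, one_smul] at e3
  have e4 : Drw y (RR C l1 l2) ∈ Er (tq C.p) l2 := by
    convert e3 using 1
    rw [RR, map_sub, map_smul]
    abel
  refine H.T0 h2 hn2 e4.1 (HomF_Drw ?_) e4.2
  rw [hy, add_comm, ← deg_append]
  exact RR_hom l1 l2

lemma HH.P4 (H : HH C n) {l1 l2 : Word r} (hl : GdL C (l1 ++ l2)) (h1 : GdL C l1) (h2 : GdL C l2)
    (hn : (l1 ++ l2).length ≤ n) (hn1 : l1.length < n) (hn2 : l2.length < n) {ini : List (Word r)} {m : Word r}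
    (hS : SL (ini ++ [m])) (hG : ∀ a ∈ ini ++ [m], GdL C a) (hd : deg (ini ++ [m]).flatten = deg (l1 ++ l2))
    (hml : m.length < (l1 ++ l2).length) (hlt : ∀ a ∈ ini, a < l2) : m ≤ l1 := by
  rw [← not_lt]
  intro hm1
  obtain ⟨_, b, hb, hbl⟩ := H.TS hl hn hG hd
  have hmb : m ≤ b := by
    rcases List.mem_append.1 hb with hb | hb
    · exact (List.pairwise_append.1 hS.2).2.2 b hb m (by simp)
    · simp at hb; exact hb.ge
  have hmlt : m < l1 ++ l2 := by
    refine lt_of_le_of_ne (hmb.trans hbl) ?_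
    rintro h; rw [h] at hml; exact lt_irrefl _ hml
  have hp : l1 <+: m := by
    by_contra hp
    have := lt_of_not_prefix hm1 hp l2 []
    rw [List.append_nil] at this
    exact lt_asymm hmlt this
  obtain ⟨y, rfl⟩ := hp
  have hy2 : y < l2 := (append_lt_append_left_iff l1 _ _).1 hmlt
  have hgy : Good (tq C.p) y := Good.right _ (hG (l1 ++ y) (by simp)).1
  obtain ⟨⟨a, ha, hla⟩, _⟩ := H.ts l2 h2 hn2 (fac y ++ ini) (fun a ha => by
    rcases List.mem_append.1 ha with ha | ha
    · exact fac_good hgy ha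
    · exact hG a (by simp [ha])) (by
    rw [List.flatten_append, fac_flatten, deg_append]
    rw [List.flatten_append, List.flatten_singleton, deg_append, deg_append, deg_append] at hd
    funext i
    have := congrFun hd i
    simp only [Pi.add_apply] at this ⊢
    omega)
  rcases List.mem_append.1 ha with ha | ha
  · exact absurd hla (not_le.2 ((fac_SL y).all_lt (m := l2) (by rwa [fac_flatten]) a ha))
  · exact absurd hla (not_le.2 (hlt a ha))

lemma HH.ortho (H : HH C n) {l1 l2 : Word r} (hl : GdL C (l1 ++ l2)) (h1 : GdL C l1) (h2 : GdL C l2)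
    (hn : (l1 ++ l2).length ≤ n) (hlt : l1 < l2) {g : Word r} (hg : Good (tq C.p) g) (hgl : ¬ IsLyndon g)
    (hd : deg g = deg (l1 ++ l2)) : pr (bb C g) (RR C l1 l2) = 0 := by
  have hp1 := List.length_pos_of_ne_nil h1.ne
  have hp2 := List.length_pos_of_ne_nil h2.ne
  have hlen := length_of_deg hd
  have hn' := hn
  rw [List.length_append] at hn' hlen
  have hn1 : l1.length < n := by omega
  have hn2 : l2.length < n := by omega
  have hgne : g ≠ [] := by rintro rfl; simp at hlen; omega
  have hSL := fac_SL g
  have hfl := fac_flatten g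
  have hlens : ∀ a ∈ fac g, a.length < g.length := fun a ha => mem_fac_lt hgl ha
  have hGd : ∀ a ∈ fac g, GdL C a := fun a ha => fac_good hg ha
  have h2l := fac_length hgl hgne
  generalize fac g = L at hSL hfl hlens hGd h2l
  rcases L with _ | ⟨g1, rest⟩
  · simp at h2l
  rcases lt_trichotomy l2 g1 with hc | hc | hc
  · apply (bb_tri g).pr_zero
    intro w hw
    have hg1 : IsLyndon g1 := hSL.head
    have hu : ∀ z, rr C l1 z ≠ 0 → z < g1 := fun z hz => lt_of_le_of_lt ((H.px l1 h1 hn1).2.2 z hz) (hlt.trans hc)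
    have hv : ∀ z, rr C l2 z ≠ 0 → z < g1 := fun z hz => lt_of_le_of_lt ((H.px l2 h2 hn2).2.2 z hz) hc
    have hw1 : w < g1 := by
      by_cases h0 : sh (tq C.p) (rr C l1) (rr C l2) w = 0
      · refine sh_lt (tq C.p) hg1 hv hu w fun h3 => hw ?_
        rw [RR, Pi.sub_apply, Pi.smul_apply, h0, h3, smul_zero, sub_zero]
      · exact sh_lt _ hg1 hu hv w h0
    refine lt_of_lt_of_le hw1 ?_
    rw [← hfl, List.flatten_cons]
    exact le_append_right _ _
  · subst hc
    have hb := bb_append (C := C) (ls := [l2]) (ms := rest) hSL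
    rw [List.flatten_singleton, ← List.flatten_cons, hfl] at hb
    rw [hb, pr_cm]
    rw [← map_zero (pr (bb C rest.flatten))]
    apply pr_congr
    intro y hy
    have hyd := bb_hom _ y hy
    have hyd1 : deg y = deg l1 := by
      rw [hyd]
      have hd' := hd
      rw [← hfl, List.flatten_cons, deg_append, deg_append, add_comm] at hd'
      exact add_right_cancel hd'
    have := H.P2 h1 h2 hn1 hn2 hlt hyd1
    show pr (bb C l2) (Drw y (RR C l1 l2)) = 0
    rw [this, map_zero]
  · have hall : ∀ a ∈ g1 :: rest, a < l2 := fun a ha => lt_of_le_of_lt (hSL.le_head ha) hc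
    rcases List.eq_nil_or_concat (g1 :: rest) with h0 | ⟨ini, m, h0⟩
    · simp at h0
    rw [List.concat_eq_append] at h0
    rw [h0] at hSL hfl hlens hGd h2l hall
    have hmm : m ∈ ini ++ [m] := by simp
    have hmlen := hlens m hmm
    have hm1 := H.P4 hl h1 h2 hn hn1 hn2 hSL hGd (by rw [hfl, hd]) (by rw [List.length_append]; omega)
      (fun a ha => hall a (by simp [ha]))
    have hb := bb_append (C := C) (ls := ini) (ms := [m]) hSL
    rw [← List.flatten_append, hfl, List.flatten_singleton] at hb
    rw [hb, pr_cm, Lop_eq_sum, map_sum]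
    apply Finset.sum_eq_zero
    intro x _
    rw [map_smul, H.P3 h1 h2 (hGd m hmm) hn1 hn2 (by omega) hlt hm1, smul_zero]

lemma rr_ne {l : Word r} (hl : GdL C l) : rr C l ≠ 0 := by
  intro h
  obtain ⟨u, hu, h1, h2, h3⟩ := hl.1
  have h4 := (XiF_eq_zero_iff (tq C.p) (bb C l)).1 h u hu
  rw [(bb_tri l).pr h3] at h4
  exact h2 h4

lemma HH.orthoL (H : HH C n) {l : Word r} (hl : GdL C l) (hn : l.length ≤ n) {g : Word r} (hg : Good (tq C.p) g)
    (hgl : ¬ IsLyndon g) (hd : deg g = deg l) : pr (bb C g) (rr C l) = 0 := by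
  have key : ∀ l, IsLyndon l → GdL C l → l.length ≤ n → deg g = deg l → pr (bb C g) (rr C l) = 0 := by
    apply lyndon_rec
    · intro i hi _ hd
      exfalso
      apply hgl
      have := List.perm_singleton.1 (perm_of_deg hd)
      rw [this]; exact hi.2
    · intro l1 l2 h1 h2 h12 hlt hb _ _ hl hn hd
      have e : rr C (l1 ++ l2) = RR C l1 l2 := by
        rw [rr, bb_lyndon h12, hb, map_sub, map_smul, XiF_cm, XiF_cm, ← bb_lyndon h1, ← bb_lyndon h2]
        rfl
      rw [e]
      exact H.ortho hl ⟨Good.left _ hl.1, h1⟩ ⟨Good.right _ hl.1, h2⟩ hn hlt hg hgl hd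
  exact key l hl.2 hl hn hd

lemma HH.PO (H : HH C n) {l : Word r} (hl : GdL C l) (hn : l.length ≤ n) {g : Word r} (hg : Good (tq C.p) g)
    (hd : deg g = deg l) (hne : g ≠ l) : pr (bb C g) (rr C l) = 0 := by
  refine H.orthoL hl hn hg (fun hL => hne ?_) hd
  exact (H.M1 hl ⟨hg, hL⟩ hn hd.symm).symm

lemma HH.PX (H : HH C n) {l : Word r} (hl : GdL C l) (hn : l.length ≤ n) : IsMx (rr C l) l := by
  obtain ⟨w, hw⟩ := Function.ne_iff.1 (rr_ne hl)
  obtain ⟨g, a1, a2, a3, a4, a5, a6⟩ := exists_good (rr_mem l) (rr_hom l) hw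
  have : g = l := by
    by_contra h
    exact a6 (H.PO hl hn a1 a2 h)
  subst this
  exact ⟨rr_hom g, a4, a5⟩

lemma HH_all (C : CartanData r) (n : ℕ) : HH C n := by
  induction n with
  | zero =>
    constructor <;> intros <;> simp_all
  | succ n H =>
    exact
      { m1 := fun l l' hl hl' hn hd => H.M1 hl hl' (Nat.lt_succ_iff.1 hn) hd
        m2 := fun w hw hn hR => H.M2 hw (Nat.lt_succ_iff.1 hn) hR
        m3 := fun l hl hn => H.M3 hl (Nat.lt_succ_iff.1 hn)
        x := fun l hl hn => H.XX hl (Nat.lt_succ_iff.1 hn)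
        ts := fun l hl hn ls hls hd => H.TS hl (Nat.lt_succ_iff.1 hn) hls hd
        px := fun l hl hn => H.PX hl (Nat.lt_succ_iff.1 hn)
        po := fun l g hl hn hg hd hne => H.PO hl (Nat.lt_succ_iff.1 hn) hg hd hne }

lemma good_isMx (C : CartanData r) {g : Word r} (hg : Good (tq C.p) g) : IsMx (rr C g) g :=
  (HH_all C (g.length + 1)).mxg hg (Nat.lt_succ_self _)

lemma main_aux (C : CartanData r) {g : Word r} (hg : IsGood C.p g) {ls : List (Word r)} (h1 : ∀ l ∈ ls, IsLyndon l)
    (h2 : ls.IsChain (fun a b => wle b a)) (h3 : ls.flatten = g) : IsMaxWord (xi C.p (cprod C.p ls)) g := by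
  have hc : ls.IsChain (fun a b => b ≤ a) := h2.imp fun a b h => (wle_iff _ _).1 h
  haveI : IsTrans (Word r) (fun a b => b ≤ a) := ⟨fun a b c h h' => h'.trans h⟩
  have hS : SL ls := ⟨h1, List.isChain_iff_pairwise.1 hc⟩
  have hm := good_isMx C (IsGood.good _ hg)
  have e : ⇑(xi C.p (cprod C.p ls)) = rr C g := by
    rw [xi_coe, cprod_eq, ← bb_flat hS, h3]; rfl
  refine ⟨?_, fun w hw => ?_⟩
  · rw [e]; exact hm.2.1
  · rw [wle_iff]
    apply hm.2.2
    rw [← e]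
    exact Finsupp.mem_support_iff.1 hw
end
end

/-- Theorem 4.9: for every good word `g`, the maximal word of `r_g = Ξ([g])` is `g`
itself, where `[g] = [l₁]⋯[l_k]` for the canonical nonincreasing Lyndon factorization
`g = l₁⋯l_k`. -/
theorem max_word_of_lyndon_basis_element {r : ℕ} (hr : 1 ≤ r) (C : CartanData r)
    (Lf : Word r → List (Word r))
    (hLf : ∀ w : Word r, (∀ l ∈ Lf w, IsLyndon l) ∧
      List.Chain' (fun a b => wle b a) (Lf w) ∧ (Lf w).flatten = w)
    (g : Word r) (hg : IsGood C.p g) :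
    IsMaxWord (xi C.p (cprod C.p (Lf g))) g := by
  obtain ⟨h1, h2, h3⟩ := hLf g
  exact main_aux C hg h1 h2 h3
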